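/- arXiv:2503.08590 — 13 statements merged into one kernel-verified Lean document; each statement's English description precedes it below -/
import Mathlib

section
/- Let s < t be real numbers and let f : ℝ → ℝ be continuously differentiable on [s,t]. Then the mean oscillation of f over I = [s,t] satisfies MO_I(f) ≤ (1/2) ∫_s^t |f'(x)| dx; that is, (1/(t-s)) ∫_s^t |f(x) - f_I| dx ≤ (1/2) ∫_s^t |f'(x)| dx. -/
open MeasureTheory intervalIntegral

/-- A function with values in `[m, M]` on `[s, t]` has mean oscillation at most `(M - m) / 2`. -/
theorem mean_oscillation_le_half_of_mem_Icc {s t m M : ℝ} (hst : s < t) {f : ℝ → ℝ}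
    (hf : IntervalIntegrable f volume s t) (hm : ∀ x ∈ Set.Icc s t, f x ∈ Set.Icc m M) :
    (1 / (t - s)) * ∫ x in s..t, |f x - (1 / (t - s)) * ∫ y in s..t, f y| ≤ (M - m) / 2 := by
  have hts : 0 < t - s := sub_pos.2 hst
  set c := (1 / (t - s)) * ∫ y in s..t, f y with hc
  have hint : ∫ y in s..t, f y = (t - s) * c := by rw [hc]; field_simp
  have hmc : m ≤ c := by
    have h := integral_mono_on hst.le (intervalIntegrable_const (c := m)) hf
      fun x hx => (hm x hx).1
    rw [intervalIntegral.integral_const, smul_eq_mul, hint] at h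
    exact le_of_mul_le_mul_left h hts
  have hcM : c ≤ M := by
    have h := integral_mono_on hst.le hf (intervalIntegrable_const (c := M))
      fun x hx => (hm x hx).2
    rw [intervalIntegral.integral_const, smul_eq_mul, hint] at h
    exact le_of_mul_le_mul_left h hts
  have habs : IntervalIntegrable (fun x => |f x - c|) volume s t :=
    (hf.sub intervalIntegrable_const).abs
  rw [one_div, inv_mul_le_iff₀ hts]
  rcases (hmc.trans hcM).eq_or_lt with rfl | hlt
  · have hzero : ∫ x in s..t, |f x - c| ≤ ∫ _ in s..t, (0 : ℝ) :=
      integral_mono_on hst.le habs intervalIntegrable_const fun x hx => by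
        have h := hm x hx
        rw [abs_le]
        constructor <;> linarith [h.1, h.2]
    simpa using hzero
  have hchord : ∀ x ∈ Set.Icc s t, (M - m) * |f x - c| ≤
      ((c - m) * M - (M - c) * m) + (M + m - 2 * c) * f x := by
    intro x hx
    obtain ⟨h₁, h₂⟩ := hm x hx
    rcases abs_cases (f x - c) with ⟨h, _⟩ | ⟨h, _⟩ <;> rw [h]
    · nlinarith [mul_nonneg (sub_nonneg.2 hmc) (sub_nonneg.2 h₂)]
    · nlinarith [mul_nonneg (sub_nonneg.2 hcM) (sub_nonneg.2 h₁)]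
  have h := integral_mono_on hst.le (habs.const_mul (M - m))
    (intervalIntegrable_const.add (hf.const_mul (M + m - 2 * c))) hchord
  rw [intervalIntegral.integral_const_mul,
    intervalIntegral.integral_add intervalIntegrable_const (hf.const_mul _),
    intervalIntegral.integral_const_mul, intervalIntegral.integral_const, smul_eq_mul, hint] at h
  refine le_of_mul_le_mul_left (h.trans ?_) (sub_pos.2 hlt)
  nlinarith [mul_nonneg hts.le (sq_nonneg (M + m - 2 * c))]

/-- The increment of a continuously differentiable function between two points of `[s, t]` is at
most its total variation on `[s, t]`. -/
theorem sub_le_integral_abs_deriv {s t : ℝ} (hst : s ≤ t) {f f' : ℝ → ℝ}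
    (hderiv : ∀ x ∈ Set.Icc s t, HasDerivWithinAt f (f' x) (Set.Icc s t) x)
    (hcont : ContinuousOn f' (Set.Icc s t)) {a b : ℝ} (ha : a ∈ Set.Icc s t)
    (hb : b ∈ Set.Icc s t) :
    f b - f a ≤ ∫ x in s..t, |f' x| := by
  have hsub : Set.uIcc a b ⊆ Set.Icc s t := Set.uIcc_subset_Icc ha hb
  have hftc : ∫ x in a..b, f' x = f b - f a := by
    refine integral_eq_sub_of_hasDeriv_right
      (fun x hx => (hderiv x (hsub hx)).continuousWithinAt.mono hsub) (fun x hx => ?_)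
      (hcont.mono hsub).intervalIntegrable
    have h₁ : s < x := (le_min ha.1 hb.1).trans_lt hx.1
    have h₂ : x < t := hx.2.trans_le (max_le ha.2 hb.2)
    exact ((hderiv x ⟨h₁.le, h₂.le⟩).hasDerivAt (Icc_mem_nhds h₁ h₂)).hasDerivWithinAt
  have hsub' : Set.uIoc a b ⊆ Set.Ioc s t :=
    Set.Ioc_subset_Ioc (le_min ha.1 hb.1) (max_le ha.2 hb.2)
  have hint : IntegrableOn (fun x => |f' x|) (Set.Ioc s t) :=
    hcont.abs.integrableOn_Icc.mono_set Set.Ioc_subset_Icc_self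
  rw [← hftc, integral_of_le hst]
  calc ∫ x in a..b, f' x ≤ ‖∫ x in a..b, f' x‖ := Real.le_norm_self _
    _ ≤ ∫ x in Set.uIoc a b, ‖f' x‖ := norm_integral_le_integral_norm_uIoc
    _ ≤ ∫ x in Set.Ioc s t, |f' x| :=
      setIntegral_mono_set hint (Filter.Eventually.of_forall fun x => abs_nonneg (f' x))
        hsub'.eventuallyLE

/-- If `f` is continuously differentiable on `[s,t]` (with derivative `f'`),
then the mean oscillation of `f` over `I = [s,t]` is at most `(1/2) ∫_s^t |f'(x)| dx`. -/
theorem mean_oscillation_le_half_total_variation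
    (s t : ℝ) (hst : s < t) (f f' : ℝ → ℝ)
    (hderiv : ∀ x ∈ Set.Icc s t, HasDerivWithinAt f (f' x) (Set.Icc s t) x)
    (hcont : ContinuousOn f' (Set.Icc s t)) :
    (1 / (t - s)) * ∫ x in s..t, |f x - (1 / (t - s)) * ∫ y in s..t, f y| ≤
      (1 / 2) * ∫ x in s..t, |f' x| := by
  have hf : ContinuousOn f (Set.Icc s t) := fun x hx => (hderiv x hx).continuousWithinAt
  obtain ⟨a, ha, hmin⟩ := isCompact_Icc.exists_isMinOn (Set.nonempty_Icc.2 hst.le) hf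
  have h := mean_oscillation_le_half_of_mem_Icc (m := f a) (M := f a + ∫ x in s..t, |f' x|) hst
    (hf.intervalIntegrable_of_Icc hst.le) fun x hx =>
      ⟨hmin hx, by linarith [sub_le_integral_abs_deriv hst.le hderiv hcont ha hx]⟩
  linarith
end

section
/- Let s < t be real numbers and let f, g : ℝ → ℝ be integrable on I = [s,t] and satisfy |f(x₁) - f(x₂)| ≤ |g(x₁) - g(x₂)| for all x₁, x₂ ∈ I. Then MO_I(f) ≤ 2 · MO_I(g). -/
open MeasureTheory intervalIntegral

/-- If `f` oscillates no more than `g` between `x` and any other point of `[s, t]`, then the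
deviation of `f x` from the mean of `f` is at most the deviation of `g x` from any constant `c`
plus the mean deviation of `g` from `c`. -/
theorem abs_sub_mean_le_abs_sub_add_mean {s t : ℝ} (hst : s < t) {f g : ℝ → ℝ}
    (hf : IntervalIntegrable f volume s t) (hg : IntervalIntegrable g volume s t) {x : ℝ}
    (hosc : ∀ y ∈ Set.Icc s t, |f x - f y| ≤ |g x - g y|) (c : ℝ) :
    |f x - (1 / (t - s)) * ∫ y in s..t, f y| ≤
      |g x - c| + (1 / (t - s)) * ∫ y in s..t, |g y - c| := by
  have hpos : 0 < t - s := sub_pos.2 hst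
  have hgc : IntervalIntegrable (fun y => |g y - c|) volume s t :=
    (hg.sub intervalIntegrable_const).abs
  have hfx : IntervalIntegrable (fun y => f x - f y) volume s t :=
    intervalIntegrable_const.sub hf
  have hmean : f x - (1 / (t - s)) * ∫ y in s..t, f y =
      (1 / (t - s)) * ∫ y in s..t, (f x - f y) := by
    rw [integral_sub intervalIntegrable_const hf, intervalIntegral.integral_const, smul_eq_mul]
    field_simp
  have hmajor : |g x - c| + (1 / (t - s)) * ∫ y in s..t, |g y - c| =
      (1 / (t - s)) * ∫ y in s..t, (|g x - c| + |g y - c|) := by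
    rw [integral_add intervalIntegrable_const hgc, intervalIntegral.integral_const, smul_eq_mul]
    field_simp
  rw [hmean, hmajor, abs_mul, abs_of_pos (one_div_pos.2 hpos)]
  gcongr
  refine (abs_integral_le_integral_abs hst.le).trans
    (integral_mono_on hst.le hfx.abs (intervalIntegrable_const.add hgc) fun y hy => ?_)
  calc |f x - f y| ≤ |g x - g y| := hosc y hy
    _ ≤ |g x - c| + |c - g y| := abs_sub_le _ _ _
    _ = |g x - c| + |g y - c| := by rw [abs_sub_comm c]

/-- If `f, g` are integrable on `I = [s,t]` and
`|f(x₁) - f(x₂)| ≤ |g(x₁) - g(x₂)|` for all `x₁, x₂ ∈ I`, then `MO_I(f) ≤ 2 · MO_I(g)`. -/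
theorem mean_oscillation_le_two_mul_of_osc_le
    (s t : ℝ) (hst : s < t) (f g : ℝ → ℝ)
    (hf : IntervalIntegrable f volume s t) (hg : IntervalIntegrable g volume s t)
    (hosc : ∀ x₁ ∈ Set.Icc s t, ∀ x₂ ∈ Set.Icc s t, |f x₁ - f x₂| ≤ |g x₁ - g x₂|) :
    (1 / (t - s)) * ∫ x in s..t, |f x - (1 / (t - s)) * ∫ y in s..t, f y| ≤
      2 * ((1 / (t - s)) * ∫ x in s..t, |g x - (1 / (t - s)) * ∫ y in s..t, g y|) := by
  have hpos : 0 < t - s := sub_pos.2 hst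
  set c := (1 / (t - s)) * ∫ y in s..t, g y
  have hgc : IntervalIntegrable (fun y => |g y - c|) volume s t :=
    (hg.sub intervalIntegrable_const).abs
  have hmono := integral_mono_on hst.le (hf.sub intervalIntegrable_const).abs
    (hgc.add intervalIntegrable_const)
    fun x hx => abs_sub_mean_le_abs_sub_add_mean hst hf hg (hosc x hx) c
  rw [integral_add hgc intervalIntegrable_const, intervalIntegral.integral_const, smul_eq_mul,
    ← mul_assoc, mul_one_div_cancel hpos.ne', one_mul, ← two_mul] at hmono
  rw [mul_left_comm]
  gcongr
end

section
/- Let s < t be real numbers and let f, g : ℝ → ℝ be monotone nondecreasing on I = [s,t], integrable on I, and satisfy |f(x₁) - f(x₂)| ≤ |g(x₁) - g(x₂)| for all x₁, x₂ ∈ I. Then MO_I(f) ≤ MO_I(g). -/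
open MeasureTheory intervalIntegral

/-- For real functions `f` and `h` that are monotone on a set, some affine function of `h` is a
lower bound of `|f + h| - |f|` there. -/
theorem exists_abs_add_mul_le_abs_add {α : Type*} [LinearOrder α] {S : Set α} {f h : α → ℝ}
    (hf : MonotoneOn f S) (hh : MonotoneOn h S) :
    ∃ k : ℝ, ∀ x ∈ S, |f x| + k * h x ≤ |f x + h x| := by
  by_cases hpos : ∃ y ∈ S, 0 < f y ∧ h y < 0
  · obtain ⟨y, hy, hfy, hhy⟩ := hpos
    refine ⟨1, fun x hx => ?_⟩
    rcases le_total x y with hxy | hxy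
    · have := hh hx hy hxy
      grind
    · have := hf hy hx hxy
      grind
  by_cases hneg : ∃ y ∈ S, f y < 0 ∧ 0 < h y
  · obtain ⟨y, hy, hfy, hhy⟩ := hneg
    refine ⟨-1, fun x hx => ?_⟩
    rcases le_total x y with hxy | hxy
    · have := hf hx hy hxy
      grind
    · have := hh hy hx hxy
      grind
  refine ⟨0, fun x hx => ?_⟩
  push Not at hpos hneg
  have := hpos x hx
  have := hneg x hx
  grind

/-- Adding a monotone function with zero integral does not decrease the `L¹` norm of a
monotone function. -/
theorem integral_abs_le_integral_abs_add_of_monotoneOn {s t : ℝ} (hst : s ≤ t) {f h : ℝ → ℝ}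
    (hfm : MonotoneOn f (Set.Icc s t)) (hhm : MonotoneOn h (Set.Icc s t))
    (hf : IntervalIntegrable f volume s t) (hh : IntervalIntegrable h volume s t)
    (hzero : ∫ x in s..t, h x = 0) :
    ∫ x in s..t, |f x| ≤ ∫ x in s..t, |f x + h x| := by
  obtain ⟨k, hk⟩ := exists_abs_add_mul_le_abs_add hfm hhm
  calc ∫ x in s..t, |f x| = ∫ x in s..t, (|f x| + k * h x) := by
        rw [integral_add hf.abs (hh.const_mul k), intervalIntegral.integral_const_mul, hzero,
          mul_zero, add_zero]
    _ ≤ ∫ x in s..t, |f x + h x| :=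
        integral_mono_on hst (hf.abs.add (hh.const_mul k)) (hf.add hh).abs hk

/-- If `f, g` are monotone nondecreasing and integrable on `I = [s,t]` and
`|f(x₁) - f(x₂)| ≤ |g(x₁) - g(x₂)|` for all `x₁, x₂ ∈ I`, then `MO_I(f) ≤ MO_I(g)`. -/
theorem mean_oscillation_le_of_osc_le_of_monotone
    (s t : ℝ) (hst : s < t) (f g : ℝ → ℝ)
    (hfm : MonotoneOn f (Set.Icc s t)) (hgm : MonotoneOn g (Set.Icc s t))
    (hf : IntervalIntegrable f volume s t) (hg : IntervalIntegrable g volume s t)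
    (hosc : ∀ x₁ ∈ Set.Icc s t, ∀ x₂ ∈ Set.Icc s t, |f x₁ - f x₂| ≤ |g x₁ - g x₂|) :
    (1 / (t - s)) * ∫ x in s..t, |f x - (1 / (t - s)) * ∫ y in s..t, f y| ≤
      (1 / (t - s)) * ∫ x in s..t, |g x - (1 / (t - s)) * ∫ y in s..t, g y| := by
  have hts : 0 < t - s := sub_pos.2 hst
  set a := (1 / (t - s)) * ∫ y in s..t, f y with ha
  set b := (1 / (t - s)) * ∫ y in s..t, g y with hb
  have hmono : MonotoneOn (fun x => (g x - b) - (f x - a)) (Set.Icc s t) := by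
    intro x hx y hy hxy
    have h := hosc y hy x hx
    rw [abs_of_nonneg (sub_nonneg.2 (hfm hx hy hxy)),
      abs_of_nonneg (sub_nonneg.2 (hgm hx hy hxy))] at h
    dsimp only
    linarith
  have hfa := hf.sub (intervalIntegrable_const (c := a))
  have hgb := hg.sub (intervalIntegrable_const (c := b))
  have hzero : ∫ x in s..t, ((g x - b) - (f x - a)) = 0 := by
    rw [integral_sub hgb hfa, integral_sub hg intervalIntegrable_const,
      integral_sub hf intervalIntegrable_const, intervalIntegral.integral_const,
      intervalIntegral.integral_const, ha, hb]
    simp only [smul_eq_mul]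
    field_simp
    ring
  refine mul_le_mul_of_nonneg_left ?_ (by positivity)
  simpa using integral_abs_le_integral_abs_add_of_monotoneOn hst.le
    (fun x hx y hy hxy => sub_le_sub_right (hfm hx hy hxy) a) hmono hfa (hgb.sub hfa) hzero
end

section
/- Let s < t be real numbers and let f, g : ℝ → ℝ be differentiable on I = [s,t] with |f'(x)| ≤ g'(x) for all x ∈ I. Then MO_I(f) ≤ 2 · MO_I(g). -/
open MeasureTheory intervalIntegral

/-- A pointwise bound `|f'| ≤ g'` makes the increments of `f` dominated by those of `g`. -/
lemma abs_sub_le_abs_sub_of_abs_deriv_le {D : Set ℝ} (hD : Convex ℝ D) {f g f' g' : ℝ → ℝ}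
    (hf : ∀ x ∈ D, HasDerivWithinAt f (f' x) D x)
    (hg : ∀ x ∈ D, HasDerivWithinAt g (g' x) D x)
    (hbound : ∀ x ∈ D, |f' x| ≤ g' x) {x y : ℝ} (hx : x ∈ D) (hy : y ∈ D) :
    |f x - f y| ≤ |g x - g y| := by
  have hsub : MonotoneOn (g - f) D := by
    have h : ∀ x ∈ D, HasDerivWithinAt (g - f) (g' x - f' x) D x :=
      fun x hx => (hg x hx).sub (hf x hx)
    refine monotoneOn_of_hasDerivWithinAt_nonneg hD
      (fun x hx => (h x hx).continuousWithinAt)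
      (fun x hx => (h x (interior_subset hx)).mono interior_subset) fun x hx => ?_
    have := (abs_le.mp (hbound x (interior_subset hx))).2
    linarith
  have hadd : MonotoneOn (g + f) D := by
    have h : ∀ x ∈ D, HasDerivWithinAt (g + f) (g' x + f' x) D x :=
      fun x hx => (hg x hx).add (hf x hx)
    refine monotoneOn_of_hasDerivWithinAt_nonneg hD
      (fun x hx => (h x hx).continuousWithinAt)
      (fun x hx => (h x (interior_subset hx)).mono interior_subset) fun x hx => ?_
    have := (abs_le.mp (hbound x (interior_subset hx))).1
    linarith
  rcases le_total y x with hyx | hxy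
  · have h1 := hsub hy hx hyx
    have h2 := hadd hy hx hyx
    simp only [Pi.sub_apply, Pi.add_apply] at h1 h2
    exact (abs_le.mpr ⟨by linarith, by linarith⟩).trans (le_abs_self _)
  · have h1 := hsub hx hy hxy
    have h2 := hadd hx hy hxy
    simp only [Pi.sub_apply, Pi.add_apply] at h1 h2
    exact (abs_le.mpr ⟨by linarith, by linarith⟩).trans (neg_le_abs _)

/-- The mean oscillation is at most twice the mean distance to any constant. -/
lemma integral_abs_sub_mean_le_two_mul {s t : ℝ} (hst : s < t) {f : ℝ → ℝ}
    (hf : IntervalIntegrable f volume s t) (a : ℝ) :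
    ∫ x in s..t, |f x - (1 / (t - s)) * ∫ y in s..t, f y| ≤ 2 * ∫ x in s..t, |f x - a| := by
  have hpos : 0 < t - s := sub_pos.mpr hst
  set m := (1 / (t - s)) * ∫ y in s..t, f y with hm
  have hfa : IntervalIntegrable (fun x => f x - a) volume s t := hf.sub intervalIntegrable_const
  have hmean : (t - s) * (m - a) = ∫ x in s..t, (f x - a) := by
    rw [integral_sub hf intervalIntegrable_const, intervalIntegral.integral_const, hm, smul_eq_mul]
    field_simp
  have hdist : (t - s) * |m - a| ≤ ∫ x in s..t, |f x - a| := by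
    rw [← abs_of_pos hpos, ← abs_mul, hmean]
    exact abs_integral_le_integral_abs hst.le
  calc ∫ x in s..t, |f x - m|
      ≤ ∫ x in s..t, (|f x - a| + |m - a|) := by
        refine integral_mono_on hst.le (hf.sub intervalIntegrable_const).abs
          (hfa.abs.add intervalIntegrable_const) fun x _ => ?_
        rw [abs_sub_comm m a]
        exact abs_sub_le _ _ _
    _ = (∫ x in s..t, |f x - a|) + (t - s) * |m - a| := by
        rw [integral_add hfa.abs intervalIntegrable_const, intervalIntegral.integral_const,
          smul_eq_mul]
    _ ≤ 2 * ∫ x in s..t, |f x - a| := by linarith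

/-- If `f, g` are differentiable on `I = [s,t]` with `|f'(x)| ≤ g'(x)` on `I`,
then `MO_I(f) ≤ 2 · MO_I(g)`. -/
theorem mean_oscillation_le_two_mul_of_deriv_le
    (s t : ℝ) (hst : s < t) (f g f' g' : ℝ → ℝ)
    (hf : ∀ x ∈ Set.Icc s t, HasDerivWithinAt f (f' x) (Set.Icc s t) x)
    (hg : ∀ x ∈ Set.Icc s t, HasDerivWithinAt g (g' x) (Set.Icc s t) x)
    (hbound : ∀ x ∈ Set.Icc s t, |f' x| ≤ g' x) :
    (1 / (t - s)) * ∫ x in s..t, |f x - (1 / (t - s)) * ∫ y in s..t, f y| ≤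
      2 * ((1 / (t - s)) * ∫ x in s..t, |g x - (1 / (t - s)) * ∫ y in s..t, g y|) := by
  have hpos : 0 < t - s := sub_pos.mpr hst
  have hfc : ContinuousOn f (Set.uIcc s t) := by
    rw [Set.uIcc_of_le hst.le]
    exact fun x hx => (hf x hx).continuousWithinAt
  have hgc : ContinuousOn g (Set.uIcc s t) := by
    rw [Set.uIcc_of_le hst.le]
    exact fun x hx => (hg x hx).continuousWithinAt
  obtain ⟨c, hc, hgc_eq⟩ := exists_eq_interval_average hst.ne hgc
  rw [interval_average_eq, smul_eq_mul, ← one_div] at hgc_eq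
  have hcI : c ∈ Set.Icc s t := by
    rw [← Set.uIcc_of_le hst.le]
    exact Set.uIoo_subset_uIcc_self hc
  rw [← hgc_eq, mul_left_comm]
  refine mul_le_mul_of_nonneg_left ?_ (one_div_pos.mpr hpos).le
  refine (integral_abs_sub_mean_le_two_mul hst hfc.intervalIntegrable (f c)).trans ?_
  refine mul_le_mul_of_nonneg_left ?_ zero_le_two
  exact integral_mono_on hst.le (hfc.intervalIntegrable.sub intervalIntegrable_const).abs
    (hgc.intervalIntegrable.sub intervalIntegrable_const).abs fun x hx =>
      abs_sub_le_abs_sub_of_abs_deriv_le (convex_Icc s t) hf hg hbound hx hcI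
end

section
/- Let 0 < δ ≤ (1/4)e^{-1} and let f : ℝ → ℝ be an even function, integrable on [-δ,δ], differentiable at every x with 0 < |x| ≤ δ, and satisfying |f'(x)| ≤ 1/(|x| · (-log|x|)) for all 0 < |x| ≤ δ. Then for every subinterval I = [s,t] ⊆ [-δ,δ] with s < t one has MO_I(f) ≤ 8 e^{-1} / log(2/(t-s)). -/
open MeasureTheory intervalIntegral

/-- The mean oscillation is at most twice the mean distance to any constant. -/
lemma mean_oscillation_le_two_mul {f : ℝ → ℝ} {s t : ℝ} (hst : s < t)
    (hf : IntervalIntegrable f volume s t) (c : ℝ) :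
    (1 / (t - s)) * ∫ x in s..t, |f x - (1 / (t - s)) * ∫ y in s..t, f y| ≤
      2 * ((1 / (t - s)) * ∫ x in s..t, |f x - c|) := by
  have hL : 0 < t - s := sub_pos.2 hst
  set m := (1 / (t - s)) * ∫ y in s..t, f y with hm
  have hi : ∀ k : ℝ, IntervalIntegrable (fun x => |f x - k|) volume s t := fun k =>
    (hf.sub intervalIntegrable_const).abs
  have h1 : (∫ x in s..t, (f x - c)) = (t - s) * (m - c) := by
    rw [integral_sub hf intervalIntegrable_const, intervalIntegral.integral_const, hm, smul_eq_mul]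
    field_simp
  have h2 : (t - s) * |m - c| ≤ ∫ x in s..t, |f x - c| := by
    have := abs_integral_le_integral_abs (f := fun x => f x - c) (μ := volume) hst.le
    rwa [h1, abs_mul, abs_of_pos hL] at this
  have h3 : ∫ x in s..t, |f x - m| ≤ ∫ x in s..t, (|f x - c| + |m - c|) := by
    refine integral_mono_on hst.le (hi m) ((hi c).add intervalIntegrable_const) fun x _ => ?_
    rw [abs_sub_comm m c]
    exact abs_sub_le _ _ _
  rw [integral_add (hi c) intervalIntegrable_const, intervalIntegral.integral_const, smul_eq_mul] at h3
  have h4 : ∫ x in s..t, |f x - m| ≤ 2 * ∫ x in s..t, |f x - c| := by linarith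
  calc (1 / (t - s)) * ∫ x in s..t, |f x - m|
      ≤ (1 / (t - s)) * (2 * ∫ x in s..t, |f x - c|) := by gcongr
    _ = _ := by ring

/-- The derivative bound makes `f` Lipschitz with constant `1 / (-log b)` in the variable `log x`
on `(0, b]`. -/
lemma abs_sub_le_abs_log_sub_div {f : ℝ → ℝ} {b : ℝ} (hb0 : 0 < b) (hb1 : b < 1)
    (hdiff : ∀ x : ℝ, 0 < x → x ≤ b → DifferentiableAt ℝ f x)
    (hbound : ∀ x : ℝ, 0 < x → x ≤ b → |deriv f x| ≤ 1 / (x * (-Real.log x)))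
    {x y : ℝ} (hx : 0 < x) (hxb : x ≤ b) (hy : 0 < y) (hyb : y ≤ b) :
    |f x - f y| ≤ |Real.log x - Real.log y| / (-Real.log b) := by
  have hD : 0 < -Real.log b := neg_pos.2 (Real.log_neg hb0 hb1)
  have key := (convex_Iic (Real.log b)).norm_image_sub_le_of_norm_hasDerivWithin_le
    (f := fun u => f (Real.exp u)) (f' := fun u => deriv f (Real.exp u) * Real.exp u)
    (C := 1 / (-Real.log b)) (x := Real.log y) (y := Real.log x) ?_ ?_
    (Real.log_le_log hy hyb) (Real.log_le_log hx hxb)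
  · simp only [Real.exp_log hx, Real.exp_log hy, Real.norm_eq_abs] at key
    calc _ ≤ _ := key
      _ = _ := by ring
  · intro u hu
    have hu' : Real.exp u ≤ b := by
      rw [← Real.exp_log hb0]
      exact Real.exp_le_exp.2 hu
    exact ((hdiff _ (Real.exp_pos u) hu').hasDerivAt.comp u (Real.hasDerivAt_exp u)).hasDerivWithinAt
  · intro u hu
    have hu1 : u ≤ Real.log b := hu
    have hu' : Real.exp u ≤ b := by
      rw [← Real.exp_log hb0]
      exact Real.exp_le_exp.2 hu
    have hup : 0 < -u := by linarith
    have h := hbound _ (Real.exp_pos u) hu'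
    rw [Real.log_exp] at h
    rw [Real.norm_eq_abs, abs_mul, abs_of_pos (Real.exp_pos u)]
    calc |deriv f (Real.exp u)| * Real.exp u
        ≤ 1 / (Real.exp u * (-u)) * Real.exp u := by gcongr
      _ = 1 / (-u) := by
        have := Real.exp_pos u
        field_simp
      _ ≤ 1 / (-Real.log b) := one_div_le_one_div_of_le hD (by linarith)

lemma abs_log_sub_log_le {x y : ℝ} (hx : 0 < x) (hy : 0 < y) :
    |Real.log x - Real.log y| ≤
      (Real.log y - Real.log x) + Real.exp (-1) / y ^ 2 * x ^ 2 := by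
  have h : Real.exp (2 * (Real.log x - Real.log y) - 1) = Real.exp (-1) / y ^ 2 * x ^ 2 := by
    have : 2 * (Real.log x - Real.log y) - 1
        = -1 + (Real.log x + Real.log x) - (Real.log y + Real.log y) := by ring
    rw [this, Real.exp_sub, Real.exp_add, Real.exp_add, Real.exp_add, Real.exp_log hx,
      Real.exp_log hy]
    ring
  rw [← h]
  have h1 := Real.add_one_le_exp (2 * (Real.log x - Real.log y) - 1)
  have h2 := Real.exp_pos (2 * (Real.log x - Real.log y) - 1)
  rw [abs_le]
  constructor <;> linarith

lemma integral_log_sub_log_add_sq (a k m : ℝ) :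
    ∫ x in (0 : ℝ)..a, ((k - Real.log x) + m * x ^ 2) =
      a * k - a * Real.log a + a + m * a ^ 3 / 3 := by
  rw [integral_add (intervalIntegrable_const.sub intervalIntegrable_log')
      (intervalIntegrable_pow 2 |>.const_mul m),
    integral_sub intervalIntegrable_const intervalIntegrable_log', integral_log,
    intervalIntegral.integral_const, intervalIntegral.integral_const_mul, integral_pow]
  simp
  ring

/-- Comparison of `∫ |f - f y|` over `[0, a]` with an explicit integral. -/
lemma integral_abs_sub_le {f : ℝ → ℝ} {a y D : ℝ} (ha : 0 ≤ a) (hy : 0 < y) (hD : 0 < D)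
    (hf : IntervalIntegrable f volume 0 a)
    (hlip : ∀ x, 0 < x → x ≤ a → |f x - f y| ≤ |Real.log x - Real.log y| / D) :
    ∫ x in (0 : ℝ)..a, |f x - f y| ≤
      (a * Real.log y - a * Real.log a + a + Real.exp (-1) / y ^ 2 * a ^ 3 / 3) / D := by
  rw [← integral_log_sub_log_add_sq, ← intervalIntegral.integral_div]
  refine integral_mono_on_of_le_Ioo ha (hf.sub intervalIntegrable_const).abs
    (((intervalIntegrable_const.sub intervalIntegrable_log').add
      ((intervalIntegrable_pow 2).const_mul _)).div_const D) ?_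
  intro x hx
  exact (hlip x hx.1 hx.2.le).trans
    (div_le_div_of_nonneg_right (abs_log_sub_log_le hx.1 hy) hD.le)

lemma one_add_two_mul_log_two_le_neg_log {b : ℝ} (hb0 : 0 < b)
    (hb : b ≤ 1 / 4 * Real.exp (-1)) : 1 + 2 * Real.log 2 ≤ -Real.log b := by
  have h := Real.log_le_log hb0 hb
  have h4 : Real.log (1 / 4) = -(2 * Real.log 2) := by
    rw [one_div, Real.log_inv, show (4 : ℝ) = 2 ^ 2 by norm_num, Real.log_pow]
    norm_num
  rw [Real.log_mul (by norm_num) (Real.exp_ne_zero _), Real.log_exp, h4] at h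
  linarith

lemma exp_neg_one_mem : Real.exp (-1) ∈ Set.Ioo (0.3678 : ℝ) 0.3679 := by
  have h1 := Real.exp_one_gt_d9
  have h2 := Real.exp_one_lt_d9
  have h3 : Real.exp (-1) * Real.exp 1 = 1 := by rw [← Real.exp_add]; simp
  have h4 := Real.exp_pos (-1)
  constructor <;> nlinarith

/-- The one-sided case: an interval `[s, t]` with `0 ≤ s`. -/
lemma integral_abs_sub_le_of_nonneg {f : ℝ → ℝ} {s t : ℝ} (hs : 0 ≤ s) (hst : s < t)
    (ht : t ≤ 1 / 4 * Real.exp (-1)) (hf : IntervalIntegrable f volume s t)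
    (hlip : ∀ x, 0 < x → x ≤ t → |f x - f t| ≤ |Real.log x - Real.log t| / (-Real.log t)) :
    ∫ x in s..t, |f x - f t| ≤ (t - s) * (4 * Real.exp (-1) / Real.log (2 / (t - s))) := by
  have ht0 : 0 < t := hs.trans_lt hst
  have hL : 0 < t - s := sub_pos.2 hst
  have hD1 := one_add_two_mul_log_two_le_neg_log ht0 ht
  have hl1 := Real.log_two_gt_d9
  have hl2 := Real.log_two_lt_d9
  obtain ⟨hE1, hE2⟩ := exp_neg_one_mem
  set D := -Real.log t with hDdef
  have hD : 0 < D := by linarith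
  have h1 : ∫ x in s..t, |f x - f t| ≤ ((t - s) - s * (Real.log t - Real.log s)) / D := by
    have : ∫ x in s..t, (Real.log t - Real.log x) / D
        = ((t - s) - s * (Real.log t - Real.log s)) / D := by
      rw [intervalIntegral.integral_div, integral_sub intervalIntegrable_const intervalIntegrable_log',
        integral_log, intervalIntegral.integral_const, smul_eq_mul]
      ring
    rw [← this]
    refine integral_mono_on_of_le_Ioo hst.le (hf.sub intervalIntegrable_const).abs
      ((intervalIntegrable_const.sub intervalIntegrable_log').div_const D) ?_
    intro x hx
    have hx0 : 0 < x := hs.trans_lt hx.1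
    have := hlip x hx0 hx.2.le
    rwa [abs_sub_comm (Real.log x), abs_of_nonneg
      (sub_nonneg.2 (Real.log_le_log hx0 hx.2.le))] at this
  have h2 : (t - s) - s * (Real.log t - Real.log s) ≤ (t - s) * ((t - s) / t) := by
    rcases hs.eq_or_lt with rfl | hs0
    · simp [ht0.ne']
    · have h := Real.log_le_sub_one_of_pos (div_pos hs0 ht0)
      rw [Real.log_div hs0.ne' ht0.ne'] at h
      have h' : s * (1 - s / t) ≤ s * (Real.log t - Real.log s) :=
        mul_le_mul_of_nonneg_left (by linarith) hs
      have h'' : (t - s) * ((t - s) / t) = (t - s) - s * (1 - s / t) := by field_simp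
      linarith
  set r := (t - s) / t with hr
  have hr0 : 0 < r := div_pos hL ht0
  have hr1 : r ≤ 1 := (div_le_one ht0).2 (by linarith)
  have hlog : Real.log (2 / (t - s)) = D + Real.log 2 - Real.log r := by
    rw [hr, Real.log_div two_ne_zero hL.ne', Real.log_div hL.ne' ht0.ne', hDdef]
    ring
  have hrlog : -(r * Real.log r) ≤ 1 - r := by
    have h := Real.log_le_sub_one_of_pos (inv_pos.2 hr0)
    rw [Real.log_inv] at h
    have := mul_le_mul_of_nonneg_left h hr0.le
    rw [mul_sub, mul_inv_cancel₀ hr0.ne'] at this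
    linarith
  have hlogr : Real.log r ≤ 0 := Real.log_nonpos hr0.le hr1
  have hG : 0 < Real.log (2 / (t - s)) := by rw [hlog]; linarith
  have h3 : r * Real.log (2 / (t - s)) ≤ 4 * Real.exp (-1) * D := by
    rw [hlog]
    nlinarith
  calc ∫ x in s..t, |f x - f t| ≤ ((t - s) * r) / D := h1.trans (by gcongr)
    _ = (t - s) * (r / D) := by ring
    _ ≤ _ := by
      gcongr ?_ * ?_
      rwa [div_le_div_iff₀ hD hG]

/-- The case of an interval `[-a, b]` with `0 ≤ a ≤ b`, for an even function. -/
lemma integral_abs_sub_half_le {f : ℝ → ℝ} {a b : ℝ} (ha : 0 < a) (hab : a ≤ b)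
    (hb : b ≤ 1 / 4 * Real.exp (-1)) (hf : IntervalIntegrable f volume 0 b)
    (hlip : ∀ x, 0 < x → x ≤ b →
      |f x - f (b / 2)| ≤ |Real.log x - Real.log (b / 2)| / (-Real.log b)) :
    (∫ x in (0 : ℝ)..a, |f x - f (b / 2)|) + (∫ x in (0 : ℝ)..b, |f x - f (b / 2)|) ≤
      (a + b) * (4 * Real.exp (-1) / Real.log (2 / (a + b))) := by
  have hb0 : 0 < b := ha.trans_le hab
  have hL : 0 < a + b := by positivity
  have hD1 := one_add_two_mul_log_two_le_neg_log hb0 hb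
  have hl1 := Real.log_two_gt_d9
  have hl2 := Real.log_two_lt_d9
  obtain ⟨hE1, hE2⟩ := exp_neg_one_mem
  set D := -Real.log b with hDdef
  have hD : 0 < D := by linarith
  have hfa : IntervalIntegrable f volume 0 a :=
    hf.mono_set (by rw [Set.uIcc_of_le ha.le, Set.uIcc_of_le hb0.le]; gcongr)
  have hA := integral_abs_sub_le ha.le (half_pos hb0) hD hfa
    fun x hx hxa => hlip x hx (hxa.trans hab)
  have hB := integral_abs_sub_le hb0.le (half_pos hb0) hD hf hlip
  set E := Real.exp (-1)
  rw [Real.log_div hb0.ne' two_ne_zero] at hA hB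
  obtain ⟨r, rfl⟩ : ∃ r, a = r * b := ⟨a / b, by field_simp⟩
  have hr0 : 0 < r := pos_of_mul_pos_left ha hb0.le
  have hr1 : r ≤ 1 := by nlinarith
  rw [Real.log_mul hr0.ne' hb0.ne'] at hA
  have hrlog : -(r * Real.log r) ≤ 1 / 4 - r + 2 * r * Real.log 2 := by
    have h := Real.log_le_sub_one_of_pos (x := 1 / (2 ^ 2 * r)) (by positivity)
    rw [one_div, Real.log_inv, Real.log_mul (by norm_num) hr0.ne', Real.log_pow] at h
    have := mul_le_mul_of_nonneg_left h hr0.le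
    rw [mul_sub, show r * (2 ^ 2 * r)⁻¹ = 1 / 4 by field_simp; norm_num] at this
    push_cast at this
    linarith
  have hG : 0 < Real.log (2 / (r * b + b)) := by
    apply Real.log_pos
    rw [one_lt_div hL]
    nlinarith
  have hG1 : Real.log (2 / (r * b + b)) ≤ D + Real.log 2 := by
    rw [Real.log_div two_ne_zero hL.ne', hDdef]
    have := Real.log_le_log hb0 (show b ≤ r * b + b by linarith)
    linarith
  have hr3 : r ^ 3 ≤ r := by nlinarith [mul_nonneg hr0.le (sub_nonneg.2 hr1), sq_nonneg r]
  have hEr : E * r ^ 3 ≤ 0.3679 * r := by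
    have : 0 < r ^ 3 := by positivity
    nlinarith
  have hlr : r * Real.log 2 ≤ 0.6932 * r := by nlinarith
  have h4 : 1.13 * Real.log (2 / (r * b + b)) ≤ 4 * E * D := by nlinarith
  calc _ ≤ _ := add_le_add hA hB
    _ = b * (1 - Real.log 2 + 4 * E / 3 + (r - r * Real.log 2 - r * Real.log r
          + 4 * (E * r ^ 3) / 3)) / D := by field_simp; ring
    _ ≤ b * (1.13 * (r + 1)) / D := by gcongr; linarith
    _ = (r * b + b) * (1.13 / D) := by ring
    _ ≤ _ := by
      gcongr ?_ * ?_
      rwa [div_le_div_iff₀ hD hG]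

/-- If `f` is even, integrable on `[-δ,δ]` (`0 < δ ≤ e⁻¹/4`), differentiable away
from `0` with `|f'(x)| ≤ 1/(|x|·(-log|x|))` for `0 < |x| ≤ δ`, then for every subinterval
`I = [s,t] ⊆ [-δ,δ]`, `MO_I(f) ≤ 8 e⁻¹ / log(2/(t-s))`. -/
theorem mean_oscillation_le_of_even_log_deriv_bound
    (δ : ℝ) (hδ0 : 0 < δ) (hδ : δ ≤ (1 / 4) * Real.exp (-1)) (f : ℝ → ℝ)
    (heven : ∀ x, f (-x) = f x)
    (hint : IntervalIntegrable f volume (-δ) δ)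
    (hdiff : ∀ x : ℝ, 0 < |x| → |x| ≤ δ → DifferentiableAt ℝ f x)
    (hbound : ∀ x : ℝ, 0 < |x| → |x| ≤ δ →
      |deriv f x| ≤ 1 / (|x| * (-Real.log |x|))) :
    ∀ s t : ℝ, s < t → Set.Icc s t ⊆ Set.Icc (-δ) δ →
      (1 / (t - s)) * ∫ x in s..t, |f x - (1 / (t - s)) * ∫ y in s..t, f y| ≤
        8 * Real.exp (-1) / Real.log (2 / (t - s)) := by
  have hlip : ∀ b, 0 < b → b ≤ δ → ∀ y, 0 < y → y ≤ b → ∀ x, 0 < x → x ≤ b →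
      |f x - f y| ≤ |Real.log x - Real.log y| / (-Real.log b) := by
    intro b hb0 hb y hy hyb x hx hxb
    have hb1 : b < 1 := by
      have := exp_neg_one_mem.2
      linarith
    refine abs_sub_le_abs_log_sub_div hb0 hb1 ?_ ?_ hx hxb hy hyb
    · intro z hz hzb
      exact hdiff z (by rwa [abs_of_pos hz]) (by rw [abs_of_pos hz]; linarith)
    · intro z hz hzb
      have := hbound z (by rwa [abs_of_pos hz]) (by rw [abs_of_pos hz]; linarith)
      rwa [abs_of_pos hz] at this
  have hsub : ∀ u v, u ≤ v → -δ ≤ u → v ≤ δ → IntervalIntegrable f volume u v := by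
    intro u v huv hu hv
    refine hint.mono_set ?_
    rw [Set.uIcc_of_le huv, Set.uIcc_of_le (by linarith)]
    exact Set.Icc_subset_Icc hu hv
  have hneg : ∀ u v c : ℝ, ∫ x in u..v, |f x - c| = ∫ x in (-v)..(-u), |f x - c| := by
    intro u v c
    rw [← integral_comp_neg]
    simp only [heven]
  have main : ∀ s t : ℝ, s < t → -δ ≤ s → t ≤ δ → -s ≤ t →
      ∃ c, ∫ x in s..t, |f x - c| ≤
        (t - s) * (4 * Real.exp (-1) / Real.log (2 / (t - s))) := by
    intro s t hst hs ht hst'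
    have ht0 : 0 < t := by linarith
    rcases le_or_gt 0 s with h0 | h0
    · exact ⟨f t, integral_abs_sub_le_of_nonneg h0 hst (ht.trans hδ) (hsub s t hst.le hs ht)
        (hlip t ht0 ht t ht0 le_rfl)⟩
    · refine ⟨f (t / 2), ?_⟩
      have h := integral_abs_sub_half_le (neg_pos.2 h0) hst' (ht.trans hδ)
        (hsub 0 t ht0.le (by linarith) ht)
        (hlip t ht0 ht (t / 2) (half_pos ht0) (half_le_self ht0.le))
      have hi : ∀ u v, u ≤ v → -δ ≤ u → v ≤ δ →
          IntervalIntegrable (fun x => |f x - f (t / 2)|) volume u v := fun u v huv hu hv =>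
        ((hsub u v huv hu hv).sub intervalIntegrable_const).abs
      rw [← integral_add_adjacent_intervals (hi s 0 h0.le hs hδ0.le)
        (hi 0 t ht0.le (by linarith) ht), hneg s 0, neg_zero]
      rwa [show -s + t = t - s by ring] at h
  intro s t hst hI
  obtain ⟨hs, ht⟩ := (Set.Icc_subset_Icc_iff hst.le).1 hI
  obtain ⟨c, hc⟩ : ∃ c, ∫ x in s..t, |f x - c| ≤
      (t - s) * (4 * Real.exp (-1) / Real.log (2 / (t - s))) := by
    rcases le_total (-s) t with h | h
    · exact main s t hst hs ht h
    · obtain ⟨c, hc⟩ := main (-t) (-s) (by linarith) (by linarith) (by linarith) (by linarith)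
      refine ⟨c, ?_⟩
      rw [hneg s t]
      rwa [show -s - -t = t - s by ring] at hc
  have hL : 0 < t - s := sub_pos.2 hst
  calc _ ≤ _ := mean_oscillation_le_two_mul hst (hsub s t hst.le hs ht) c
    _ ≤ 2 * ((1 / (t - s)) *
        ((t - s) * (4 * Real.exp (-1) / Real.log (2 / (t - s))))) := by gcongr
    _ = _ := by
      field_simp
      ring
end

section
/- Let 0 < δ ≤ (1/4)e^{-1} and let f : ℝ → ℝ be an even function, integrable on [-δ,δ], differentiable at every x with 0 < |x| ≤ δ, satisfying |f'(x)| ≤ 1/(|x| · (-log|x|)) for all 0 < |x| ≤ δ, and in addition monotone on (0,δ]. Then for every subinterval I = [s,t] ⊆ [-δ,δ] with s < t one has MO_I(f) ≤ 4 e^{-1} / log(2/(t-s)). -/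
open MeasureTheory intervalIntegral

/-- If `g` has mean zero then `∫ |g| = 2 ∫ g⁺`. -/
lemma integral_abs_eq_two_mul_integral_max {g : ℝ → ℝ} {s t : ℝ}
    (hg : IntervalIntegrable g volume s t) (h0 : ∫ x in s..t, g x = 0) :
    ∫ x in s..t, |g x| = 2 * ∫ x in s..t, max (g x) 0 := by
  have hp : IntervalIntegrable (fun x => max (g x) 0) volume s t :=
    ⟨hg.1.pos_part, hg.2.pos_part⟩
  have h : ∀ x, |g x| = 2 * max (g x) 0 - g x := fun x => by
    rcases le_total 0 (g x) with hx | hx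
    · rw [abs_of_nonneg hx, max_eq_left hx]; ring
    · rw [abs_of_nonpos hx, max_eq_right hx]; ring
  simp_rw [h]
  rw [integral_sub (hp.const_mul 2) hg, h0, intervalIntegral.integral_const_mul, sub_zero]

/-- An integrable function takes, away from `0`, values on both sides of its mean. -/
lemma exists_le_mean_and_mean_le {f : ℝ → ℝ} {s t : ℝ} (hst : s < t)
    (hf : IntervalIntegrable f volume s t) :
    (∃ x ∈ Set.Ioc s t, x ≠ 0 ∧ f x ≤ (1 / (t - s)) * ∫ y in s..t, f y) ∧
      ∃ x ∈ Set.Ioc s t, x ≠ 0 ∧ (1 / (t - s)) * ∫ y in s..t, f y ≤ f x := by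
  have hμ : volume.restrict (Set.uIoc s t) ≠ 0 := by
    rw [Set.uIoc_of_le hst.le, Ne, Measure.restrict_eq_zero, Real.volume_Ioc]
    simpa using hst
  have : IsFiniteMeasure (volume.restrict (Set.uIoc s t)) := by
    rw [Set.uIoc_of_le hst.le]; infer_instance
  have hi : Integrable f (volume.restrict (Set.uIoc s t)) := by
    rw [Set.uIoc_of_le hst.le]; exact hf.1
  have hN : volume.restrict (Set.uIoc s t) ({0} ∪ (Set.Ioc s t)ᶜ) = 0 := by
    refine measure_union_null (by simp) ?_
    rw [Set.uIoc_of_le hst.le, Measure.restrict_apply measurableSet_Ioc.compl]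
    simp
  have hc : (1 / (t - s)) * ∫ y in s..t, f y = ⨍ y in s..t, f y := by
    rw [interval_average_eq_div]; ring
  rw [hc]
  obtain ⟨x, hx, hxc⟩ := exists_notMem_null_le_average hμ hi hN
  obtain ⟨y, hy, hyc⟩ := exists_notMem_null_average_le hμ hi hN
  simp only [Set.mem_union, Set.mem_singleton_iff, Set.mem_compl_iff, not_or, not_not] at hx hy
  exact ⟨⟨x, hx.2, hx.1, hxc⟩, ⟨y, hy.2, hy.1, hyc⟩⟩

lemma integral_sub_mean {f : ℝ → ℝ} {s t : ℝ} (hst : s < t)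
    (hf : IntervalIntegrable f volume s t) :
    ∫ x in s..t, (f x - (1 / (t - s)) * ∫ y in s..t, f y) = 0 := by
  rw [integral_sub hf (by simp), intervalIntegral.integral_const, smul_eq_mul]
  field_simp [sub_ne_zero.2 hst.ne']
  ring

lemma intervalIntegrable_max_log_sub (c a b : ℝ) :
    IntervalIntegrable (fun x => max (c - Real.log x) 0) volume a b := by
  have h : IntervalIntegrable (fun x => c - Real.log x) volume a b :=
    IntervalIntegrable.sub (by simp) intervalIntegrable_log'
  exact ⟨h.1.pos_part, h.2.pos_part⟩

lemma intervalIntegrable_max_sub_log (c a b : ℝ) :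
    IntervalIntegrable (fun x => max (Real.log x - c) 0) volume a b := by
  have h : IntervalIntegrable (fun x => Real.log x - c) volume a b :=
    IntervalIntegrable.sub intervalIntegrable_log' (by simp)
  exact ⟨h.1.pos_part, h.2.pos_part⟩

lemma integral_max_log_sub_le {m b : ℝ} (hm : 0 < m) (hb : 0 ≤ b) :
    ∫ x in (0 : ℝ)..b, max (Real.log m - Real.log x) 0 ≤ m := by
  have h1 : ∫ x in (0 : ℝ)..m, max (Real.log m - Real.log x) 0 = m := by
    have : ∫ x in (0 : ℝ)..m, max (Real.log m - Real.log x) 0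
        = ∫ x in (0 : ℝ)..m, (Real.log m - Real.log x) := by
      refine integral_congr_ae (.of_forall fun x hx => ?_)
      rw [Set.uIoc_of_le hm.le] at hx
      exact max_eq_left (sub_nonneg.2 (Real.log_le_log hx.1 hx.2))
    rw [this, integral_sub (by simp) intervalIntegrable_log', integral_log,
      intervalIntegral.integral_const, smul_eq_mul]
    simp
  rcases le_total b m with hbm | hmb
  · exact (integral_mono_interval le_rfl hb hbm (.of_forall fun x => le_max_right _ _)
      (intervalIntegrable_max_log_sub _ _ _)).trans h1.le
  · rw [← integral_add_adjacent_intervals (intervalIntegrable_max_log_sub _ 0 m)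
      (intervalIntegrable_max_log_sub _ m b), h1]
    have : ∫ x in m..b, max (Real.log m - Real.log x) 0 = ∫ x in m..b, (0 : ℝ) := by
      refine integral_congr_ae (.of_forall fun x hx => ?_)
      rw [Set.uIoc_of_le hmb] at hx
      exact max_eq_right (sub_nonpos.2 (Real.log_le_log hm hx.1.le))
    simp [this]

lemma sub_log_antitone {u v : ℝ} (hu : 0 < u) (huv : u ≤ v) (hv : v ≤ 1) :
    v - Real.log v ≤ u - Real.log u := by
  have hv0 : 0 < v := hu.trans_le huv
  have h := Real.log_le_sub_one_of_pos (div_pos hu hv0)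
  rw [Real.log_div hu.ne' hv0.ne'] at h
  have h2 : u / v - 1 ≤ u - v := by
    rw [div_sub_one hv0.ne', div_le_iff₀ hv0]
    nlinarith
  linarith

lemma integral_max_sub_log_le {m b u k : ℝ} (hm : 0 < m) (hb : 0 ≤ b) (hu : 0 < u)
    (huk : u - Real.log u - 1 ≤ k) (hk : 0 ≤ k) (hum : u * b ≤ m) :
    ∫ x in (0 : ℝ)..b, max (Real.log x - Real.log m) 0 ≤ k * b := by
  have hz : ∀ c, 0 ≤ c → c ≤ m →
      ∫ x in (0 : ℝ)..c, max (Real.log x - Real.log m) 0 = 0 := fun c hc hcm => by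
    have : ∫ x in (0 : ℝ)..c, max (Real.log x - Real.log m) 0 = ∫ x in (0 : ℝ)..c, (0 : ℝ) := by
      refine integral_congr_ae (.of_forall fun x hx => ?_)
      rw [Set.uIoc_of_le hc] at hx
      exact max_eq_right (sub_nonpos.2 (Real.log_le_log hx.1 (hx.2.trans hcm)))
    simp [this]
  rcases le_total b m with hbm | hmb
  · rw [hz b hb hbm]; positivity
  · rw [← integral_add_adjacent_intervals (intervalIntegrable_max_sub_log _ 0 m)
      (intervalIntegrable_max_sub_log _ m b), hz m hm.le le_rfl]
    have : ∫ x in m..b, max (Real.log x - Real.log m) 0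
        = ∫ x in m..b, (Real.log x - Real.log m) := by
      refine integral_congr_ae (.of_forall fun x hx => ?_)
      rw [Set.uIoc_of_le hmb] at hx
      exact max_eq_left (sub_nonneg.2 (Real.log_le_log hm hx.1.le))
    rw [this, integral_sub intervalIntegrable_log' (by simp), integral_log,
      intervalIntegral.integral_const, smul_eq_mul]
    have hb0 : 0 < b := hm.trans_le hmb
    have h := sub_log_antitone hu ((le_div_iff₀ hb0).2 hum) ((div_le_one hb0).2 hmb)
    rw [Real.log_div hm.ne' hb0.ne'] at h
    have h2 : b * (m / b - (Real.log m - Real.log b) - 1) ≤ b * k :=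
      mul_le_mul_of_nonneg_left (by linarith) hb
    have h3 : b * (m / b) = m := by field_simp
    nlinarith

/-- An even function that decreases in `|x|` at most as fast as `A * log |x|` increases has mean
oscillation controlled by that of the logarithm around some level `log m`. -/
lemma exists_integral_abs_sub_mean_le {f : ℝ → ℝ} {A R s t : ℝ} (hA : 0 ≤ A) (hst : s < t)
    (hsub : Set.Icc s t ⊆ Set.Icc (-R) R) (hf : IntervalIntegrable f volume s t)
    (heven : ∀ x, f (-x) = f x) (hcont : ContinuousOn f (Set.Ioc 0 R))
    (hanti : AntitoneOn f (Set.Ioc 0 R))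
    (hlog : ∀ x y, 0 < x → x ≤ y → y ≤ R → f x - f y ≤ A * (Real.log y - Real.log x)) :
    ∃ m ∈ Set.Ioc 0 R,
      (∫ x in s..t, |f x - (1 / (t - s)) * ∫ y in s..t, f y| ≤
        2 * (A * ∫ x in s..t, max (Real.log m - Real.log x) 0)) ∧
      (∫ x in s..t, |f x - (1 / (t - s)) * ∫ y in s..t, f y| ≤
        2 * (A * ∫ x in s..t, max (Real.log x - Real.log m) 0)) := by
  have habs : ∀ x, f |x| = f x := fun x => by
    rcases abs_choice x with h | h <;> rw [h]
    exact heven x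
  have hmem : ∀ x ∈ Set.Icc s t, x ≠ 0 → |x| ∈ Set.Ioc 0 R := fun x hx h0 =>
    ⟨abs_pos.2 h0, abs_le.2 (hsub hx)⟩
  obtain ⟨⟨x₁, hx₁, hx₁0, h₁⟩, ⟨x₂, hx₂, hx₂0, h₂⟩⟩ := exists_le_mean_and_mean_le hst hf
  have hz := integral_sub_mean hst hf
  set c := (1 / (t - s)) * ∫ y in s..t, f y with hc
  obtain ⟨m, hm, hfm⟩ := isPreconnected_Ioc.intermediate_value
    (hmem x₁ (Set.Ioc_subset_Icc_self hx₁) hx₁0) (hmem x₂ (Set.Ioc_subset_Icc_self hx₂) hx₂0) hcont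
    (show c ∈ _ by rw [habs, habs]; exact ⟨h₁, h₂⟩)
  have hg : IntervalIntegrable (fun x => f x - c) volume s t := hf.sub (by simp)
  have hne : ∀ᵐ x ∂(volume.restrict (Set.Icc s t)), x ∈ Set.Icc s t ∧ x ≠ 0 :=
    (ae_restrict_mem measurableSet_Icc).and (Measure.ae_ne _ 0)
  refine ⟨m, hm, ?_, ?_⟩
  · rw [integral_abs_eq_two_mul_integral_max hg hz, ← intervalIntegral.integral_const_mul A]
    refine mul_le_mul_of_nonneg_left (integral_mono_ae_restrict hst.le
      ⟨hg.1.pos_part, hg.2.pos_part⟩ ((intervalIntegrable_max_log_sub _ _ _).const_mul A) ?_) two_pos.le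
    filter_upwards [hne] with x ⟨hx, hx0⟩
    have hxm := hmem x hx hx0
    rw [← habs x, ← Real.log_abs x, ← hfm]
    rcases le_total |x| m with h | h
    · refine max_le ((hlog _ _ hxm.1 h hm.2).trans ?_) (mul_nonneg hA (le_max_right _ _))
      exact mul_le_mul_of_nonneg_left (le_max_left _ _) hA
    · rw [max_eq_right (sub_nonpos.2 (hanti hm hxm h))]
      exact mul_nonneg hA (le_max_right _ _)
  · have hg' : IntervalIntegrable (fun x => c - f x) volume s t := IntervalIntegrable.sub (by simp) hf
    have hz' : ∫ x in s..t, (c - f x) = 0 := by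
      rw [← neg_eq_zero, ← intervalIntegral.integral_neg, ← hz]
      simp
    simp_rw [abs_sub_comm _ c]
    rw [integral_abs_eq_two_mul_integral_max hg' hz', ← intervalIntegral.integral_const_mul A]
    refine mul_le_mul_of_nonneg_left (integral_mono_ae_restrict hst.le
      ⟨hg'.1.pos_part, hg'.2.pos_part⟩ ((intervalIntegrable_max_sub_log _ _ _).const_mul A) ?_) two_pos.le
    filter_upwards [hne] with x ⟨hx, hx0⟩
    have hxm := hmem x hx hx0
    rw [← habs x, ← Real.log_abs x, ← hfm]
    rcases le_total m |x| with h | h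
    · refine max_le ((hlog _ _ hm.1 h hxm.2).trans ?_) (mul_nonneg hA (le_max_right _ _))
      exact mul_le_mul_of_nonneg_left (le_max_left _ _) hA
    · rw [max_eq_right (sub_nonpos.2 (hanti hxm hm h))]
      exact mul_nonneg hA (le_max_right _ _)

/-- The mean oscillation of a bounded function is at most half of its oscillation. -/
lemma integral_abs_sub_mean_le_half_osc {f : ℝ → ℝ} {s t α β : ℝ} (hst : s < t)
    (hf : IntervalIntegrable f volume s t) (hfαβ : ∀ x ∈ Set.Icc s t, f x ∈ Set.Icc α β) :
    ∫ x in s..t, |f x - (1 / (t - s)) * ∫ y in s..t, f y| ≤ (t - s) * ((β - α) / 2) := by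
  obtain ⟨⟨x₁, hx₁, -, h₁⟩, ⟨x₂, hx₂, -, h₂⟩⟩ := exists_le_mean_and_mean_le hst hf
  have hz := integral_sub_mean hst hf
  set c := (1 / (t - s)) * ∫ y in s..t, f y with hc
  have hαc : α ≤ c := (hfαβ x₁ (Set.Ioc_subset_Icc_self hx₁)).1.trans h₁
  have hcβ : c ≤ β := h₂.trans (hfαβ x₂ (Set.Ioc_subset_Icc_self hx₂)).2
  have hg : IntervalIntegrable (fun x => f x - c) volume s t := hf.sub (by simp)
  have hts : 0 < t - s := sub_pos.2 hst
  rcases (hαc.trans hcβ).eq_or_lt with h | h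
  · have : ∫ x in s..t, |f x - c| ≤ ∫ x in s..t, (0 : ℝ) := by
      refine integral_mono_on hst.le hg.abs (by simp) fun x hx => ?_
      have hx' := hfαβ x hx
      rw [abs_le]; constructor <;> linarith [hx'.1, hx'.2]
    simpa [h] using this
  · have hI : ∫ x in s..t, (β - α) * |f x - c| ≤
        ∫ x in s..t, (2 * ((c - α) * (β - c)) + (α + β - 2 * c) * (f x - c)) := by
      refine integral_mono_on hst.le (hg.abs.const_mul _)
        (IntervalIntegrable.add (by simp) (hg.const_mul _)) fun x hx => ?_
      have hx' := hfαβ x hx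
      rcases abs_cases (f x - c) with ⟨e, _⟩ | ⟨e, _⟩ <;> rw [e]
      · nlinarith [mul_nonneg (sub_nonneg.2 hαc) (sub_nonneg.2 hx'.2)]
      · nlinarith [mul_nonneg (sub_nonneg.2 hcβ) (sub_nonneg.2 hx'.1)]
    rw [integral_add (by simp) (hg.const_mul _), intervalIntegral.integral_const_mul,
      intervalIntegral.integral_const_mul _ (fun x => f x - c), hz,
      intervalIntegral.integral_const, smul_eq_mul] at hI
    have h4 : 2 * ((c - α) * (β - c)) ≤ (β - α) * ((β - α) / 2) := by
      nlinarith [sq_nonneg (α + β - 2 * c)]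
    have h5 := mul_le_mul_of_nonneg_left h4 hts.le
    refine le_of_mul_le_mul_left ?_ (sub_pos.2 h)
    linarith

lemma div_le_of_integral_le {J L Λ k q : ℝ} (hL : 0 < L) (hΛ : 0 < Λ) (hk : 0 ≤ k)
    (hJ : J ≤ L * (1 / Λ * k)) (hpos : 0 < Real.log (2 / L)) (hlog : Real.log (2 / L) ≤ Λ + q)
    (hkq : k * (Λ + q) ≤ 4 * Real.exp (-1) * Λ) :
    1 / L * J ≤ 4 * Real.exp (-1) / Real.log (2 / L) := by
  have h1 : 1 / L * J ≤ k / Λ := by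
    rw [one_div_mul_eq_div, div_le_iff₀ hL]
    calc J ≤ _ := hJ
      _ = k / Λ * L := by ring
  refine h1.trans ?_
  rw [div_le_div_iff₀ hΛ hpos]
  exact (mul_le_mul_of_nonneg_left hlog hk).trans hkq

lemma sub_log_sub_one_le : (0.28 : ℝ) - Real.log 0.28 - 1 ≤ 0.56 := by
  have h : -1.28 ≤ Real.log 0.28 := by
    rw [Real.le_log_iff_exp_le (by norm_num), Real.exp_neg, inv_le_comm₀ (Real.exp_pos _) (by norm_num),
      show (1.28 : ℝ) = 1 + 0.28 by norm_num, Real.exp_add]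
    have h1 := Real.exp_one_gt_d9
    have h2 := Real.quadratic_le_exp_of_nonneg (show (0 : ℝ) ≤ 0.28 by norm_num)
    nlinarith
  linarith

lemma neg_one_le_log_two_fifths : -1 ≤ Real.log 0.4 := by
  rw [Real.le_log_iff_exp_le (by norm_num)]
  exact Real.exp_neg_one_lt_d9.le.trans (by norm_num)

section Antitone

variable {f : ℝ → ℝ} {R s t : ℝ}

/-- The oscillation bound on an interval around the singularity. -/
lemma mean_oscillation_le_of_neg_of_pos (hΛ : 2.386 ≤ -Real.log R) (hs : s < 0) (ht : 0 < t)
    (hsR : -R ≤ s) (htR : t ≤ R) (hmax : R ≤ t - s) (hf : IntervalIntegrable f volume s t)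
    (heven : ∀ x, f (-x) = f x) (hcont : ContinuousOn f (Set.Ioc 0 R))
    (hanti : AntitoneOn f (Set.Ioc 0 R))
    (hlog : ∀ x y, 0 < x → x ≤ y → y ≤ R →
      f x - f y ≤ 1 / -Real.log R * (Real.log y - Real.log x)) :
    (1 / (t - s)) * ∫ x in s..t, |f x - (1 / (t - s)) * ∫ y in s..t, f y| ≤
        4 * Real.exp (-1) / Real.log (2 / (t - s)) := by
  have hst : s < t := hs.trans ht
  have hR : 0 < R := ht.trans_le htR
  have hΛ0 : 0 < -Real.log R := by linarith
  have hL : 0 < t - s := sub_pos.2 hst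
  have hR1 : R < 1 := by
    by_contra! h
    linarith [Real.log_nonneg h]
  obtain ⟨m, hm, h1, h2⟩ := exists_integral_abs_sub_mean_le (one_div_nonneg.2 hΛ0.le) hst
    (Set.Icc_subset_Icc hsR htR) hf heven hcont hanti hlog
  have hP : ∫ x in s..t, max (Real.log m - Real.log x) 0 ≤ 2 * m := by
    rw [← integral_add_adjacent_intervals (intervalIntegrable_max_log_sub _ s 0)
      (intervalIntegrable_max_log_sub _ 0 t)]
    have h := intervalIntegral.integral_comp_neg (a := 0) (b := -s)
      (fun x => max (Real.log m - Real.log x) 0)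
    simp only [Real.log_neg_eq_log, neg_neg, neg_zero] at h
    rw [← h]
    linarith [integral_max_log_sub_le hm.1 ht.le, integral_max_log_sub_le hm.1 (neg_pos.2 hs).le]
  have hN : 0.28 * R ≤ m → ∫ x in s..t, max (Real.log x - Real.log m) 0 ≤ 0.56 * (t - s) := by
    intro hRm
    rw [← integral_add_adjacent_intervals (intervalIntegrable_max_sub_log _ s 0)
      (intervalIntegrable_max_sub_log _ 0 t)]
    have h := intervalIntegral.integral_comp_neg (a := 0) (b := -s)
      (fun x => max (Real.log x - Real.log m) 0)
    simp only [Real.log_neg_eq_log, neg_neg, neg_zero] at h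
    rw [← h]
    have h3 := integral_max_sub_log_le hm.1 ht.le (by norm_num) sub_log_sub_one_le (by norm_num)
      (by linarith)
    have h4 := integral_max_sub_log_le hm.1 (neg_pos.2 hs).le (by norm_num) sub_log_sub_one_le
      (by norm_num) (by linarith)
    linarith
  have hJ : ∫ x in s..t, |f x - (1 / (t - s)) * ∫ y in s..t, f y| ≤
      (t - s) * (1 / -Real.log R * 1.12) := by
    have key : ∀ B, B ≤ 0.56 * (t - s) →
        2 * (1 / -Real.log R * B) ≤ (t - s) * (1 / -Real.log R * 1.12) := fun B hB => by
      have := mul_le_mul_of_nonneg_left hB (one_div_nonneg.2 hΛ0.le)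
      linarith
    rcases le_total m (0.28 * R) with hmR | hmR
    · exact h1.trans (key _ (by linarith))
    · exact h2.trans (key _ (hN hmR))
  have hl2 := Real.log_two_lt_d9
  refine div_le_of_integral_le (q := Real.log 2) hL hΛ0 (by norm_num) hJ ?_ ?_ ?_
  · exact Real.log_pos ((one_lt_div hL).2 (by linarith))
  · rw [Real.log_div two_ne_zero hL.ne']
    linarith [Real.log_le_log hR hmax]
  · nlinarith [Real.exp_neg_one_gt_d9]

/-- The oscillation bound on an interval to the right of the singularity. -/
lemma mean_oscillation_le_of_nonneg (hΛ : 2.386 ≤ -Real.log t) (hs : 0 ≤ s) (hst : s < t)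
    (hf : IntervalIntegrable f volume s t)
    (heven : ∀ x, f (-x) = f x) (hcont : ContinuousOn f (Set.Ioc 0 t))
    (hanti : AntitoneOn f (Set.Ioc 0 t))
    (hlog : ∀ x y, 0 < x → x ≤ y → y ≤ t →
      f x - f y ≤ 1 / -Real.log t * (Real.log y - Real.log x)) :
    (1 / (t - s)) * ∫ x in s..t, |f x - (1 / (t - s)) * ∫ y in s..t, f y| ≤
        4 * Real.exp (-1) / Real.log (2 / (t - s)) := by
  have ht : 0 < t := hs.trans_lt hst
  have hΛ0 : 0 < -Real.log t := by linarith
  have hL : 0 < t - s := sub_pos.2 hst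
  have ht1 : t < 1 := by
    by_contra! h
    linarith [Real.log_nonneg h]
  have hpos : 0 < Real.log (2 / (t - s)) := Real.log_pos ((one_lt_div hL).2 (by linarith))
  have hlogL : Real.log (2 / (t - s)) = -Real.log t + Real.log (2 / ((t - s) / t)) := by
    rw [Real.log_div two_ne_zero hL.ne', Real.log_div two_ne_zero (by positivity),
      Real.log_div hL.ne' ht.ne']
    ring
  have hl2 := Real.log_two_lt_d9
  have he := Real.exp_neg_one_gt_d9
  rcases le_total s (t / 5) with h5 | h5
  · obtain ⟨m, hm, h1, h2⟩ := exists_integral_abs_sub_mean_le (one_div_nonneg.2 hΛ0.le) hst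
      (Set.Icc_subset_Icc (by linarith) le_rfl) hf heven hcont hanti hlog
    have hJ : ∫ x in s..t, |f x - (1 / (t - s)) * ∫ y in s..t, f y| ≤
        (t - s) * (1 / -Real.log t * 1) := by
      have key : ∀ B, B ≤ 0.4 * t →
          2 * (1 / -Real.log t * B) ≤ (t - s) * (1 / -Real.log t * 1) := fun B hB => by
        have := mul_le_mul_of_nonneg_left (show B ≤ (t - s) / 2 by linarith)
          (one_div_nonneg.2 hΛ0.le)
        linarith
      rcases le_total m (0.4 * t) with hmt | hmt
      · refine h1.trans (key _ (le_trans ?_ hmt))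
        exact (integral_mono_interval hs hst.le le_rfl (.of_forall fun x => le_max_right _ _)
          (intervalIntegrable_max_log_sub _ _ _)).trans (integral_max_log_sub_le hm.1 ht.le)
      · refine h2.trans (key _ ?_)
        refine (integral_mono_interval hs hst.le le_rfl (.of_forall fun x => le_max_right _ _)
          (intervalIntegrable_max_sub_log _ _ _)).trans
          (integral_max_sub_log_le (u := 0.4) hm.1 ht.le (by norm_num) ?_ (by norm_num) hmt)
        linarith [neg_one_le_log_two_fifths]
    refine div_le_of_integral_le (q := 1) hL hΛ0 (by norm_num) hJ hpos ?_ (by nlinarith)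
    have h3 : Real.log 0.4 ≤ Real.log ((t - s) / 2 / t) :=
      Real.log_le_log (by norm_num) ((le_div_iff₀ ht).2 (by linarith))
    have h4 : Real.log (2 / ((t - s) / t)) = -Real.log ((t - s) / 2 / t) := by
      rw [← Real.log_inv]
      congr 1
      field_simp
    rw [hlogL, h4]
    linarith [neg_one_le_log_two_fifths]
  · have hs0 : 0 < s := by linarith
    have hJ : ∀ k, (Real.log t - Real.log s) / 2 ≤ k →
        ∫ x in s..t, |f x - (1 / (t - s)) * ∫ y in s..t, f y| ≤
          (t - s) * (1 / -Real.log t * k) := fun k hk => by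
      refine (integral_abs_sub_mean_le_half_osc hst hf (α := f t) (β := f s) fun x hx => ?_).trans ?_
      · have hx0 : x ∈ Set.Ioc 0 t := ⟨hs0.trans_le hx.1, hx.2⟩
        exact ⟨hanti hx0 ⟨ht, le_rfl⟩ hx.2, hanti ⟨hs0, hst.le⟩ hx0 hx.1⟩
      · refine mul_le_mul_of_nonneg_left ?_ hL.le
        have := mul_le_mul_of_nonneg_left hk (one_div_nonneg.2 hΛ0.le)
        linarith [hlog s t hs0 hst.le le_rfl]
    have hdiv : Real.log (t / s) = Real.log t - Real.log s := Real.log_div ht.ne' hs0.ne'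
    rcases le_total s (t / 2) with h2 | h2
    · refine div_le_of_integral_le (q := 2 * Real.log 2) (k := 0.8182) hL hΛ0 (by norm_num)
        (hJ _ ?_) hpos ?_ (by nlinarith)
      · have h3 : Real.log (t / s) ≤ Real.log (2 * 2 * 1.25) :=
          Real.log_le_log (by positivity) ((div_le_iff₀ hs0).2 (by linarith))
        rw [Real.log_mul (by norm_num) (by norm_num), Real.log_mul (by norm_num) (by norm_num)] at h3
        linarith [Real.log_le_sub_one_of_pos (show (0 : ℝ) < 1.25 by norm_num)]
      · rw [hlogL, two_mul, ← Real.log_mul two_ne_zero two_ne_zero]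
        gcongr
        rw [div_le_iff₀ (by positivity), ← mul_div_assoc, le_div_iff₀ ht]
        linarith
    · have hθ : (t - s) / t ≤ 1 / 2 := by
        rw [div_le_iff₀ ht]; linarith
      have hθ0 : 0 < (t - s) / t := by positivity
      refine div_le_of_integral_le (q := 2 / ((t - s) / t) - 1) (k := (t - s) / t) hL hΛ0 hθ0.le
        (hJ _ ?_) hpos ?_ ?_
      · have h3 := Real.log_le_sub_one_of_pos (div_pos ht hs0)
        rw [hdiv, div_sub_one hs0.ne'] at h3
        have h4 : (t - s) / s ≤ 2 * ((t - s) / t) := by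
          rw [← mul_div_assoc, div_le_div_iff₀ hs0 ht]
          nlinarith
        linarith
      · rw [hlogL]
        linarith [Real.log_le_sub_one_of_pos (div_pos two_pos hθ0)]
      · have h3 : (t - s) / t * (2 / ((t - s) / t)) = 2 := mul_div_cancel₀ _ hθ0.ne'
        nlinarith

end Antitone

/-- A bound on the derivative by `1 / (|x| * -log |x|)` gives a Lipschitz bound against the
logarithm. -/
lemma abs_sub_le_of_log_deriv_bound {f : ℝ → ℝ} {R : ℝ} (hR1 : R < 1)
    (hdiff : ∀ x : ℝ, 0 < |x| → |x| ≤ R → DifferentiableAt ℝ f x)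
    (hbound : ∀ x : ℝ, 0 < |x| → |x| ≤ R → |deriv f x| ≤ 1 / (|x| * (-Real.log |x|)))
    {x y : ℝ} (hx : 0 < x) (hxy : x ≤ y) (hy : y ≤ R) :
    |f x - f y| ≤ 1 / -Real.log R * (Real.log y - Real.log x) := by
  have hR : 0 < R := hx.trans_le (hxy.trans hy)
  have hΛ : 0 < -Real.log R := neg_pos.2 (Real.log_neg hR hR1)
  have hd : ∀ z ∈ Set.Ioc 0 R, DifferentiableAt ℝ f z := fun z hz =>
    hdiff z (abs_pos.2 hz.1.ne') (by rw [abs_of_pos hz.1]; exact hz.2)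
  have hb : ∀ z ∈ Set.Ioc 0 R, |deriv f z| ≤ 1 / -Real.log R * z⁻¹ := fun z hz => by
    have h := hbound z (abs_pos.2 hz.1.ne') (by rw [abs_of_pos hz.1]; exact hz.2)
    rw [abs_of_pos hz.1] at h
    refine h.trans ?_
    rw [mul_comm z, ← one_div_mul_one_div, one_div z]
    refine mul_le_mul_of_nonneg_right ?_ (inv_nonneg.2 hz.1.le)
    exact one_div_le_one_div_of_le hΛ (neg_le_neg (Real.log_le_log hz.1 hz.2))
  have key : ∀ σ : ℝ, |σ| = 1 →
      MonotoneOn (fun z => 1 / -Real.log R * Real.log z + σ * f z) (Set.Ioc 0 R) := fun σ hσ => by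
    have hD : ∀ z ∈ Set.Ioc 0 R, HasDerivAt (fun z => 1 / -Real.log R * Real.log z + σ * f z)
        (1 / -Real.log R * z⁻¹ + σ * deriv f z) z := fun z hz =>
      ((Real.hasDerivAt_log hz.1.ne').const_mul _).add ((hd z hz).hasDerivAt.const_mul σ)
    refine monotoneOn_of_deriv_nonneg (convex_Ioc _ _)
      (fun z hz => (hD z hz).continuousAt.continuousWithinAt)
      (fun z hz => (hD z (interior_subset hz)).differentiableAt.differentiableWithinAt)
      fun z hz => ?_
    rw [(hD z (interior_subset hz)).deriv]
    have h1 := hb z (interior_subset hz)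
    have h2 : |σ * deriv f z| = |deriv f z| := by rw [abs_mul, hσ, one_mul]
    linarith [neg_abs_le (σ * deriv f z)]
  have h1 := key 1 (by simp) ⟨hx, hxy.trans hy⟩ ⟨hx.trans_le hxy, hy⟩ hxy
  have h2 := key (-1) (by simp) ⟨hx, hxy.trans hy⟩ ⟨hx.trans_le hxy, hy⟩ hxy
  simp only at h1 h2
  rw [abs_le]
  constructor <;> linarith

lemma mean_oscillation_le_of_antitone {δ : ℝ} (hδ0 : 0 < δ) (hδ : δ ≤ (1 / 4) * Real.exp (-1))
    {f : ℝ → ℝ} (heven : ∀ x, f (-x) = f x)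
    (hint : IntervalIntegrable f volume (-δ) δ)
    (hdiff : ∀ x : ℝ, 0 < |x| → |x| ≤ δ → DifferentiableAt ℝ f x)
    (hbound : ∀ x : ℝ, 0 < |x| → |x| ≤ δ →
      |deriv f x| ≤ 1 / (|x| * (-Real.log |x|)))
    (hanti : AntitoneOn f (Set.Ioc 0 δ)) {s t : ℝ} (hst : s < t)
    (hsub : Set.Icc s t ⊆ Set.Icc (-δ) δ) :
    (1 / (t - s)) * ∫ x in s..t, |f x - (1 / (t - s)) * ∫ y in s..t, f y| ≤
      4 * Real.exp (-1) / Real.log (2 / (t - s)) := by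
  have hδs : -δ ≤ s := (hsub ⟨le_rfl, hst.le⟩).1
  have htδ : t ≤ δ := (hsub ⟨hst.le, le_rfl⟩).2
  have hlogδ : 2.386 ≤ -Real.log δ := by
    have h := Real.log_le_log hδ0 hδ
    rw [Real.log_mul (by norm_num) (Real.exp_pos _).ne', Real.log_exp,
      show (1 / 4 : ℝ) = (2 * 2)⁻¹ by norm_num, Real.log_inv,
      Real.log_mul two_ne_zero two_ne_zero] at h
    linarith [Real.log_two_gt_d9]
  have hδ1 : δ < 1 := by
    by_contra! h
    linarith [Real.log_nonneg h]
  have hΛ : ∀ R, 0 < R → R ≤ δ → 2.386 ≤ -Real.log R := fun R hR hRδ =>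
    hlogδ.trans (neg_le_neg (Real.log_le_log hR hRδ))
  have hcont : ContinuousOn f (Set.Ioc 0 δ) := fun z hz =>
    (hdiff z (abs_pos.2 hz.1.ne')
      (by rw [abs_of_pos hz.1]; exact hz.2)).continuousAt.continuousWithinAt
  have hlog : ∀ R ≤ δ, ∀ x y, 0 < x → x ≤ y → y ≤ R →
      f x - f y ≤ 1 / -Real.log R * (Real.log y - Real.log x) := fun R hR x y hx hxy hy =>
    (le_abs_self _).trans (abs_sub_le_of_log_deriv_bound (hR.trans_lt hδ1)
      (fun z h0 hz => hdiff z h0 (hz.trans hR)) (fun z h0 hz => hbound z h0 (hz.trans hR)) hx hxy hy)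
  have hf : ∀ {a b : ℝ}, -δ ≤ a → a ≤ b → b ≤ δ → IntervalIntegrable f volume a b :=
    fun ha hab hb => hint.mono_set (by
      rw [Set.uIcc_of_le hab, Set.uIcc_of_le (by linarith)]
      exact Set.Icc_subset_Icc ha hb)
  have hIoc : ∀ {R : ℝ}, R ≤ δ → Set.Ioc 0 R ⊆ Set.Ioc 0 δ := fun h =>
    Set.Ioc_subset_Ioc_right h
  rcases le_or_gt 0 s with hs | hs
  · exact mean_oscillation_le_of_nonneg (hΛ t (hs.trans_lt hst) htδ) hs hst (hf hδs hst.le htδ)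
      heven (hcont.mono (hIoc htδ)) (hanti.mono (hIoc htδ)) (hlog t htδ)
  rcases le_or_gt t 0 with ht | ht
  · have hsδ : -s ≤ δ := by linarith
    have h := mean_oscillation_le_of_nonneg (s := -t) (hΛ (-s) (by linarith) hsδ) (by linarith)
      (by linarith) (hf (by linarith) (by linarith) hsδ) heven (hcont.mono (hIoc hsδ))
      (hanti.mono (hIoc hsδ)) (hlog _ hsδ)
    rw [← intervalIntegral.integral_comp_neg, ← intervalIntegral.integral_comp_neg,
      show -s - -t = t - s by ring] at h
    simpa only [heven] using h
  · have hR : max (-s) t ≤ δ := max_le (by linarith) htδ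
    refine mean_oscillation_le_of_neg_of_pos (hΛ _ (lt_max_of_lt_right ht) hR) hs ht
      (by linarith [le_max_left (-s) t]) (le_max_right _ _) (max_le (by linarith) (by linarith))
      (hf hδs hst.le htδ) heven (hcont.mono (hIoc hR)) (hanti.mono (hIoc hR)) (hlog _ hR)

/-- Same as Statement 4 but with `f` additionally monotone on `(0,δ]`; then the
constant improves to `4 e⁻¹ / log(2/(t-s))`. -/
theorem mean_oscillation_le_of_even_log_deriv_bound_of_monotone
    (δ : ℝ) (hδ0 : 0 < δ) (hδ : δ ≤ (1 / 4) * Real.exp (-1)) (f : ℝ → ℝ)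
    (heven : ∀ x, f (-x) = f x)
    (hint : IntervalIntegrable f volume (-δ) δ)
    (hdiff : ∀ x : ℝ, 0 < |x| → |x| ≤ δ → DifferentiableAt ℝ f x)
    (hbound : ∀ x : ℝ, 0 < |x| → |x| ≤ δ →
      |deriv f x| ≤ 1 / (|x| * (-Real.log |x|)))
    (hmono : MonotoneOn f (Set.Ioc 0 δ) ∨ AntitoneOn f (Set.Ioc 0 δ)) :
    ∀ s t : ℝ, s < t → Set.Icc s t ⊆ Set.Icc (-δ) δ →
      (1 / (t - s)) * ∫ x in s..t, |f x - (1 / (t - s)) * ∫ y in s..t, f y| ≤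
        4 * Real.exp (-1) / Real.log (2 / (t - s)) := by
  intro s t hst hsub
  rcases hmono with hmono | hanti
  · have h := mean_oscillation_le_of_antitone (f := fun x => -f x) hδ0 hδ
      (fun x => by rw [heven]) hint.neg (fun x h0 hx => (hdiff x h0 hx).neg)
      (fun x h0 hx => by rw [deriv.fun_neg, abs_neg]; exact hbound x h0 hx) hmono.neg hst hsub
    refine le_trans (le_of_eq ?_) h
    congr 1
    refine integral_congr fun x _ => ?_
    simp only [intervalIntegral.integral_neg]
    rw [← abs_neg]
    congr 1
    ring
  · exact mean_oscillation_le_of_antitone hδ0 hδ heven hint hdiff hbound hanti hst hsub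
end

section
/- Let 0 < δ ≤ e^{-2} and let f : ℝ → ℂ be continuous at 0, differentiable at every x with 0 < |x| ≤ δ, and satisfy ‖f'(x)‖ ≤ 1/(|x| · (log|x|)²) for all 0 < |x| ≤ δ. Then for every subinterval I = [s,t] ⊆ [-δ,δ] with s < t one has MO_I(f) ≤ 1 / log(log(2/(t-s))). -/
open MeasureTheory intervalIntegral

/-- The function `x ↦ 1 / log (1 / x)`, with value `0` at `0`. -/
noncomputable def negInvLog (x : ℝ) : ℝ := -(Real.log x)⁻¹

lemma negInvLog_zero : negInvLog 0 = 0 := by simp [negInvLog]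

lemma log_le_neg_two {x : ℝ} (hx : 0 < x) (hx2 : x ≤ Real.exp (-2)) : Real.log x ≤ -2 :=
  (Real.log_le_iff_le_exp hx).2 hx2

lemma hasDerivAt_negInvLog {x : ℝ} (hx : 0 < x) (hx2 : x ≤ Real.exp (-2)) :
    HasDerivAt negInvLog (1 / (x * (Real.log x) ^ 2)) x := by
  have hl := log_le_neg_two hx hx2
  have hl0 : Real.log x ≠ 0 := by linarith
  refine ((Real.hasDerivAt_log hx.ne').inv hl0).neg.congr_deriv ?_
  field_simp

lemma continuousOn_negInvLog : ContinuousOn negInvLog (Set.Icc 0 (Real.exp (-2))) := by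
  intro x hx
  rcases hx.1.eq_or_lt with rfl | h0
  · have h : Filter.Tendsto negInvLog (nhdsWithin 0 {0}ᶜ) (nhds 0) := by
      have := (tendsto_inv_atBot_zero.comp Real.tendsto_log_nhdsNE_zero).neg
      rwa [neg_zero] at this
    have h' : ContinuousAt negInvLog 0 := by
      rw [continuousAt_iff_punctured_nhds, negInvLog_zero]
      exact h
    exact h'.continuousWithinAt
  · exact (hasDerivAt_negInvLog h0 hx.2).continuousAt.continuousWithinAt

lemma mul_log_sq_le_mul_log_sq {x y : ℝ} (hx : 0 < x) (hxy : x ≤ y) (hy : y ≤ Real.exp (-2)) :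
    x * (Real.log x) ^ 2 ≤ y * (Real.log y) ^ 2 := by
  have hy0 := hx.trans_le hxy
  have hly := log_le_neg_two hy0 hy
  have hlxy := Real.log_le_log hx hxy
  set u := Real.log x with hu
  set v := Real.log y with hv
  have hy' : y = x * (Real.exp ((v - u) / 2)) ^ 2 := by
    rw [← Real.exp_nat_mul, ← Real.exp_log hx, ← Real.exp_log hy0, ← hu, ← hv, ← Real.exp_add]
    congr 1
    push_cast
    ring
  have hexp := Real.add_one_le_exp ((v - u) / 2)
  have h1 : -u ≤ Real.exp ((v - u) / 2) * (-v) := by nlinarith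
  have h2 : u ^ 2 ≤ (Real.exp ((v - u) / 2) * (-v)) ^ 2 := by nlinarith
  calc x * u ^ 2 ≤ x * (Real.exp ((v - u) / 2) * (-v)) ^ 2 := by gcongr
    _ = x * (Real.exp ((v - u) / 2)) ^ 2 * v ^ 2 := by ring
    _ = y * v ^ 2 := by rw [← hy']

lemma concaveOn_negInvLog : ConcaveOn ℝ (Set.Icc 0 (Real.exp (-2))) negInvLog := by
  refine AntitoneOn.concaveOn_of_deriv (convex_Icc _ _) continuousOn_negInvLog ?_ ?_
  · rw [interior_Icc]
    exact fun x hx => (hasDerivAt_negInvLog hx.1 hx.2.le).differentiableAt.differentiableWithinAt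
  · rw [interior_Icc]
    intro x hx y hy hxy
    rw [(hasDerivAt_negInvLog hx.1 hx.2.le).deriv, (hasDerivAt_negInvLog hy.1 hy.2.le).deriv]
    have := log_le_neg_two hx.1 hx.2.le
    have : 0 < x * (Real.log x) ^ 2 := mul_pos hx.1 (by nlinarith)
    exact one_div_le_one_div_of_le this (mul_log_sq_le_mul_log_sq hx.1 hxy hy.2.le)

lemma negInvLog_mono {x y : ℝ} (hx : 0 ≤ x) (hxy : x ≤ y) (hy : y ≤ Real.exp (-2)) :
    negInvLog x ≤ negInvLog y := by
  have hmono : MonotoneOn negInvLog (Set.Icc 0 (Real.exp (-2))) := by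
    refine monotoneOn_of_deriv_nonneg (convex_Icc _ _) continuousOn_negInvLog ?_ ?_
    · rw [interior_Icc]
      exact fun x hx =>
        (hasDerivAt_negInvLog hx.1 hx.2.le).differentiableAt.differentiableWithinAt
    · rw [interior_Icc]
      intro x hx
      rw [(hasDerivAt_negInvLog hx.1 hx.2.le).deriv]
      have := hx.1
      positivity
  exact hmono ⟨hx, hxy.trans hy⟩ ⟨hx.trans hxy, hy⟩ hxy

lemma negInvLog_add_le {x y : ℝ} (hx : 0 ≤ x) (hx2 : x ≤ Real.exp (-2)) (hy : 0 ≤ y)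
    (hy2 : y ≤ Real.exp (-2)) : negInvLog x + negInvLog y ≤ 2 * negInvLog ((x + y) / 2) := by
  have h := concaveOn_negInvLog.2 (show x ∈ _ from ⟨hx, hx2⟩) (show y ∈ _ from ⟨hy, hy2⟩)
    (show (0 : ℝ) ≤ 1 / 2 by norm_num) (show (0 : ℝ) ≤ 1 / 2 by norm_num) (by norm_num)
  simp only [smul_eq_mul] at h
  rw [show 1 / 2 * x + 1 / 2 * y = (x + y) / 2 by ring] at h
  linarith

lemma mul_negInvLog_le {c x : ℝ} (hc : 0 ≤ c) (hc1 : c ≤ 1) (hx : 0 ≤ x)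
    (hx2 : x ≤ Real.exp (-2)) : c * negInvLog x ≤ negInvLog (c * x) := by
  have h := concaveOn_negInvLog.2 (show x ∈ _ from ⟨hx, hx2⟩)
    (show (0 : ℝ) ∈ _ from ⟨le_rfl, (Real.exp_pos _).le⟩) hc (sub_nonneg.2 hc1) (by ring)
  simpa [negInvLog_zero] using h

lemma negInvLog_sub_le {x y : ℝ} (hy : 0 ≤ y) (hyx : y ≤ x) (hx2 : x ≤ Real.exp (-2)) :
    negInvLog x - negInvLog y ≤ 2 * negInvLog ((x - y) / 2) := by
  rcases (hy.trans hyx).eq_or_lt with h0 | hx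
  · have : y = 0 := by linarith
    subst this
    simp [← h0, negInvLog_zero]
  · have h1 := mul_negInvLog_le (c := y / x) (by positivity) ((div_le_one hx).2 hyx) hx.le hx2
    have h2 := mul_negInvLog_le (c := (x - y) / 2 / x)
      (div_nonneg (by linarith) hx.le) ((div_le_one hx).2 (by linarith)) hx.le hx2
    rw [div_mul_cancel₀ _ hx.ne'] at h1 h2
    have h3 : y / x * negInvLog x + 2 * ((x - y) / 2 / x * negInvLog x) = negInvLog x := by
      field_simp
      ring
    linarith

lemma norm_sub_le_negInvLog_sub {E : Type*} [NormedAddCommGroup E] [NormedSpace ℝ E]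
    {δ : ℝ} (hδ : δ ≤ Real.exp (-2)) {f f' : ℝ → E} (hcont : ContinuousAt f 0)
    (hderiv : ∀ x, 0 < x → x ≤ δ → HasDerivAt f (f' x) x)
    (hbound : ∀ x, 0 < x → x ≤ δ → ‖f' x‖ ≤ 1 / (x * (Real.log x) ^ 2))
    {x y : ℝ} (hy : 0 ≤ y) (hyx : y ≤ x) (hx : x ≤ δ) :
    ‖f x - f y‖ ≤ negInvLog x - negInvLog y := by
  have pos : ∀ z, 0 < z → z ≤ x → ‖f x - f z‖ ≤ negInvLog x - negInvLog z := by
    intro z hz hzx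
    have hB : ∀ w ∈ Set.Icc z x, HasDerivAt (fun w => negInvLog w - negInvLog z)
        (1 / (w * (Real.log w) ^ 2)) w := fun w hw =>
      (hasDerivAt_negInvLog (hz.trans_le hw.1) (hw.2.trans (hx.trans hδ))).sub_const _
    have hF : ∀ w ∈ Set.Icc z x, HasDerivAt (fun w => f w - f z) (f' w) w := fun w hw =>
      (hderiv w (hz.trans_le hw.1) (hw.2.trans hx)).sub_const _
    exact image_norm_le_of_norm_deriv_right_le_deriv_boundary'
      (fun w hw => (hF w hw).continuousAt.continuousWithinAt)
      (fun w hw => (hF w ⟨hw.1, hw.2.le⟩).hasDerivWithinAt) (by simp)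
      (fun w hw => (hB w hw).continuousAt.continuousWithinAt)
      (fun w hw => (hB w ⟨hw.1, hw.2.le⟩).hasDerivWithinAt)
      (fun w hw => hbound w (hz.trans_le hw.1) (hw.2.le.trans hx)) ⟨hzx, le_rfl⟩
  rcases hy.eq_or_lt with rfl | hy0
  · rcases hyx.eq_or_lt with rfl | hx0
    · simp
    have hg : Filter.Tendsto negInvLog (nhdsWithin 0 (Set.Ioo 0 x)) (nhds (negInvLog 0)) :=
      (continuousOn_negInvLog 0 ⟨le_rfl, (Real.exp_pos _).le⟩).mono
        fun w hw => ⟨hw.1.le, hw.2.le.trans (hx.trans hδ)⟩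
    have hf : Filter.Tendsto f (nhdsWithin 0 (Set.Ioo 0 x)) (nhds (f 0)) :=
      hcont.tendsto.mono_left nhdsWithin_le_nhds
    have hne : (nhdsWithin 0 (Set.Ioo 0 x)).NeBot := left_nhdsWithin_Ioo_neBot hx0
    exact le_of_tendsto_of_tendsto (hf.const_sub _).norm (hg.const_sub _)
      (Filter.eventually_of_mem self_mem_nhdsWithin fun w hw => pos w hw.1 hw.2.le)
  · exact pos y hy0 hyx

lemma norm_sub_le_two_mul_negInvLog {E : Type*} [NormedAddCommGroup E] [NormedSpace ℝ E]
    {δ : ℝ} (hδ : δ ≤ Real.exp (-2)) {f : ℝ → E} (hcont : ContinuousAt f 0)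
    (hdiff : ∀ x : ℝ, 0 < |x| → |x| ≤ δ → DifferentiableAt ℝ f x)
    (hbound : ∀ x : ℝ, 0 < |x| → |x| ≤ δ → ‖deriv f x‖ ≤ 1 / (|x| * (Real.log |x|) ^ 2))
    {x y : ℝ} (hy : -δ ≤ y) (hyx : y ≤ x) (hx : x ≤ δ) :
    ‖f x - f y‖ ≤ 2 * negInvLog ((x - y) / 2) := by
  have right : ∀ {a b : ℝ}, 0 ≤ b → b ≤ a → a ≤ δ →
      ‖f a - f b‖ ≤ negInvLog a - negInvLog b := by
    refine fun {a b} => norm_sub_le_negInvLog_sub (f' := deriv f) hδ hcont ?_ ?_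
    · exact fun z hz hzδ => (hdiff z (abs_pos.2 hz.ne') (by rwa [abs_of_pos hz])).hasDerivAt
    · intro z hz hzδ
      simpa only [abs_of_pos hz] using hbound z (abs_pos.2 hz.ne') (by rwa [abs_of_pos hz])
  have left : ∀ {a b : ℝ}, 0 ≤ b → b ≤ a → a ≤ δ →
      ‖f (-a) - f (-b)‖ ≤ negInvLog a - negInvLog b := by
    refine fun {a b} => norm_sub_le_negInvLog_sub (f := fun z => f (-z))
      (f' := fun z => -deriv f (-z)) hδ ?_ ?_ ?_
    · exact ContinuousAt.comp (f := fun z : ℝ => -z) (by simpa using hcont)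
        continuous_neg.continuousAt
    · intro z hz hzδ
      have h := (hdiff (-z) (by simpa using hz.ne') (by rwa [abs_neg, abs_of_pos hz])).hasDerivAt
      exact (h.scomp z (hasDerivAt_neg z)).congr_deriv (neg_one_smul ℝ _)
    · intro z hz hzδ
      simpa only [abs_neg, abs_of_pos hz, norm_neg] using
        hbound (-z) (by simpa using hz.ne') (by rwa [abs_neg, abs_of_pos hz])
  rcases le_total 0 y with h0y | hy0
  · exact (right h0y hyx hx).trans (negInvLog_sub_le h0y hyx (hx.trans hδ))
  rcases le_total x 0 with hx0 | h0x
  · have h := left (a := -y) (b := -x) (by linarith) (by linarith) (by linarith)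
    rw [neg_neg, neg_neg, norm_sub_rev] at h
    have h' := negInvLog_sub_le (x := -y) (y := -x) (by linarith) (by linarith) (by linarith)
    rw [show -y - -x = x - y by ring] at h'
    exact h.trans h'
  · have h1 := right le_rfl h0x hx
    have h2 := left (a := -y) le_rfl (by linarith) (by linarith)
    rw [neg_neg, neg_zero, norm_sub_rev] at h2
    have h3 := norm_sub_le_norm_sub_add_norm_sub (f x) (f 0) (f y)
    have h4 := negInvLog_add_le h0x (hx.trans hδ) (y := -y) (by linarith) (by linarith)
    rw [← sub_eq_add_neg] at h4
    rw [negInvLog_zero] at h1 h2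
    linarith

/-- The mean oscillation of a continuous function is at most the diameter of its range. -/
lemma mean_oscillation_le_of_norm_sub_le {f : ℝ → ℂ} {s t C : ℝ} (hst : s < t)
    (hf : ContinuousOn f (Set.Icc s t))
    (hC : ∀ x ∈ Set.Icc s t, ∀ y ∈ Set.Icc s t, ‖f x - f y‖ ≤ C) :
    (1 / (t - s)) * ∫ x in s..t, ‖f x - (((t - s) : ℂ))⁻¹ * ∫ y in s..t, f y‖ ≤ C := by
  have hpos : 0 < t - s := sub_pos.2 hst
  have hne : ((t : ℂ) - s) ≠ 0 := by exact_mod_cast hpos.ne'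
  have hint : IntervalIntegrable f volume s t :=
    ContinuousOn.intervalIntegrable (by rwa [Set.uIcc_of_le hst.le])
  have hsub : Set.uIoc s t ⊆ Set.Icc s t := by
    rw [Set.uIoc_of_le hst.le]
    exact Set.Ioc_subset_Icc_self
  have hpt : ∀ x ∈ Set.Icc s t, ‖f x - (((t - s) : ℂ))⁻¹ * ∫ y in s..t, f y‖ ≤ C := by
    intro x hx
    have heq : f x - (((t - s) : ℂ))⁻¹ * ∫ y in s..t, f y
        = (((t - s) : ℂ))⁻¹ * ∫ y in s..t, (f x - f y) := by
      rw [intervalIntegral.integral_sub (by simp) hint, intervalIntegral.integral_const,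
        Complex.real_smul]
      push_cast
      field_simp
    have hle := intervalIntegral.norm_integral_le_of_norm_le_const
      (fun y hy => hC x hx y (hsub hy))
    rw [abs_of_pos hpos] at hle
    have hnorm : ‖((t : ℂ) - s)‖ = t - s := by
      rw [← Complex.ofReal_sub, Complex.norm_real, Real.norm_of_nonneg hpos.le]
    rw [heq, norm_mul, norm_inv, hnorm, inv_mul_le_iff₀ hpos]
    linarith
  have hle := intervalIntegral.norm_integral_le_of_norm_le_const
    (f := fun x => ‖f x - (((t - s) : ℂ))⁻¹ * ∫ y in s..t, f y‖)
    (fun x hx => by rw [norm_norm]; exact hpt x (hsub hx))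
  rw [abs_of_pos hpos] at hle
  rw [one_div, inv_mul_le_iff₀ hpos]
  linarith [(le_abs_self _).trans hle]

/-- If `f : ℝ → ℂ` is continuous at `0`, differentiable at every `x` with
`0 < |x| ≤ δ ≤ e⁻²`, and `‖f'(x)‖ ≤ 1/(|x|·(log|x|)²)` there, then for every subinterval
`I = [s,t] ⊆ [-δ,δ]`, `MO_I(f) ≤ 1 / log(log(2/(t-s)))`. -/
theorem mean_oscillation_le_of_loglog_deriv_bound
    (δ : ℝ) (hδ0 : 0 < δ) (hδ : δ ≤ Real.exp (-2)) (f : ℝ → ℂ)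
    (hcont : ContinuousAt f 0)
    (hdiff : ∀ x : ℝ, 0 < |x| → |x| ≤ δ → DifferentiableAt ℝ f x)
    (hbound : ∀ x : ℝ, 0 < |x| → |x| ≤ δ →
      ‖deriv f x‖ ≤ 1 / (|x| * (Real.log |x|) ^ 2)) :
    ∀ s t : ℝ, s < t → Set.Icc s t ⊆ Set.Icc (-δ) δ →
      (1 / (t - s)) * ∫ x in s..t,
          ‖f x - (((t - s) : ℂ))⁻¹ * ∫ y in s..t, f y‖ ≤
        1 / Real.log (Real.log (2 / (t - s))) := by
  intro s t hst hsub
  have hs := (hsub ⟨le_rfl, hst.le⟩).1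
  have ht := (hsub ⟨hst.le, le_rfl⟩).2
  have hcontOn : ContinuousOn f (Set.Icc s t) := by
    intro x hx
    rcases eq_or_ne x 0 with rfl | h0
    · exact hcont.continuousWithinAt
    · exact (hdiff x (abs_pos.2 h0) (abs_le.2 (hsub hx))).continuousAt.continuousWithinAt
  have hosc : ∀ x ∈ Set.Icc s t, ∀ y ∈ Set.Icc s t, y ≤ x →
      ‖f x - f y‖ ≤ 2 * negInvLog ((t - s) / 2) := by
    intro x hx y hy hyx
    refine (norm_sub_le_two_mul_negInvLog hδ hcont hdiff hbound
      (hsub hy).1 hyx (hsub hx).2).trans ?_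
    have := negInvLog_mono (x := (x - y) / 2) (y := (t - s) / 2) (by linarith)
      (by linarith [hx.2, hy.1]) (by linarith)
    linarith
  refine (mean_oscillation_le_of_norm_sub_le hst hcontOn
    (C := 2 * negInvLog ((t - s) / 2)) fun x hx y hy => ?_).trans ?_
  · rcases le_total y x with h | h
    · exact hosc x hx y hy h
    · rw [norm_sub_rev]
      exact hosc y hy x hx h
  · have hlog : Real.log (2 / (t - s)) = -Real.log ((t - s) / 2) := by
      rw [← Real.log_inv, inv_div]
    have hl := log_le_neg_two (x := (t - s) / 2) (by linarith) (by linarith)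
    rw [negInvLog, ← inv_neg, ← hlog]
    set L := Real.log (2 / (t - s))
    have hL : 2 ≤ L := by linarith
    have hlogpos : 0 < Real.log L := Real.log_pos (by linarith)
    have hlogL : Real.log L ≤ L / 2 := by
      have h1 := Real.log_le_sub_one_of_pos (show 0 < L / 2 by linarith)
      have h2 := Real.log_le_sub_one_of_pos (show (0 : ℝ) < 2 by norm_num)
      rw [Real.log_div (by linarith) (by norm_num)] at h1
      linarith
    rw [show 2 * L⁻¹ = 1 / (L / 2) by field_simp]
    exact one_div_le_one_div_of_le hlogpos hlogL
end

section
/- For every d > 0, the mean oscillation of the natural logarithm over the interval I = [0,d] equals 2/e; that is, (1/d) ∫_0^d |log x - ((1/d)∫_0^d log ξ dξ)| dx = 2 e^{-1} (equivalently, (1/d)∫_0^d |log x - log d + 1| dx = 2e^{-1}). -/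
open MeasureTheory intervalIntegral

/-- The mean of `log` over `[0, d]` is `log d - 1`. -/
theorem mean_log_from_zero {d : ℝ} (hd : d ≠ 0) :
    (1 / d) * ∫ ξ in (0:ℝ)..d, Real.log ξ = Real.log d - 1 := by
  rw [integral_log_from_zero]
  field_simp

/-- The part of the `L¹` distance of `log` to `log c` lying left of `c`. -/
theorem integral_abs_log_sub_log_from_zero {c : ℝ} (hc : 0 < c) :
    ∫ x in (0:ℝ)..c, |Real.log x - Real.log c| = c := by
  have h : ∫ x in (0:ℝ)..c, |Real.log x - Real.log c| =
      ∫ x in (0:ℝ)..c, (Real.log c - Real.log x) := by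
    refine integral_congr_ae (Filter.Eventually.of_forall fun x hx ↦ ?_)
    rw [Set.uIoc_of_le hc.le] at hx
    rw [abs_sub_comm, abs_of_nonneg (sub_nonneg.2 (Real.log_le_log hx.1 hx.2))]
  rw [h, integral_sub intervalIntegrable_const intervalIntegrable_log', integral_log_from_zero,
    intervalIntegral.integral_const, smul_eq_mul]
  ring

/-- The part of the `L¹` distance of `log` to `log c` lying between `c` and `d`. -/
theorem integral_abs_log_sub_log_of_le {c d : ℝ} (hc : 0 < c) (hcd : c ≤ d) :
    ∫ x in c..d, |Real.log x - Real.log c| = d * (Real.log d - Real.log c - 1) + c := by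
  have h : ∫ x in c..d, |Real.log x - Real.log c| =
      ∫ x in c..d, (Real.log x - Real.log c) := by
    refine integral_congr_ae (Filter.Eventually.of_forall fun x hx ↦ ?_)
    rw [Set.uIoc_of_le hcd] at hx
    rw [abs_of_nonneg (sub_nonneg.2 (Real.log_le_log hc hx.1.le))]
  rw [h, integral_sub intervalIntegrable_log' intervalIntegrable_const, integral_log,
    intervalIntegral.integral_const, smul_eq_mul]
  ring

/-- For every `d > 0`, the mean oscillation of `log` over `[0,d]` equals `2/e`. -/
theorem mean_oscillation_log_eq_two_div_e (d : ℝ) (hd : 0 < d) :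
    (1 / d) * ∫ x in (0:ℝ)..d,
        |Real.log x - (1 / d) * ∫ ξ in (0:ℝ)..d, Real.log ξ| =
      2 * Real.exp (-1) := by
  set c := d * Real.exp (-1) with hc_def
  have hc : 0 < c := by positivity
  have hcd : c ≤ d := mul_le_of_le_one_right hd.le (Real.exp_le_one_iff.2 (by norm_num))
  have hlog : Real.log c = Real.log d - 1 := by
    rw [hc_def, Real.log_mul hd.ne' (Real.exp_ne_zero _), Real.log_exp, sub_eq_add_neg]
  have hint (a b : ℝ) :
      IntervalIntegrable (fun x ↦ |Real.log x - Real.log c|) volume a b :=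
    (intervalIntegrable_log'.sub intervalIntegrable_const).abs
  rw [mean_log_from_zero hd.ne', ← hlog, ← integral_add_adjacent_intervals (hint 0 c) (hint c d),
    integral_abs_log_sub_log_from_zero hc, integral_abs_log_sub_log_of_le hc hcd, hlog, hc_def]
  field_simp
  ring
end

section
/- The function θ ↦ Log(1 - Log(1 + e^{iθ})) (defined for θ ≢ π (mod 2π)) is integrable on [0, 2π], and all of its negative Fourier coefficients vanish: for every integer n < 0, (1/(2π)) ∫_0^{2π} Log(1 - Log(1 + e^{iθ})) e^{-inθ} dθ = 0. In other words, log a⁺, where a⁺(z) = 1 - ln(1+z), belongs to the Hardy space H¹ of the circle. -/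
open MeasureTheory intervalIntegral Real

open Metric Set Filter Topology in
/-- The mean value property on the unit circle for a holomorphic function on the open unit disc that
is continuous at almost every boundary point and dominated on the concentric circles. -/
theorem circleAverage_eq_of_dominated {f : ℂ → ℂ} {bound : ℝ → ℝ}
    (hf : DifferentiableOn ℂ f (ball 0 1))
    (hbound : ∀ r ∈ Ioo (0 : ℝ) 1, ∀ᵐ θ : ℝ, ‖f (circleMap 0 r θ)‖ ≤ bound θ)
    (hint : IntervalIntegrable bound volume 0 (2 * π))
    (hcont : ∀ᵐ θ : ℝ, ContinuousAt f (circleMap 0 1 θ)) :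
    circleAverage f 0 1 = f 0 := by
  have hevent : ∀ᶠ r in 𝓝[<] (1 : ℝ), r ∈ Ioo (0 : ℝ) 1 := Ioo_mem_nhdsLT one_pos
  have havg : ∀ r ∈ Ioo (0 : ℝ) 1, circleAverage f 0 r = f 0 := by
    intro r hr
    refine DiffContOnCl.circleAverage (DifferentiableOn.diffContOnCl (hf.mono ?_))
    rw [abs_of_pos hr.1]
    exact closure_ball_subset_closedBall.trans (closedBall_subset_ball hr.2)
  have hlim : Tendsto (fun r => ∫ θ in (0 : ℝ)..2 * π, f (circleMap 0 r θ)) (𝓝[<] 1)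
      (𝓝 (∫ θ in (0 : ℝ)..2 * π, f (circleMap 0 1 θ))) := by
    refine intervalIntegral.tendsto_integral_filter_of_dominated_convergence bound ?_ ?_ hint ?_
    · filter_upwards [hevent] with r hr
      refine Continuous.aestronglyMeasurable ?_
      refine hf.continuousOn.comp_continuous (continuous_circleMap 0 r) fun θ => ?_
      simpa [abs_of_pos hr.1] using hr.2
    · filter_upwards [hevent] with r hr
      filter_upwards [hbound r hr] with θ hθ _ using hθ
    · filter_upwards [hcont] with θ hθ _
      have hr : Tendsto (fun r : ℝ => circleMap 0 r θ) (𝓝[<] 1) (𝓝 (circleMap 0 1 θ)) := by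
        refine Tendsto.mono_left (Continuous.tendsto ?_ 1) nhdsWithin_le_nhds
        unfold circleMap
        fun_prop
      exact hθ.tendsto.comp hr
  refine tendsto_nhds_unique (f := fun r => circleAverage f 0 r) (hlim.const_smul _) ?_
  exact tendsto_const_nhds.congr' (by filter_upwards [hevent] with r hr using (havg r hr).symm)

theorem one_add_re_pos_of_norm_le_one {z : ℂ} (hz : ‖z‖ ≤ 1) (hne : z ≠ -1) : 0 < (1 + z).re := by
  by_contra! h
  have hre : z.re ≤ -1 := by simp at h; linarith
  have hsq : z.re * z.re + z.im * z.im ≤ 1 := by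
    rw [← Complex.normSq_apply, Complex.normSq_eq_norm_sq]
    nlinarith [norm_nonneg z]
  apply hne
  apply Complex.ext
  · simp; nlinarith
  · simp; nlinarith

theorem one_sub_log_two_le_re {z : ℂ} (hz : ‖z‖ ≤ 1) (hne : z ≠ -1) :
    1 - Real.log 2 ≤ (1 - Complex.log (1 + z)).re := by
  have h0 : 0 < ‖1 + z‖ := norm_pos_iff.2 fun h => hne (eq_neg_of_add_eq_zero_right h)
  have h2 : ‖1 + z‖ ≤ 2 := (norm_add_le _ _).trans (by simp; linarith)
  rw [Complex.sub_re, Complex.one_re, Complex.log_re]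
  linarith [Real.log_le_log h0 h2]

theorem one_sub_log_two_pos : 0 < 1 - Real.log 2 := by
  linarith [Real.log_two_lt_d9]

theorem differentiableAt_log_one_sub_log {z : ℂ} (hz : ‖z‖ ≤ 1) (hne : z ≠ -1) :
    DifferentiableAt ℂ (fun z => Complex.log (1 - Complex.log (1 + z))) z := by
  have h1 : 1 + z ∈ Complex.slitPlane := Or.inl (one_add_re_pos_of_norm_le_one hz hne)
  have h2 : 1 - Complex.log (1 + z) ∈ Complex.slitPlane :=
    Or.inl (one_sub_log_two_pos.trans_le (one_sub_log_two_le_re hz hne))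
  exact (((differentiableAt_id.const_add 1).clog h1).const_sub 1).clog h2

theorem norm_log_le_abs_log_norm_add_pi (w : ℂ) : ‖Complex.log w‖ ≤ |Real.log ‖w‖| + π := by
  refine (Complex.norm_le_abs_re_add_abs_im _).trans ?_
  rw [Complex.log_re, Complex.log_im]
  gcongr
  exact Complex.abs_arg_le_pi w

theorem norm_log_one_sub_log_le {z : ℂ} (hz : ‖z‖ ≤ 1) (hne : z ≠ -1) :
    ‖Complex.log (1 - Complex.log (1 + z))‖ ≤
      |Real.log ‖1 + z‖| + (1 + 2 * π + |Real.log (1 - Real.log 2)|) := by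
  set w := 1 - Complex.log (1 + z) with hw
  have hlow : 1 - Real.log 2 ≤ ‖w‖ := (one_sub_log_two_le_re hz hne).trans (Complex.re_le_norm w)
  have hup : ‖w‖ ≤ 1 + (|Real.log ‖1 + z‖| + π) :=
    (norm_sub_le _ _).trans (by simpa using norm_log_le_abs_log_norm_add_pi (1 + z))
  have hlog : |Real.log ‖w‖| ≤ ‖w‖ + |Real.log (1 - Real.log 2)| := by
    refine abs_le.2 ⟨?_, ?_⟩
    · have := Real.log_le_log one_sub_log_two_pos hlow
      linarith [neg_abs_le (Real.log (1 - Real.log 2)), norm_nonneg w]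
    · linarith [Real.log_le_self (norm_nonneg w), abs_nonneg (Real.log (1 - Real.log 2))]
  linarith [norm_log_le_abs_log_norm_add_pi w]

theorem abs_log_norm_one_add_mul_le {ζ : ℂ} (hζ : ‖ζ‖ = 1) (hne : ζ ≠ -1) {r : ℝ}
    (hr0 : 0 ≤ r) (hr1 : r ≤ 1) :
    |Real.log ‖1 + r * ζ‖| ≤ Real.log 2 + |Real.log ‖1 + ζ‖| := by
  have hnorm : ‖(r : ℂ) * ζ‖ = r := by simp [hζ, abs_of_nonneg hr0]
  have hpos : 0 < ‖1 + ζ‖ := norm_pos_iff.2 fun h => hne (eq_neg_of_add_eq_zero_right h)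
  have hhalf : ‖1 + ζ‖ ≤ 2 * ‖1 + r * ζ‖ := by
    have hdist : 1 - r ≤ ‖1 + r * ζ‖ := by
      have := norm_sub_le (1 + r * ζ) (r * ζ)
      rw [hnorm] at this
      simp at this
      linarith
    have hsplit : ‖1 + ζ‖ ≤ ‖1 + r * ζ‖ + (1 - r) := by
      have := norm_add_le (1 + r * ζ) ((1 - r : ℝ) * ζ)
      have hrem : ‖((1 - r : ℝ) : ℂ) * ζ‖ = 1 - r := by
        rw [norm_mul, hζ, Complex.norm_real, Real.norm_of_nonneg (by linarith), mul_one]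
      rw [hrem] at this
      refine le_of_eq_of_le (congrArg _ ?_) this
      push_cast
      ring
    linarith
  have hpos' : 0 < ‖1 + r * ζ‖ := by linarith
  have hup : ‖1 + r * ζ‖ ≤ 2 := (norm_add_le _ _).trans (by rw [hnorm]; simp; linarith)
  refine abs_le.2 ⟨?_, ?_⟩
  · have := Real.log_le_log hpos hhalf
    rw [Real.log_mul two_ne_zero hpos'.ne'] at this
    linarith [neg_abs_le (Real.log ‖1 + ζ‖)]
  · linarith [Real.log_le_log hpos' hup, abs_nonneg (Real.log ‖1 + ζ‖)]

theorem ae_circleMap_ne_neg_one : ∀ᵐ θ : ℝ, circleMap 0 1 θ ≠ -1 := by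
  have h := ((Set.countable_singleton (-1 : ℂ)).preimage_circleMap 0 one_ne_zero).ae_notMem volume
  simpa using h

/-- A majorant of `θ ↦ Log(1 - Log(1 + r e^{iθ}))`, uniform in `0 ≤ r ≤ 1`. -/
noncomputable def logOneSubLogBound (θ : ℝ) : ℝ :=
  |Real.log ‖1 + circleMap 0 1 θ‖| +
    (Real.log 2 + (1 + 2 * π + |Real.log (1 - Real.log 2)|))

theorem intervalIntegrable_logOneSubLogBound :
    IntervalIntegrable logOneSubLogBound volume 0 (2 * π) := by
  have h : CircleIntegrable (fun z : ℂ => Real.log ‖1 + z‖) 0 1 :=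
    MeromorphicOn.circleIntegrable_log_norm fun z _ => by fun_prop
  exact (IntervalIntegrable.abs h).add intervalIntegrable_const

theorem norm_log_one_sub_log_circleMap_le {r θ : ℝ} (hr0 : 0 ≤ r) (hr1 : r ≤ 1)
    (hθ : circleMap 0 1 θ ≠ -1) :
    ‖Complex.log (1 - Complex.log (1 + circleMap 0 r θ))‖ ≤ logOneSubLogBound θ := by
  have hmap : circleMap 0 r θ = r * circleMap 0 1 θ := by simp [circleMap]
  have hζ : ‖circleMap 0 1 θ‖ = 1 := by simp
  have hz : ‖circleMap 0 r θ‖ ≤ 1 := by simpa [abs_of_nonneg hr0] using hr1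
  have hne : circleMap 0 r θ ≠ -1 := by
    intro h
    have hr : r = 1 := by simpa [abs_of_nonneg hr0] using congrArg norm h
    exact hθ (hr ▸ h)
  have hlog := abs_log_norm_one_add_mul_le hζ hθ hr0 hr1
  rw [← hmap] at hlog
  have := norm_log_one_sub_log_le hz hne
  unfold logOneSubLogBound
  linarith

theorem circleAverage_log_one_sub_log_mul_pow (k : ℕ) :
    circleAverage (fun z => Complex.log (1 - Complex.log (1 + z)) * z ^ (k + 1)) 0 1 = 0 := by
  have hdiff {z : ℂ} (hz : ‖z‖ ≤ 1) (hne : z ≠ -1) : DifferentiableAt ℂ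
      (fun z => Complex.log (1 - Complex.log (1 + z)) * z ^ (k + 1)) z :=
    (differentiableAt_log_one_sub_log hz hne).mul (differentiableAt_id.pow _)
  rw [circleAverage_eq_of_dominated (bound := logOneSubLogBound) ?_ ?_
    intervalIntegrable_logOneSubLogBound ?_]
  · simp
  · intro z hz
    have hz' : ‖z‖ < 1 := by simpa using hz
    refine (hdiff hz'.le ?_).differentiableWithinAt
    rintro rfl
    simp at hz'
  · intro r hr
    filter_upwards [ae_circleMap_ne_neg_one] with θ hθ
    rw [norm_mul, norm_pow, norm_circleMap_zero, abs_of_pos hr.1]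
    exact (mul_le_of_le_one_right (norm_nonneg _) (pow_le_one₀ hr.1.le hr.2.le)).trans
      (norm_log_one_sub_log_circleMap_le hr.1.le hr.2.le hθ)
  · filter_upwards [ae_circleMap_ne_neg_one] with θ hθ
    exact (hdiff (by simp) hθ).continuousAt

/-- `θ ↦ Log(1 - Log(1 + e^{iθ}))` is integrable on `[0,2π]` and all of its
negative Fourier coefficients vanish, i.e. `log a⁺ ∈ H¹` of the circle. -/
theorem log_a_plus_mem_hardy_H1 :
    IntervalIntegrable
        (fun θ : ℝ => Complex.log (1 - Complex.log (1 + Complex.exp ((θ : ℂ) * Complex.I))))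
        volume 0 (2 * π) ∧
      ∀ n : ℤ, n < 0 →
        (1 / (2 * (π : ℂ))) * ∫ θ in (0:ℝ)..(2 * π),
            Complex.log (1 - Complex.log (1 + Complex.exp ((θ : ℂ) * Complex.I))) *
              Complex.exp (-(n : ℂ) * (θ : ℂ) * Complex.I) = 0 := by
  refine ⟨?_, fun n hn => ?_⟩
  · refine intervalIntegrable_logOneSubLogBound.mono_fun ?_ ?_
    · exact Measurable.aestronglyMeasurable (by fun_prop)
    · refine ae_restrict_of_ae ?_
      filter_upwards [ae_circleMap_ne_neg_one] with θ hθ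
      have h := norm_log_one_sub_log_circleMap_le zero_le_one le_rfl hθ
      simpa [circleMap] using h.trans (le_abs_self _)
  · obtain ⟨k, rfl⟩ : ∃ k : ℕ, n = -(k + 1 : ℕ) := ⟨(-n - 1).toNat, by omega⟩
    have h := circleAverage_log_one_sub_log_mul_pow k
    rw [circleAverage_def, Complex.real_smul] at h
    rw [← h]
    push_cast
    rw [one_div]
    congr 1
    refine intervalIntegral.integral_congr fun θ _ => ?_
    simp only [circleMap, Complex.ofReal_one, one_mul, zero_add]
    rw [← Complex.exp_nat_mul]
    congr 2
    push_cast
    ring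
end

section
/- The derivative with respect to x of Log(1 - Log(1 - e^{ix})) equals -i · (1 - e^{-ix})^{-1} · (1 - Log(1 - e^{ix}))^{-1} for 0 < |x| < π, and this derivative is asymptotically equivalent to 1/(x log|x|) as x → 0; precisely, the product (-i · (1 - e^{-ix})^{-1} · (1 - Log(1 - e^{ix}))^{-1}) · (x · log|x|) tends to 1 as x → 0 with x ≠ 0. -/
open Complex Filter

lemma one_sub_exp_mul_I_re_pos {x : ℝ} (h0 : 0 < |x|) (hpi : |x| < Real.pi) :
    0 < (1 - Complex.exp ((x : ℂ) * Complex.I)).re := by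
  rw [Complex.sub_re, Complex.exp_ofReal_mul_I_re, Complex.one_re, ← Real.cos_abs]
  have h := Real.cos_lt_cos_of_nonneg_of_le_pi le_rfl hpi.le h0
  rw [Real.cos_zero] at h
  linarith

lemma one_sub_exp_mul_I_im_ne_zero {x : ℝ} (h0 : 0 < |x|) (hpi : |x| < Real.pi) :
    (1 - Complex.exp ((x : ℂ) * Complex.I)).im ≠ 0 := by
  rw [Complex.sub_im, Complex.exp_ofReal_mul_I_im, Complex.one_im, zero_sub, neg_ne_zero]
  intro h
  rw [Real.sin_eq_zero_iff_of_lt_of_lt (abs_lt.mp hpi).1 (abs_lt.mp hpi).2] at h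
  exact (abs_pos.mp h0) h

lemma one_sub_log_mem_slitPlane {w : ℂ} (hw : w.im ≠ 0) :
    1 - Complex.log w ∈ Complex.slitPlane := by
  refine Or.inr ?_
  rw [Complex.sub_im, Complex.log_im, Complex.one_im, zero_sub, neg_ne_zero]
  intro h
  exact hw (Complex.arg_eq_zero_iff.mp h).2

lemma hasDerivAt_log_one_sub_log {x : ℝ} (h0 : 0 < |x|) (hpi : |x| < Real.pi) :
    HasDerivAt
      (fun y : ℝ => Complex.log (1 - Complex.log (1 - Complex.exp ((y : ℂ) * Complex.I))))
      (-Complex.I * (1 - Complex.exp (-(x : ℂ) * Complex.I))⁻¹ *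
        (1 - Complex.log (1 - Complex.exp ((x : ℂ) * Complex.I)))⁻¹) x := by
  have hre := one_sub_exp_mul_I_re_pos h0 hpi
  have hslit := one_sub_log_mem_slitPlane (one_sub_exp_mul_I_im_ne_zero h0 hpi)
  have hw : 1 - Complex.exp ((x : ℂ) * Complex.I) ≠ 0 := fun h => by simp [h] at hre
  have hexp := ((((hasDerivAt_id x).ofReal_comp).mul_const Complex.I).cexp).const_sub 1
  have hd := ((hexp.clog_real (Or.inl hre)).const_sub 1).clog_real hslit
  refine hd.congr_deriv ?_
  have he := Complex.exp_ne_zero ((x : ℂ) * Complex.I)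
  have hinv : Complex.exp (-(x : ℂ) * Complex.I) = (Complex.exp ((x : ℂ) * Complex.I))⁻¹ := by
    rw [neg_mul, Complex.exp_neg]
  have hL := Complex.slitPlane_ne_zero hslit
  simp only [id, hinv]
  have hw' : Complex.exp ((x : ℂ) * Complex.I) - 1 ≠ 0 := by
    rw [← neg_sub]; exact neg_ne_zero.mpr hw
  generalize Complex.log (1 - Complex.exp ((x : ℂ) * Complex.I)) = L at *
  generalize Complex.exp ((x : ℂ) * Complex.I) = e at *
  have hone : 1 - e⁻¹ = -(1 - e) / e := by field_simp; ring
  rw [hone, Complex.ofReal_one]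
  field_simp

lemma tendsto_one_sub_exp_mul_div (c : ℂ) :
    Tendsto (fun x : ℝ => (1 - Complex.exp ((x : ℂ) * c)) / (x : ℂ))
      (nhdsWithin 0 {0}ᶜ) (nhds (-c)) := by
  have hd := ((((hasDerivAt_id (0 : ℝ)).ofReal_comp).mul_const c).cexp).const_sub 1
  have ht := hd.tendsto_slope_zero
  simp only [id, Complex.ofReal_zero, zero_mul, Complex.exp_zero, Complex.ofReal_one, one_mul,
    sub_self, sub_zero, zero_add] at ht
  refine ht.congr fun x => ?_
  rw [Complex.real_smul, Complex.ofReal_inv, div_eq_inv_mul]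

lemma tendsto_log_norm_sub_log_abs :
    Tendsto (fun x : ℝ => Real.log ‖1 - Complex.exp ((x : ℂ) * Complex.I)‖ - Real.log |x|)
      (nhdsWithin 0 {0}ᶜ) (nhds 0) := by
  have hn := (tendsto_one_sub_exp_mul_div Complex.I).norm
  rw [norm_neg, Complex.norm_I] at hn
  have hl := hn.log one_ne_zero
  rw [Real.log_one] at hl
  have hne := hn.eventually_ne one_ne_zero
  refine hl.congr' ?_
  filter_upwards [hne, self_mem_nhdsWithin] with x hx hx0
  rw [norm_div, Complex.norm_real, Real.norm_eq_abs] at hx ⊢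
  exact Real.log_div (div_ne_zero_iff.mp hx).1 (div_ne_zero_iff.mp hx).2

lemma tendsto_one_sub_log_div_log_abs :
    Tendsto (fun x : ℝ =>
        (1 - Complex.log (1 - Complex.exp ((x : ℂ) * Complex.I))) / (Real.log |x| : ℂ))
      (nhdsWithin 0 {0}ᶜ) (nhds (-1)) := by
  have hlog : Tendsto (fun x : ℝ => Real.log |x|) (nhdsWithin 0 {0}ᶜ) atBot := by
    simpa only [Real.log_abs] using Real.tendsto_log_nhdsNE_zero
  have hinv : Tendsto (fun x : ℝ => ((Real.log |x|)⁻¹ : ℝ)) (nhdsWithin 0 {0}ᶜ) (nhds 0) :=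
    tendsto_inv_atBot_zero.comp hlog
  have harg : Tendsto
      (fun x : ℝ => (Real.log |x|)⁻¹ * (1 - Complex.exp ((x : ℂ) * Complex.I)).arg)
      (nhdsWithin 0 {0}ᶜ) (nhds 0) :=
    hinv.zero_mul_isBoundedUnder_le
      (isBoundedUnder_of ⟨Real.pi, fun _ => Complex.abs_arg_le_pi _⟩)
  have hre := (hinv.sub (hinv.mul tendsto_log_norm_sub_log_abs)).sub_const 1
  have hC := ((Complex.continuous_ofReal.tendsto _).comp hre).sub
    (((Complex.continuous_ofReal.tendsto _).comp harg).mul_const Complex.I)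
  simp only [mul_zero, sub_zero, zero_sub, Complex.ofReal_zero, zero_mul, Complex.ofReal_neg,
    Complex.ofReal_one] at hC
  refine hC.congr' ?_
  filter_upwards [hlog.eventually_ne_atBot 0] with x hx
  have hx' : (Real.log |x| : ℂ) ≠ 0 := Complex.ofReal_ne_zero.mpr hx
  simp only [Function.comp_apply, Complex.log]
  push_cast
  field_simp
  ring

/-- For `0 < |x| < π`, the derivative in `x` of `Log(1 - Log(1 - e^{ix}))` is
`-i (1 - e^{-ix})⁻¹ (1 - Log(1 - e^{ix}))⁻¹`, and this derivative is asymptotically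
equivalent to `1/(x log|x|)` as `x → 0`. -/
theorem deriv_log_a_plus_and_asymptotics :
    (∀ x : ℝ, 0 < |x| → |x| < Real.pi →
      HasDerivAt (fun y : ℝ => Complex.log (1 - Complex.log (1 - Complex.exp ((y : ℂ) * Complex.I))))
        (-Complex.I * (1 - Complex.exp (-(x : ℂ) * Complex.I))⁻¹ *
          (1 - Complex.log (1 - Complex.exp ((x : ℂ) * Complex.I)))⁻¹) x) ∧
    Tendsto (fun x : ℝ =>
        (-Complex.I * (1 - Complex.exp (-(x : ℂ) * Complex.I))⁻¹ *
            (1 - Complex.log (1 - Complex.exp ((x : ℂ) * Complex.I)))⁻¹) *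
          ((x : ℂ) * (Real.log |x| : ℂ)))
      (nhdsWithin 0 {0}ᶜ) (nhds 1) := by
  refine ⟨fun x h0 hpi => hasDerivAt_log_one_sub_log h0 hpi, ?_⟩
  have h1 := (tendsto_one_sub_exp_mul_div (-Complex.I)).inv₀ (by simp)
  have h2 := tendsto_one_sub_log_div_log_abs.inv₀ (by simp)
  have h := (h1.const_mul (-Complex.I)).mul h2
  have hone : -Complex.I * (- -Complex.I)⁻¹ * (-1 : ℂ)⁻¹ = 1 := by simp
  rw [hone] at h
  refine h.congr fun x => ?_
  rw [inv_div, inv_div, mul_neg, ← neg_mul]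
  ring
end

section
/- The symbol a belongs to BMO_log on the unit circle: there exists a constant C > 0 such that for every interval I = [s,t] ⊂ ℝ with 0 < t - s ≤ π, the mean oscillation of the (almost everywhere defined) function θ ↦ a(θ) over I satisfies MO_I(a) ≤ C / log(2π/(t-s)). -/
open MeasureTheory intervalIntegral Real

open scoped ComplexConjugate

lemma one_add_exp_mul_I_re_nonneg (θ : ℝ) : 0 ≤ (1 + Complex.exp ((θ : ℂ) * Complex.I)).re := by
  rw [Complex.add_re, Complex.one_re, Complex.exp_ofReal_mul_I_re]
  linarith [Real.neg_one_le_cos θ]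

lemma one_add_exp_mul_I_re_pos {θ : ℝ} (h : 1 + Complex.exp ((θ : ℂ) * Complex.I) ≠ 0) :
    0 < (1 + Complex.exp ((θ : ℂ) * Complex.I)).re := by
  refine lt_of_le_of_ne (one_add_exp_mul_I_re_nonneg θ) fun h0 => h ?_
  rw [Complex.add_re, Complex.one_re, Complex.exp_ofReal_mul_I_re] at h0
  have hs : Real.sin θ = 0 := by nlinarith [Real.sin_sq_add_cos_sq θ]
  apply Complex.ext
  · rw [Complex.add_re, Complex.one_re, Complex.exp_ofReal_mul_I_re, ← h0, Complex.zero_re]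
  · rw [Complex.add_im, Complex.one_im, Complex.exp_ofReal_mul_I_im, hs, Complex.zero_im, add_zero]

lemma norm_one_add_exp_mul_I_le (θ : ℝ) : ‖1 + Complex.exp ((θ : ℂ) * Complex.I)‖ ≤ 2 := by
  refine (norm_add_le _ _).trans ?_
  rw [Complex.norm_exp_ofReal_mul_I, norm_one]
  norm_num

/-- The numerator `1 - Log (1 + e^{iθ})` of the symbol. -/
noncomputable def symbolNum (θ : ℝ) : ℂ := 1 - Complex.log (1 + Complex.exp ((θ : ℂ) * Complex.I))

lemma conj_symbolNum (θ : ℝ) :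
    conj (symbolNum θ) = 1 - Complex.log (1 + Complex.exp (-(θ : ℂ) * Complex.I)) := by
  have harg : (1 + Complex.exp ((θ : ℂ) * Complex.I)).arg ≠ π := by
    intro h
    have := Complex.abs_arg_le_pi_div_two_iff.2 (one_add_exp_mul_I_re_nonneg θ)
    rw [h, abs_of_pos pi_pos] at this
    linarith [pi_pos]
  rw [symbolNum, map_sub, map_one, ← Complex.log_conj _ harg, map_add, map_one,
    ← Complex.exp_conj, map_mul, Complex.conj_ofReal, Complex.conj_I, mul_neg, neg_mul]

lemma symbolNum_re (θ : ℝ) :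
    (symbolNum θ).re = 1 - Real.log ‖1 + Complex.exp ((θ : ℂ) * Complex.I)‖ := by
  rw [symbolNum, Complex.sub_re, Complex.one_re, Complex.log_re]

lemma abs_symbolNum_im_le (θ : ℝ) : |(symbolNum θ).im| ≤ π / 2 := by
  rw [symbolNum, Complex.sub_im, Complex.one_im, Complex.log_im, zero_sub, abs_neg]
  exact Complex.abs_arg_le_pi_div_two_iff.2 (one_add_exp_mul_I_re_nonneg θ)

lemma log_norm_one_add_exp_mul_I_le (θ : ℝ) :
    Real.log ‖1 + Complex.exp ((θ : ℂ) * Complex.I)‖ ≤ 0.6931471808 := by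
  rcases (norm_nonneg (1 + Complex.exp ((θ : ℂ) * Complex.I))).eq_or_lt with h | h
  · rw [← h, Real.log_zero]; norm_num
  · exact (Real.log_le_log h (norm_one_add_exp_mul_I_le θ)).trans Real.log_two_lt_d9.le

lemma symbolNum_re_pos (θ : ℝ) : 0 < (symbolNum θ).re := by
  rw [symbolNum_re]
  linarith [log_norm_one_add_exp_mul_I_le θ]

lemma symbolNum_ne_zero (θ : ℝ) : symbolNum θ ≠ 0 := fun h => by
  simpa [h] using symbolNum_re_pos θ

lemma norm_div_conj_sub_one_le {z : ℂ} (hz : 0 < z.re) : ‖z / conj z - 1‖ ≤ 2 * |z.im| / z.re := by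
  have hz0 : z ≠ 0 := fun h => by simp [h] at hz
  have hc : conj z ≠ 0 := (map_ne_zero _).2 hz0
  rw [div_sub_one hc, Complex.sub_conj, norm_div, Complex.norm_conj, norm_mul, Complex.norm_I,
    mul_one, Complex.norm_real, Real.norm_eq_abs, abs_mul, abs_two]
  exact div_le_div_of_nonneg_left (by positivity) hz (Complex.re_le_norm z)

lemma norm_div_conj_sub_div_conj_le {z w : ℂ} (hz : z ≠ 0) (hw : w ≠ 0) :
    ‖z / conj z - w / conj w‖ ≤ 2 * ‖z - w‖ / ‖z‖ := by
  have hz' : conj z ≠ 0 := (map_ne_zero _).2 hz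
  have hw' : conj w ≠ 0 := (map_ne_zero _).2 hw
  have h : z / conj z - w / conj w = ((z - w) - w / conj w * conj (z - w)) / conj z := by
    rw [map_sub]
    field_simp
    ring
  rw [h, norm_div, Complex.norm_conj]
  gcongr
  refine (norm_sub_le _ _).trans_eq ?_
  rw [norm_mul, norm_div, Complex.norm_conj, Complex.norm_conj, div_self (norm_ne_zero_iff.2 hw)]
  ring

lemma norm_one_add_exp_sub_le (θ φ : ℝ) :
    ‖(1 + Complex.exp ((θ : ℂ) * Complex.I)) - (1 + Complex.exp ((φ : ℂ) * Complex.I))‖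
      ≤ |θ - φ| := by
  have h : (1 + Complex.exp ((θ : ℂ) * Complex.I)) - (1 + Complex.exp ((φ : ℂ) * Complex.I)) =
      Complex.exp ((φ : ℂ) * Complex.I) * (Complex.exp (Complex.I * ((θ - φ : ℝ) : ℂ)) - 1) := by
    rw [mul_sub, ← Complex.exp_add]
    push_cast
    ring_nf
  rw [h, norm_mul, Complex.norm_exp_ofReal_mul_I, one_mul]
  exact Real.norm_exp_I_mul_ofReal_sub_one_le

/-- Lipschitz estimate for the logarithm on the right half-plane, near a base point. -/
lemma norm_log_sub_log_le {z w : ℂ} (hz : 0 < z.re) (hw : 0 < w.re) (h : ‖w - z‖ ≤ ‖z‖ / 2) :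
    ‖Complex.log w - Complex.log z‖ ≤ 2 / ‖z‖ * ‖w - z‖ := by
  have hz0 : 0 < ‖z‖ := hz.trans_le (Complex.re_le_norm z)
  refine Convex.norm_image_sub_le_of_norm_hasDerivWithin_le (f' := fun x => x⁻¹)
    (s := Metric.closedBall z (‖z‖ / 2) ∩ {x : ℂ | 0 < x.re}) (fun x hx => ?_) (fun x hx => ?_)
    ((convex_closedBall _ _).inter (convex_halfSpace_re_gt 0)) ⟨?_, hz⟩ ⟨?_, hw⟩
  · exact (Complex.hasDerivAt_log (Or.inl hx.2)).hasDerivWithinAt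
  · have h1 : ‖x - z‖ ≤ ‖z‖ / 2 := mem_closedBall_iff_norm.1 hx.1
    have h2 : ‖z‖ / 2 ≤ ‖x‖ := by
      have := norm_sub_norm_le z x
      rw [norm_sub_rev] at this
      linarith
    rw [norm_inv, ← inv_div]
    exact inv_anti₀ (by positivity) h2
  · exact Metric.mem_closedBall_self (by positivity)
  · exact mem_closedBall_iff_norm.2 h

lemma log_two_pi_le : Real.log (2 * π) ≤ 2 := by
  rw [Real.log_le_iff_le_exp (by positivity)]
  have h := Real.exp_one_gt_d9
  have h2 : Real.exp 2 = Real.exp 1 * Real.exp 1 := by rw [← Real.exp_add]; norm_num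
  rw [h2]
  nlinarith [Real.pi_lt_d2]

lemma log_two_pi_div_pos {δ : ℝ} (hδ : 0 < δ) (hδπ : δ ≤ π) : 0 < Real.log (2 * π / δ) := by
  apply Real.log_pos
  rw [lt_div_iff₀ hδ]
  linarith

lemma norm_symbol_sub_one_le {θ δ : ℝ} (hδ : 0 < δ) (hδπ : δ ≤ π)
    (h : ‖1 + Complex.exp ((θ : ℂ) * Complex.I)‖ ≤ 2 * δ) :
    ‖symbolNum θ / conj (symbolNum θ) - 1‖ ≤ 32 / Real.log (2 * π / δ) := by
  have hL := log_two_pi_div_pos hδ hδπ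
  by_cases h0 : 1 + Complex.exp ((θ : ℂ) * Complex.I) = 0
  · have : symbolNum θ = 1 := by rw [symbolNum, h0, Complex.log_zero, sub_zero]
    rw [this, map_one, div_one, sub_self, norm_zero]
    positivity
  · have hre := symbolNum_re_pos θ
    refine (norm_div_conj_sub_one_le hre).trans ?_
    rw [div_le_div_iff₀ hre hL]
    have hlog := Real.log_le_log (norm_pos_iff.2 h0) h
    rw [Real.log_mul two_ne_zero hδ.ne'] at hlog
    have hdiv : Real.log (2 * π / δ) = Real.log (2 * π) - Real.log δ :=
      Real.log_div (by positivity) hδ.ne'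
    have h10 : Real.log (2 * π / δ) ≤ 10 * (symbolNum θ).re := by
      rw [symbolNum_re]
      linarith [log_norm_one_add_exp_mul_I_le θ, log_two_pi_le, Real.log_two_lt_d9]
    have him := abs_symbolNum_im_le θ
    have hπ := Real.pi_lt_d2
    calc 2 * |(symbolNum θ).im| * Real.log (2 * π / δ)
        ≤ 3.2 * (10 * (symbolNum θ).re) := by gcongr; linarith
      _ = 32 * (symbolNum θ).re := by ring

lemma norm_symbol_sub_symbol_le_of_far {θ φ δ : ℝ} (hδ : 0 < δ) (hδπ : δ ≤ π)
    (hθφ : |θ - φ| ≤ δ) (h : 2 * δ < ‖1 + Complex.exp ((θ : ℂ) * Complex.I)‖) :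
    ‖symbolNum θ / conj (symbolNum θ) - symbolNum φ / conj (symbolNum φ)‖ ≤
      64 / Real.log (2 * π / δ) := by
  have hL := log_two_pi_div_pos hδ hδπ
  have hlip := (norm_one_add_exp_sub_le θ φ).trans hθφ
  have hre := symbolNum_re_pos θ
  have hreq := symbolNum_re θ
  have hlogm := log_norm_one_add_exp_mul_I_le θ
  have hdiff : symbolNum θ - symbolNum φ =
      Complex.log (1 + Complex.exp ((φ : ℂ) * Complex.I)) -
        Complex.log (1 + Complex.exp ((θ : ℂ) * Complex.I)) := by
    rw [symbolNum, symbolNum]; ring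
  have hθ0 : 1 + Complex.exp ((θ : ℂ) * Complex.I) ≠ 0 := norm_pos_iff.1 (by linarith)
  have hφ0 : 1 + Complex.exp ((φ : ℂ) * Complex.I) ≠ 0 := fun h0 => by
    rw [h0, sub_zero] at hlip
    linarith
  have hθ := one_add_exp_mul_I_re_pos hθ0
  have hφ := one_add_exp_mul_I_re_pos hφ0
  set m := ‖1 + Complex.exp ((θ : ℂ) * Complex.I)‖ with hm
  have hm0 : 0 < m := by linarith
  rw [norm_sub_rev] at hlip
  have hw : ‖symbolNum θ - symbolNum φ‖ ≤ 2 / m * δ := by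
    rw [hdiff]
    refine (norm_log_sub_log_le hθ hφ (by rw [← hm]; linarith)).trans ?_
    rw [← hm]
    gcongr
  have hlog : Real.log (2 * π / δ) = Real.log (2 * π) + Real.log (m / δ) - Real.log m := by
    rw [Real.log_div (by positivity) hδ.ne', Real.log_div hm0.ne' hδ.ne']; ring
  have hq : δ / m ≤ 1 / 2 := by rw [div_le_div_iff₀ hm0 two_pos]; linarith
  have hq0 : 0 < δ / m := by positivity
  have h1 : δ / m * Real.log (m / δ) ≤ 1 := by
    calc δ / m * Real.log (m / δ) ≤ δ / m * (m / δ) := by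
          gcongr
          exact Real.log_le_self (by positivity)
      _ = 1 := by field_simp
  have h16 : δ / m * Real.log (2 * π / δ) ≤ 16 * (symbolNum θ).re := by
    rw [hlog, hreq]
    have h2 : δ / m * (2 - Real.log m) ≤ 1 / 2 * (2 - Real.log m) := by
      gcongr
      linarith
    have h3 : δ / m * Real.log (2 * π) ≤ δ / m * 2 := by
      gcongr
      exact log_two_pi_le
    nlinarith
  calc _ ≤ 2 * ‖symbolNum θ - symbolNum φ‖ / ‖symbolNum θ‖ :=
        norm_div_conj_sub_div_conj_le (symbolNum_ne_zero θ) (symbolNum_ne_zero φ)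
    _ ≤ 2 * (2 / m * δ) / (symbolNum θ).re := by
        gcongr
        exact Complex.re_le_norm _
    _ ≤ 64 / Real.log (2 * π / δ) := by
        rw [div_le_div_iff₀ hre hL]
        calc 2 * (2 / m * δ) * Real.log (2 * π / δ)
            = 4 * (δ / m * Real.log (2 * π / δ)) := by ring
          _ ≤ 64 * (symbolNum θ).re := by linarith

/-- The symbol has a logarithmic modulus of continuity. -/
lemma norm_symbol_sub_symbol_le {θ φ δ : ℝ} (hδ : 0 < δ) (hδπ : δ ≤ π) (hθφ : |θ - φ| ≤ δ) :
    ‖symbolNum θ / conj (symbolNum θ) - symbolNum φ / conj (symbolNum φ)‖ ≤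
      64 / Real.log (2 * π / δ) := by
  rcases lt_or_ge (2 * δ) ‖1 + Complex.exp ((θ : ℂ) * Complex.I)‖ with h | h
  · exact norm_symbol_sub_symbol_le_of_far hδ hδπ hθφ h
  rcases lt_or_ge (2 * δ) ‖1 + Complex.exp ((φ : ℂ) * Complex.I)‖ with h' | h'
  · rw [norm_sub_rev]
    exact norm_symbol_sub_symbol_le_of_far hδ hδπ (by rwa [abs_sub_comm]) h'
  · rw [← sub_sub_sub_cancel_right _ _ 1]
    refine (norm_sub_le _ _).trans ((add_le_add (norm_symbol_sub_one_le hδ hδπ h)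
      (norm_symbol_sub_one_le hδ hδπ h')).trans_eq ?_)
    ring

lemma intervalIntegrable_symbol (s t : ℝ) :
    IntervalIntegrable (fun θ => symbolNum θ / conj (symbolNum θ)) volume s t := by
  have hmeas : Measurable symbolNum := by
    unfold symbolNum
    fun_prop
  have hmeas' : Measurable fun θ => symbolNum θ / conj (symbolNum θ) :=
    hmeas.div (Complex.continuous_conj.measurable.comp hmeas)
  refine (intervalIntegrable_const (c := (1 : ℝ))).mono_fun hmeas'.aestronglyMeasurable
    (Filter.Eventually.of_forall fun θ => ?_)
  simp only [norm_div, Complex.norm_conj, norm_one]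
  exact div_self_le_one _

/-- The mean oscillation over an interval is at most the oscillation. -/
lemma meanOscillation_le_of_norm_sub_le {f : ℝ → ℂ} {s t M : ℝ} (hst : s < t)
    (hf : IntervalIntegrable f volume s t)
    (hM : ∀ x ∈ Set.Icc s t, ∀ y ∈ Set.Icc s t, ‖f x - f y‖ ≤ M) :
    (1 / (t - s)) * ∫ x in s..t, ‖f x - ((t - s : ℂ))⁻¹ * ∫ y in s..t, f y‖ ≤ M := by
  have hpos : 0 < t - s := sub_pos.2 hst
  have hne : ((t : ℂ) - s) ≠ 0 := by exact_mod_cast hpos.ne'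
  have hsub : Set.uIoc s t ⊆ Set.Icc s t := by
    rw [Set.uIoc_of_le hst.le]
    exact Set.Ioc_subset_Icc_self
  have hpt : ∀ x ∈ Set.uIoc s t, ‖f x - ((t - s : ℂ))⁻¹ * ∫ y in s..t, f y‖ ≤ M := by
    intro x hx
    have heq : f x - ((t - s : ℂ))⁻¹ * ∫ y in s..t, f y =
        ((t - s : ℂ))⁻¹ * ∫ y in s..t, (f x - f y) := by
      rw [intervalIntegral.integral_sub intervalIntegrable_const hf,
        intervalIntegral.integral_const, Complex.real_smul]
      push_cast
      field_simp
    have hint := intervalIntegral.norm_integral_le_of_norm_le_const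
      (f := fun y => f x - f y) (fun y hy => hM x (hsub hx) y (hsub hy))
    have hnorm : ‖((t : ℂ) - s)‖ = t - s := by
      rw [← Complex.ofReal_sub, Complex.norm_real, Real.norm_of_nonneg hpos.le]
    rw [abs_of_pos hpos] at hint
    rw [heq, norm_mul, norm_inv, hnorm, inv_mul_le_iff₀ hpos, mul_comm]
    exact hint
  have hint := intervalIntegral.norm_integral_le_of_norm_le_const
    (f := fun x => ‖f x - ((t - s : ℂ))⁻¹ * ∫ y in s..t, f y‖)
    (fun x hx => by rw [norm_norm]; exact hpt x hx)
  rw [abs_of_pos hpos] at hint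
  rw [one_div, inv_mul_le_iff₀ hpos, mul_comm (t - s) M]
  exact (Real.le_norm_self _).trans hint

/-- The symbol `a(θ) = (1 - Log(1+e^{iθ}))/(1 - Log(1+e^{-iθ}))` belongs to
`BMO_log`: there is `C > 0` such that for every interval `I = [s,t]` with `0 < t - s ≤ π`,
`MO_I(a) ≤ C / log(2π/(t-s))`. -/
theorem symbol_mem_BMO_log :
    ∃ C : ℝ, 0 < C ∧ ∀ s t : ℝ, s < t → t - s ≤ π →
      (1 / (t - s)) * ∫ θ in s..t,
          ‖(1 - Complex.log (1 + Complex.exp ((θ : ℂ) * Complex.I))) /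
              (1 - Complex.log (1 + Complex.exp (-(θ : ℂ) * Complex.I))) -
            (((t - s) : ℂ))⁻¹ * ∫ φ in s..t,
              (1 - Complex.log (1 + Complex.exp ((φ : ℂ) * Complex.I))) /
                (1 - Complex.log (1 + Complex.exp (-(φ : ℂ) * Complex.I)))‖ ≤
        C / Real.log (2 * π / (t - s)) := by
  refine ⟨64, by norm_num, fun s t hst htπ => ?_⟩
  simp_rw [← conj_symbolNum]
  refine meanOscillation_le_of_norm_sub_le hst (intervalIntegrable_symbol s t)
    fun x hx y hy => norm_symbol_sub_symbol_le (sub_pos.2 hst) htπ ?_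
  exact abs_sub_le_iff.2 ⟨by linarith [hx.2, hy.1], by linarith [hx.1, hy.2]⟩
end

section
/- There exist a constant C > 0 and δ ∈ (0,1) such that for all real θ with 0 < |θ| < δ, the estimate ‖∫_{-1}^0 (1 - log(1+t))^{-1} / (t + e^{iθ})² dt + 1/((1 - e^{iθ})(1 - log|θ|))‖ ≤ C / (|θ| · (log|θ|)²) holds. -/
open MeasureTheory intervalIntegral

lemma abs_log_add_sq_log_le {r : ℝ} (hr : 0 < r) :
    |2 * Real.log r| + (2 * Real.log r) ^ 2 ≤ 8 * (r + r⁻¹) := by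
  have hexp : Real.exp |Real.log r| ≤ r + r⁻¹ := by
    have hinv : 0 < r⁻¹ := inv_pos.mpr hr
    rcases abs_cases (Real.log r) with ⟨h, -⟩ | ⟨h, -⟩
    · rw [h, Real.exp_log hr]; linarith
    · rw [h, Real.exp_neg, Real.exp_log hr]; linarith
  have hquad := Real.quadratic_le_exp_of_nonneg (abs_nonneg (Real.log r))
  rw [abs_mul, abs_two, mul_pow, ← sq_abs (Real.log r)]
  nlinarith [abs_nonneg (Real.log r)]

lemma abs_inv_one_sub_log_sub_le {s a : ℝ} (hs : 0 < s) (hs1 : s ≤ 1) (ha : 0 < a)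
    (ha1 : a ≤ 1) :
    |(1 - Real.log s)⁻¹ - (1 - Real.log a)⁻¹| ≤
      8 * (√(s / a) + (√(s / a))⁻¹) / (1 - Real.log a) ^ 2 := by
  have hls : Real.log s ≤ 0 := Real.log_nonpos hs.le hs1
  have hla : Real.log a ≤ 0 := Real.log_nonpos ha.le ha1
  have hx : 0 < s / a := div_pos hs ha
  have hbound := abs_log_add_sq_log_le (Real.sqrt_pos.mpr hx)
  have hlog : 2 * Real.log √(s / a) = Real.log s - Real.log a := by
    rw [Real.log_sqrt hx.le, Real.log_div hs.ne' ha.ne']; ring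
  rw [hlog] at hbound
  have hS : 0 < 1 - Real.log s := by linarith
  have hA : 0 < 1 - Real.log a := by linarith
  set u := Real.log s - Real.log a with hu
  have hdiff : (1 - Real.log s)⁻¹ - (1 - Real.log a)⁻¹ =
      u / ((1 - Real.log s) * (1 - Real.log a)) := by
    rw [hu]; field_simp; ring
  rw [hdiff, abs_div, abs_of_pos (mul_pos hS hA)]
  refine le_trans ?_ (div_le_div_of_nonneg_right hbound (sq_nonneg _))
  rw [div_le_div_iff₀ (mul_pos hS hA) (by positivity)]
  have hA' : 1 - Real.log a ≤ (1 + |u|) * (1 - Real.log s) := by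
    nlinarith [abs_nonneg u, le_abs_self u]
  calc |u| * (1 - Real.log a) ^ 2
      = |u| * (1 - Real.log a) * (1 - Real.log a) := by ring
    _ ≤ |u| * (1 - Real.log a) * ((1 + |u|) * (1 - Real.log s)) := by gcongr
    _ = (|u| + |u| ^ 2) * ((1 - Real.log s) * (1 - Real.log a)) := by ring
    _ = (|u| + u ^ 2) * ((1 - Real.log s) * (1 - Real.log a)) := by rw [sq_abs]

lemma sq_add_abs_le_norm_add_exp_sub_one_sq {s θ : ℝ} (hθ : |θ| ≤ 1) :
    (s + |θ|) ^ 2 / 16 ≤ ‖(s : ℂ) + (Complex.exp (θ * Complex.I) - 1)‖ ^ 2 := by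
  have hnorm : ‖(s : ℂ) + (Complex.exp (θ * Complex.I) - 1)‖ ^ 2 =
      s ^ 2 + (1 - s) * (2 * (1 - Real.cos θ)) := by
    rw [← Complex.normSq_eq_norm_sq, Complex.normSq_apply]
    simp only [Complex.add_re, Complex.add_im, Complex.sub_re, Complex.sub_im,
      Complex.exp_ofReal_mul_I_re, Complex.exp_ofReal_mul_I_im, Complex.ofReal_re,
      Complex.ofReal_im, Complex.one_re, Complex.one_im]
    nlinarith [Real.sin_sq_add_cos_sq θ]
  rw [hnorm]
  have hsq : θ ^ 2 ≤ 1 := (sq_le_one_iff_abs_le_one θ).mpr hθ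
  have hlow : θ ^ 2 / 4 ≤ 2 * (1 - Real.cos θ) := by
    have hcos := Real.cos_le_one_sub_mul_cos_sq (x := θ) (by linarith [Real.pi_gt_three])
    have hpi : 1 / 8 ≤ 2 / Real.pi ^ 2 := by
      rw [div_le_div_iff₀ (by norm_num) (by positivity)]
      nlinarith [Real.pi_pos, Real.pi_le_four]
    nlinarith [mul_le_mul_of_nonneg_right hpi (sq_nonneg θ)]
  have hup : 2 * (1 - Real.cos θ) ≤ 1 := by
    have := Real.one_sub_sq_div_two_le_cos (x := θ)
    linarith
  generalize 2 * (1 - Real.cos θ) = q at *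
  have habs := sq_abs θ
  have hq : 0 ≤ q := by nlinarith
  have hcross : 2 * (s * q) ≤ s ^ 2 + q := by
    nlinarith [sq_nonneg (s - q), mul_nonneg hq (sub_nonneg.mpr hup)]
  nlinarith [sq_nonneg (s - |θ|)]

lemma hasDerivAt_arctan_sqrt_div {s a : ℝ} (hs : 0 < s) (ha : 0 < a) :
    HasDerivAt (fun s => Real.arctan √(s / a)) (1 / (2 * √(s / a) * (s + a))) s := by
  have hx : 0 < s / a := div_pos hs ha
  convert (((hasDerivAt_id' s).div_const a).sqrt hx.ne').arctan using 1
  rw [Real.sq_sqrt hx.le]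
  have := Real.sqrt_pos.mpr hx
  field_simp
  ring

lemma intervalIntegrable_inv_sqrt_div_mul_add {a : ℝ} (ha : 0 < a) :
    IntervalIntegrable (fun s => 1 / (2 * √(s / a) * (s + a))) volume 0 1 := by
  refine intervalIntegrable_deriv_of_nonneg (g := fun s => Real.arctan √(s / a))
    (by fun_prop) (fun s hs => ?_) (fun s hs => ?_)
  all_goals
    have hs0 : 0 < s := by simpa using hs.1
  · exact hasDerivAt_arctan_sqrt_div hs0 ha
  · positivity

lemma integral_inv_sqrt_div_mul_add_le {a : ℝ} (ha : 0 < a) :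
    ∫ s in (0 : ℝ)..1, 1 / (2 * √(s / a) * (s + a)) ≤ 2 := by
  rw [integral_eq_sub_of_hasDerivAt_of_le (f := fun s => Real.arctan √(s / a)) zero_le_one
    (by fun_prop) (fun s hs => hasDerivAt_arctan_sqrt_div hs.1 ha)
    (intervalIntegrable_inv_sqrt_div_mul_add ha)]
  have := Real.arctan_lt_pi_div_two √(1 / a)
  simp only [zero_div, Real.sqrt_zero, Real.arctan_zero, sub_zero]
  linarith [Real.pi_le_four]

lemma integral_one_div_add_sq {c : ℂ} (hc : ∀ s : ℝ, 0 ≤ s → (s : ℂ) + c ≠ 0) :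
    IntervalIntegrable (fun s : ℝ => 1 / ((s : ℂ) + c) ^ 2) volume 0 1 ∧
      ∫ s in (0 : ℝ)..1, 1 / ((s : ℂ) + c) ^ 2 = 1 / c - 1 / (1 + c) := by
  have hne : ∀ s ∈ Set.uIcc (0 : ℝ) 1, (s : ℂ) + c ≠ 0 := fun s hs => by
    rw [Set.uIcc_of_le zero_le_one] at hs
    exact hc s hs.1
  have hint : IntervalIntegrable (fun s : ℝ => 1 / ((s : ℂ) + c) ^ 2) volume 0 1 :=
    ContinuousOn.intervalIntegrable <| continuousOn_const.div (by fun_prop)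
      fun s hs => pow_ne_zero 2 (hne s hs)
  refine ⟨hint, ?_⟩
  rw [integral_eq_sub_of_hasDerivAt (f := fun s : ℝ => -((s : ℂ) + c)⁻¹) (fun s hs => ?_) hint]
  · simp; ring
  · convert (((hasDerivAt_id' s).ofReal_comp.add_const c).fun_inv (hne s hs)).fun_neg using 1
    simp [neg_div]

lemma norm_inv_one_sub_log_sub_div_le {s θ : ℝ} (hs : 0 < s) (hs1 : s ≤ 1) (hθ : 0 < |θ|)
    (hθ1 : |θ| ≤ 1) :
    ‖((1 - (Real.log s : ℂ))⁻¹ - (1 - (Real.log |θ| : ℂ))⁻¹) /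
        ((s : ℂ) + (Complex.exp (θ * Complex.I) - 1)) ^ 2‖ ≤
      256 / (|θ| * (1 - Real.log |θ|) ^ 2) * (1 / (2 * √(s / |θ|) * (s + |θ|))) := by
  have hnum : ‖(1 - (Real.log s : ℂ))⁻¹ - (1 - (Real.log |θ| : ℂ))⁻¹‖ =
      |(1 - Real.log s)⁻¹ - (1 - Real.log |θ|)⁻¹| := by
    rw [← Real.norm_eq_abs ((1 - Real.log s)⁻¹ - _), ← Complex.norm_real]
    push_cast
    rfl
  rw [norm_div, norm_pow, hnum]
  have hA : 0 < 1 - Real.log |θ| := by linarith [Real.log_nonpos hθ.le hθ1]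
  refine (div_le_div₀ (by positivity) (abs_inv_one_sub_log_sub_le hs hs1 hθ hθ1) (by positivity)
    (sq_add_abs_le_norm_add_exp_sub_one_sq hθ1)).trans_eq ?_
  have hr : 0 < √(s / |θ|) := Real.sqrt_pos.mpr (div_pos hs hθ)
  have hr2 : √(s / |θ|) ^ 2 = s / |θ| := Real.sq_sqrt (div_pos hs hθ).le
  have hsum : √(s / |θ|) + (√(s / |θ|))⁻¹ = (s + |θ|) / (|θ| * √(s / |θ|)) := by
    rw [eq_div_iff (by positivity), add_mul, ← mul_assoc]
    field_simp
    rw [hr2]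
    field_simp
  rw [hsum]
  field_simp
  norm_num

lemma norm_integral_inv_one_sub_log_div_sub_le {θ : ℝ} (hθ : 0 < |θ|) (hθ1 : |θ| < 1) :
    ‖(∫ s in (0 : ℝ)..1, (1 - (Real.log s : ℂ))⁻¹ /
          ((s : ℂ) + (Complex.exp (θ * Complex.I) - 1)) ^ 2) -
        (1 - (Real.log |θ| : ℂ))⁻¹ * (1 / (Complex.exp (θ * Complex.I) - 1) -
          1 / Complex.exp (θ * Complex.I))‖ ≤
      512 / (|θ| * (1 - Real.log |θ|) ^ 2) := by
  set c := Complex.exp (θ * Complex.I) - 1 with hc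
  set K := 256 / (|θ| * (1 - Real.log |θ|) ^ 2) with hK
  set F : ℝ → ℂ := fun s => ((1 - (Real.log s : ℂ))⁻¹ - (1 - (Real.log |θ| : ℂ))⁻¹) /
    ((s : ℂ) + c) ^ 2 with hF
  have hne : ∀ s : ℝ, 0 ≤ s → (s : ℂ) + c ≠ 0 := fun s hs h => by
    have := sq_add_abs_le_norm_add_exp_sub_one_sq (s := s) hθ1.le
    rw [← hc, h, norm_zero] at this
    nlinarith [sq_pos_of_pos hθ]
  obtain ⟨hint, hval⟩ := integral_one_div_add_sq hne
  have hmaj := (intervalIntegrable_inv_sqrt_div_mul_add hθ).const_mul K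
  have hle : ∀ s ∈ Set.Ioc (0 : ℝ) 1, ‖F s‖ ≤ K * (1 / (2 * √(s / |θ|) * (s + |θ|))) :=
    fun s hs => norm_inv_one_sub_log_sub_div_le hs.1 hs.2 hθ hθ1.le
  have hFint : IntervalIntegrable F volume 0 1 := by
    rw [intervalIntegrable_iff_integrableOn_Ioc_of_le zero_le_one] at hmaj ⊢
    refine Integrable.mono' hmaj (Measurable.aestronglyMeasurable (by fun_prop)) ?_
    exact (ae_restrict_iff' measurableSet_Ioc).mpr (.of_forall hle)
  have hsplit : (∫ s in (0 : ℝ)..1, (1 - (Real.log s : ℂ))⁻¹ / ((s : ℂ) + c) ^ 2) =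
      (∫ s in (0 : ℝ)..1, F s) + (1 - (Real.log |θ| : ℂ))⁻¹ * (1 / c - 1 / (1 + c)) := by
    rw [← hval, ← intervalIntegral.integral_const_mul, ← integral_add hFint (hint.const_mul _)]
    congr 1 with s
    rw [hF]; ring
  have hexp : Complex.exp (θ * Complex.I) = 1 + c := by rw [hc]; ring
  rw [hexp, hsplit, add_sub_cancel_right]
  refine (norm_integral_le_of_norm_le zero_le_one (.of_forall hle) hmaj).trans ?_
  rw [intervalIntegral.integral_const_mul]
  calc K * _ ≤ K * 2 := by
        gcongr
        exact integral_inv_sqrt_div_mul_add_le hθ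
    _ = _ := by rw [hK]; ring

/-- There are `C > 0` and `δ ∈ (0,1)` such that for `0 < |θ| < δ`,
`‖∫_{-1}^0 (1-log(1+t))⁻¹/(t+e^{iθ})² dt + 1/((1-e^{iθ})(1-log|θ|))‖
  ≤ C/(|θ|·(log|θ|)²)`. -/
theorem deriv_Q_tilde_a_estimate :
    ∃ C : ℝ, 0 < C ∧ ∃ δ : ℝ, δ ∈ Set.Ioo (0:ℝ) 1 ∧
      ∀ θ : ℝ, 0 < |θ| → |θ| < δ →
        ‖(∫ t in (-1:ℝ)..0,
              (1 - (Real.log (1 + t) : ℂ))⁻¹ /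
                ((t : ℂ) + Complex.exp ((θ : ℂ) * Complex.I)) ^ 2) +
            1 / ((1 - Complex.exp ((θ : ℂ) * Complex.I)) *
              (1 - (Real.log |θ| : ℂ)))‖ ≤
          C / (|θ| * (Real.log |θ|) ^ 2) := by
  refine ⟨513, by norm_num, 1 / 2, by norm_num, fun θ hθ hθδ => ?_⟩
  have hθ1 : |θ| < 1 := by linarith
  have hlog : Real.log |θ| < 0 := Real.log_neg hθ hθ1
  have hshift : (∫ t in (-1:ℝ)..0, (1 - (Real.log (1 + t) : ℂ))⁻¹ /
        ((t : ℂ) + Complex.exp ((θ : ℂ) * Complex.I)) ^ 2) =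
      ∫ s in (0 : ℝ)..1, (1 - (Real.log s : ℂ))⁻¹ /
        ((s : ℂ) + (Complex.exp (θ * Complex.I) - 1)) ^ 2 := by
    have := intervalIntegral.integral_comp_add_left (a := -1) (b := 0)
      (fun s : ℝ => (1 - (Real.log s : ℂ))⁻¹ /
        ((s : ℂ) + (Complex.exp (θ * Complex.I) - 1)) ^ 2) 1
    norm_num only at this
    rw [← this]
    congr 1 with t
    push_cast
    ring_nf
  have hmain := norm_integral_inv_one_sub_log_div_sub_le hθ hθ1
  have hrest : ‖(1 - (Real.log |θ| : ℂ))⁻¹ * (1 / Complex.exp (θ * Complex.I))‖ =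
      (1 - Real.log |θ|)⁻¹ := by
    rw [norm_mul, norm_div, Complex.norm_exp_ofReal_mul_I, norm_one, div_one, mul_one, norm_inv,
      ← Complex.ofReal_one, ← Complex.ofReal_sub, Complex.norm_real,
      Real.norm_of_nonneg (by linarith)]
  have hrest_le : (1 - Real.log |θ|)⁻¹ ≤ 1 / (|θ| * Real.log |θ| ^ 2) := by
    rw [← one_div]
    apply one_div_le_one_div_of_le (mul_pos hθ (sq_pos_of_neg hlog))
    have := Real.abs_log_mul_self_lt |θ| hθ hθ1.le
    rw [abs_lt] at this
    nlinarith
  have hmain_le : 512 / (|θ| * (1 - Real.log |θ|) ^ 2) ≤ 512 / (|θ| * Real.log |θ| ^ 2) := by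
    have := sq_pos_of_neg hlog
    gcongr 512 / (|θ| * ?_)
    nlinarith
  have hneg : 1 / ((1 - Complex.exp (θ * Complex.I)) * (1 - (Real.log |θ| : ℂ))) =
      -((1 - (Real.log |θ| : ℂ))⁻¹ * (1 / (Complex.exp (θ * Complex.I) - 1))) := by
    rw [← neg_sub (Complex.exp (θ * Complex.I)) 1, one_div, mul_inv, inv_neg]
    ring
  rw [hshift, hneg]
  calc _ = ‖((∫ s in (0 : ℝ)..1, (1 - (Real.log s : ℂ))⁻¹ /
            ((s : ℂ) + (Complex.exp (θ * Complex.I) - 1)) ^ 2) -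
          (1 - (Real.log |θ| : ℂ))⁻¹ * (1 / (Complex.exp (θ * Complex.I) - 1) -
            1 / Complex.exp (θ * Complex.I))) -
        (1 - (Real.log |θ| : ℂ))⁻¹ * (1 / Complex.exp (θ * Complex.I))‖ := by
        congr 1; ring
    _ ≤ 512 / (|θ| * Real.log |θ| ^ 2) + 1 / (|θ| * Real.log |θ| ^ 2) :=
        (norm_sub_le _ _).trans (add_le_add (hmain.trans hmain_le) (hrest.trans_le hrest_le))
    _ = 513 / (|θ| * Real.log |θ| ^ 2) := by ring
end

section
/- Let F(θ) = ∫_{-1}^0 1 / ((t + e^{iθ})(1 - log(1 + t))) dt for θ ∈ ℝ (the boundary value Qã(-e^{iθ})). Then F belongs to BMO_log: there exists a constant C > 0 such that for every interval I = [s,t] ⊂ ℝ with 0 < t - s ≤ π, MO_I(F) ≤ C / log(2π/(t - s)). -/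
open MeasureTheory intervalIntegral Real

/-- The antiderivative `2 (√(x - a) - √(a - x))` of `1 / √|x - a|`. -/
lemma hasDerivAt_signed_sqrt {a x : ℝ} (hx : x ≠ a) :
    HasDerivAt (fun y => 2 * (√(y - a) - √(a - y))) (1 / √|x - a|) x := by
  rcases lt_or_gt_of_ne hx with h | h
  · have h1 : HasDerivAt (fun y : ℝ => -(2 * √(a - y))) (1 / √|x - a|) x := by
      have h2 : HasDerivAt (fun y : ℝ => a - y) (-1) x := by
        simpa using (hasDerivAt_id x).const_sub a
      have h3 := ((h2.sqrt (by linarith)).const_mul 2).neg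
      refine h3.congr_deriv ?_
      rw [abs_of_neg (by linarith), neg_sub]
      have : √(a - x) ≠ 0 := (Real.sqrt_pos.2 (by linarith)).ne'
      field_simp
    refine h1.congr_of_eventuallyEq ?_
    filter_upwards [Iio_mem_nhds h] with y hy
    have hy' : y < a := hy
    rw [Real.sqrt_eq_zero_of_nonpos (x := y - a) (by linarith)]
    ring
  · have h1 : HasDerivAt (fun y : ℝ => 2 * √(y - a)) (1 / √|x - a|) x := by
      have h2 : HasDerivAt (fun y : ℝ => y - a) 1 x := (hasDerivAt_id x).sub_const a
      have h3 := (h2.sqrt (by linarith)).const_mul 2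
      refine h3.congr_deriv ?_
      rw [abs_of_pos (by linarith)]
      have : √(x - a) ≠ 0 := (Real.sqrt_pos.2 (by linarith)).ne'
      field_simp
    refine h1.congr_of_eventuallyEq ?_
    filter_upwards [Ioi_mem_nhds h] with y hy
    have hy' : a < y := hy
    rw [Real.sqrt_eq_zero_of_nonpos (x := a - y) (by linarith)]
    ring

lemma intervalIntegrable_one_div_sqrt_abs (a s t : ℝ) :
    IntervalIntegrable (fun x => 1 / √|x - a|) volume s t := by
  have key : ∀ b, IntervalIntegrable (fun x => 1 / √|x - a|) volume a b := by
    intro b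
    apply intervalIntegral.intervalIntegrable_deriv_of_nonneg
      (g := fun y => 2 * (√(y - a) - √(a - y))) (by fun_prop)
    · intro x hx
      refine hasDerivAt_signed_sqrt ?_
      rintro rfl
      rcases le_total x b with h | h <;> simp [h] at hx
    · intro x _
      positivity
  exact (key s).symm.trans (key t)

lemma sqrt_sub_sqrt_le_sqrt {x y d : ℝ} (hd : 0 ≤ d) (h : y ≤ x + d) : √y - √x ≤ √d := by
  have h1 : √y ≤ √x + √d := by
    refine Real.sqrt_le_iff.2 ⟨by positivity, ?_⟩
    have := Real.sq_sqrt hd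
    have h3 : x ≤ √x ^ 2 := by
      rcases le_total 0 x with h | h
      · rw [Real.sq_sqrt h]
      · nlinarith [sq_nonneg √x]
    nlinarith [mul_nonneg (Real.sqrt_nonneg x) (Real.sqrt_nonneg d)]
  linarith

lemma integral_one_div_sqrt_abs_le (a : ℝ) {s t : ℝ} (hst : s ≤ t) :
    ∫ x in s..t, 1 / √|x - a| ≤ 4 * √(t - s) := by
  rw [integral_eq_of_hasDerivAt_off_countable_of_le (fun y => 2 * (√(y - a) - √(a - y))) _ hst
    (Set.countable_singleton a) (by fun_prop) (fun x hx => hasDerivAt_signed_sqrt hx.2)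
    (intervalIntegrable_one_div_sqrt_abs a s t)]
  have h1 := sqrt_sub_sqrt_le_sqrt (x := s - a) (y := t - a) (d := t - s) (by linarith) (by linarith)
  have h2 := sqrt_sub_sqrt_le_sqrt (x := a - t) (y := a - s) (d := t - s) (by linarith) (by linarith)
  linarith

lemma one_div_sqrt_le_of_mul_le {x y : ℝ} (hx : 0 < x) (h : 2 / π * x ≤ y) :
    1 / √y ≤ 2 * (1 / √x) := by
  have h4 : x / 4 ≤ y := by
    refine le_trans ?_ h
    have : 1 / 4 ≤ 2 / π := by
      rw [div_le_div_iff₀ (by norm_num) pi_pos]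
      linarith [pi_le_four]
    nlinarith
  have hs : √x / 2 ≤ √y := by
    refine Real.le_sqrt_of_sq_le ?_
    rw [div_pow, Real.sq_sqrt hx.le]
    linarith
  have hx' := Real.sqrt_pos.2 hx
  calc 1 / √y ≤ 1 / (√x / 2) := one_div_le_one_div_of_le (by positivity) hs
    _ = 2 * (1 / √x) := by field_simp

lemma one_div_sqrt_abs_sin_le {x : ℝ} (h1 : -(π / 2) ≤ x) (h2 : x ≤ 3 * π / 2) :
    1 / √|sin x| ≤ 2 * (1 / √|x|) + 2 * (1 / √|x - π|) := by
  rcases le_total x (π / 2) with h | h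
  · have h0 : (0:ℝ) ≤ 2 * (1 / √|x - π|) := by positivity
    rcases eq_or_ne x 0 with rfl | hx
    · simp
    · have := one_div_sqrt_le_of_mul_le (abs_pos.2 hx) (mul_abs_le_abs_sin (abs_le.2 ⟨h1, h⟩))
      linarith
  · have h0 : (0:ℝ) ≤ 2 * (1 / √|x|) := by positivity
    rcases eq_or_ne x π with rfl | hx
    · simp
    · have h3 := mul_abs_le_abs_sin (x := x - π) (abs_le.2 ⟨by linarith, by linarith⟩)
      rw [sin_sub_pi, abs_neg] at h3
      have := one_div_sqrt_le_of_mul_le (abs_pos.2 (sub_ne_zero.2 hx)) h3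
      linarith

lemma exists_one_div_sqrt_abs_sin_le {s t : ℝ} (hπ : t - s ≤ π) :
    ∃ a b : ℝ, ∀ x ∈ Set.Icc s t,
      1 / √|sin x| ≤ 2 * (1 / √|x - a|) + 2 * (1 / √|x - b|) := by
  set k : ℤ := ⌊s / π + 1 / 2⌋ with hk
  have h1 : k * π ≤ s + π / 2 := by
    have := Int.floor_le (s / π + 1 / 2)
    rw [← hk] at this
    have h := mul_le_mul_of_nonneg_right this pi_pos.le
    rw [add_mul, div_mul_cancel₀ _ pi_ne_zero] at h
    linarith
  have h2 : s + π / 2 ≤ k * π + π := by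
    have := (Int.lt_floor_add_one (s / π + 1 / 2)).le
    rw [← hk] at this
    have h := mul_le_mul_of_nonneg_right this pi_pos.le
    rw [add_mul, add_mul, div_mul_cancel₀ _ pi_ne_zero] at h
    linarith
  refine ⟨k * π, k * π + π, fun x hx => ?_⟩
  have h := one_div_sqrt_abs_sin_le (x := x - k * π) (by linarith [hx.1]) (by linarith [hx.2])
  rw [sin_sub_int_mul_pi, abs_mul, abs_zpow, abs_neg, abs_one, one_zpow, one_mul, sub_sub] at h
  exact h

lemma intervalIntegrable_one_div_sqrt_abs_sin {s t : ℝ} (hst : s ≤ t) (hπ : t - s ≤ π) :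
    IntervalIntegrable (fun x => 1 / √|sin x|) volume s t ∧
      ∫ x in s..t, 1 / √|sin x| ≤ 16 * √(t - s) := by
  obtain ⟨a, b, hab⟩ := exists_one_div_sqrt_abs_sin_le hπ
  have hi := ((intervalIntegrable_one_div_sqrt_abs a s t).const_mul 2).add
    ((intervalIntegrable_one_div_sqrt_abs b s t).const_mul 2)
  have hs : IntervalIntegrable (fun x => 1 / √|sin x|) volume s t := by
    refine hi.mono_fun' (Measurable.aestronglyMeasurable (by fun_prop)) ?_
    refine (ae_restrict_iff' measurableSet_uIoc).2 (.of_forall fun x hx => ?_)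
    rw [Set.uIoc_of_le hst] at hx
    have h0 : 0 ≤ 1 / √|sin x| := by positivity
    simpa only [Real.norm_of_nonneg h0] using hab x ⟨hx.1.le, hx.2⟩
  refine ⟨hs, (integral_mono_on hst hs hi hab).trans ?_⟩
  rw [intervalIntegral.integral_add ((intervalIntegrable_one_div_sqrt_abs a s t).const_mul 2)
    ((intervalIntegrable_one_div_sqrt_abs b s t).const_mul 2),
    intervalIntegral.integral_const_mul, intervalIntegral.integral_const_mul]
  linarith [integral_one_div_sqrt_abs_le a hst, integral_one_div_sqrt_abs_le b hst]

lemma integral_norm_sub_mul_integral_le {α β : Type*} [MeasurableSpace α] [MeasurableSpace β]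
    {μ : Measure α} {ν : Measure β} [IsFiniteMeasure μ] [SFinite ν] {K : α → β → ℂ}
    (hK : Integrable (Function.uncurry K) (μ.prod ν)) (c : ℂ) :
    ∫ x, ‖(∫ y, K x y ∂ν) - c * ∫ z, ∫ y, K z y ∂ν ∂μ‖ ∂μ ≤
      ∫ y, ∫ x, ‖K x y - c * ∫ z, K z y ∂μ‖ ∂μ ∂ν := by
  have hA : Integrable (fun y => c * ∫ z, K z y ∂μ) ν := hK.integral_prod_right.const_mul c
  have hD : Integrable (Function.uncurry fun x y => ‖K x y - c * ∫ z, K z y ∂μ‖) (μ.prod ν) :=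
    (hK.sub (hA.comp_snd μ)).norm
  rw [← integral_integral_swap hD]
  refine integral_mono_of_nonneg (.of_forall fun _ => norm_nonneg _) hD.integral_prod_left ?_
  filter_upwards [hK.prod_right_ae] with x hx
  replace hx : Integrable (K x) ν := hx
  rw [integral_integral_swap hK, ← MeasureTheory.integral_const_mul,
    ← MeasureTheory.integral_sub hx hA]
  exact norm_integral_le_integral_norm _

/-- The kernel `1 / ((u + e^{iθ}) (1 - log (1 + u)))`. -/
noncomputable def cauchyLogKernel (θ u : ℝ) : ℂ :=
  1 / (((u : ℂ) + Complex.exp ((θ : ℂ) * Complex.I)) * (1 - (Real.log (1 + u) : ℂ)))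

lemma one_add_le_norm_add_exp {u : ℝ} (hu : u ≤ 0) (θ : ℝ) :
    1 + u ≤ ‖(u : ℂ) + Complex.exp ((θ : ℂ) * Complex.I)‖ := by
  have h := norm_sub_le ((u : ℂ) + Complex.exp ((θ : ℂ) * Complex.I)) (u : ℂ)
  rw [add_sub_cancel_left, Complex.norm_exp_ofReal_mul_I, Complex.norm_real, Real.norm_eq_abs,
    abs_of_nonpos hu] at h
  linarith

lemma abs_sin_le_norm_add_exp (u θ : ℝ) :
    |sin θ| ≤ ‖(u : ℂ) + Complex.exp ((θ : ℂ) * Complex.I)‖ := by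
  have h := Complex.abs_im_le_norm ((u : ℂ) + Complex.exp ((θ : ℂ) * Complex.I))
  rwa [Complex.add_im, Complex.ofReal_im, zero_add, Complex.exp_ofReal_mul_I_im] at h

lemma one_le_one_sub_log {u : ℝ} (hu : u ∈ Set.Ioc (-1 : ℝ) 0) : 1 ≤ 1 - log (1 + u) := by
  have := Real.log_nonpos (x := 1 + u) (by linarith [hu.1]) (by linarith [hu.2])
  linarith

lemma norm_one_sub_log {u : ℝ} (hu : u ∈ Set.Ioc (-1 : ℝ) 0) :
    ‖1 - (Real.log (1 + u) : ℂ)‖ = 1 - log (1 + u) := by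
  rw [← Complex.ofReal_one, ← Complex.ofReal_sub, Complex.norm_real, Real.norm_of_nonneg]
  linarith [one_le_one_sub_log hu]

lemma norm_cauchyLogKernel_le {u θ : ℝ} (hu : u ∈ Set.Ioc (-1 : ℝ) 0) (hθ : sin θ ≠ 0) :
    ‖cauchyLogKernel θ u‖ ≤ 1 / (1 - log (1 + u)) * (1 / √|sin θ| * (1 / √(1 + u))) := by
  have h1 := one_le_one_sub_log hu
  have hv : 0 < 1 + u := by linarith [hu.1]
  have hs := abs_pos.2 hθ
  have hn : √|sin θ| * √(1 + u) ≤ ‖(u : ℂ) + Complex.exp ((θ : ℂ) * Complex.I)‖ := by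
    have ha := Real.sqrt_le_sqrt (abs_sin_le_norm_add_exp u θ)
    have hb := Real.sqrt_le_sqrt (one_add_le_norm_add_exp hu.2 θ)
    refine (mul_le_mul ha hb (Real.sqrt_nonneg _) (Real.sqrt_nonneg _)).trans_eq ?_
    exact Real.mul_self_sqrt (norm_nonneg _)
  have hp : 0 < √|sin θ| * √(1 + u) := mul_pos (Real.sqrt_pos.2 hs) (Real.sqrt_pos.2 hv)
  rw [cauchyLogKernel, norm_div, norm_mul, norm_one, norm_one_sub_log hu, one_div_mul_one_div,
    one_div_mul_one_div, mul_comm (1 - _)]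
  exact one_div_le_one_div_of_le (by positivity) (by gcongr)

lemma norm_cauchyLogKernel_sub_le {u : ℝ} (hu : u ∈ Set.Ioc (-1 : ℝ) 0) (θ φ : ℝ) :
    ‖cauchyLogKernel θ u - cauchyLogKernel φ u‖ ≤
      1 / (1 - log (1 + u)) * (|φ - θ| / (1 + u) ^ 2) := by
  have h1 := one_le_one_sub_log hu
  have hv : 0 < 1 + u := by linarith [hu.1]
  have hA := one_add_le_norm_add_exp hu.2 θ
  have hB := one_add_le_norm_add_exp hu.2 φ
  have hL : (1 - (Real.log (1 + u) : ℂ)) ≠ 0 := by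
    rw [← norm_pos_iff, norm_one_sub_log hu]; linarith
  have hA0 := norm_pos_iff.1 (hv.trans_le hA)
  have hB0 := norm_pos_iff.1 (hv.trans_le hB)
  have hE : ‖Complex.exp ((φ : ℂ) * Complex.I) - Complex.exp ((θ : ℂ) * Complex.I)‖ ≤ |φ - θ| := by
    have : Complex.exp ((φ : ℂ) * Complex.I) - Complex.exp ((θ : ℂ) * Complex.I) =
        Complex.exp ((θ : ℂ) * Complex.I) * (Complex.exp (Complex.I * ((φ - θ : ℝ) : ℂ)) - 1) := by
      rw [mul_sub, ← Complex.exp_add, mul_one]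
      congr 2
      push_cast
      ring
    rw [this, norm_mul, Complex.norm_exp_ofReal_mul_I, one_mul]
    exact Real.norm_exp_I_mul_ofReal_sub_one_le
  have heq : cauchyLogKernel θ u - cauchyLogKernel φ u =
      1 / (1 - (Real.log (1 + u) : ℂ)) *
        ((Complex.exp ((φ : ℂ) * Complex.I) - Complex.exp ((θ : ℂ) * Complex.I)) /
        (((u : ℂ) + Complex.exp ((θ : ℂ) * Complex.I)) *
          ((u : ℂ) + Complex.exp ((φ : ℂ) * Complex.I)))) := by
    rw [cauchyLogKernel, cauchyLogKernel]
    generalize Complex.exp ((θ : ℂ) * Complex.I) = a at *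
    generalize Complex.exp ((φ : ℂ) * Complex.I) = b at *
    field_simp
    ring
  rw [heq, norm_mul, norm_div, norm_div, norm_mul, norm_one, norm_one_sub_log hu]
  have h0 : 0 ≤ 1 / (1 - log (1 + u)) := by positivity
  refine mul_le_mul_of_nonneg_left (div_le_div₀ (abs_nonneg _) hE (by positivity) ?_) h0
  nlinarith

lemma continuous_cauchyLogKernel {u : ℝ} (hu : u ∈ Set.Ioc (-1 : ℝ) 0) :
    Continuous fun θ => cauchyLogKernel θ u := by
  have h1 := one_le_one_sub_log hu
  unfold cauchyLogKernel
  refine continuous_const.div (by fun_prop) fun θ => mul_ne_zero ?_ ?_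
  · rw [← norm_pos_iff]
    linarith [hu.1, one_add_le_norm_add_exp hu.2 θ]
  · rw [← norm_pos_iff, norm_one_sub_log hu]; linarith

lemma ae_sin_ne_zero : ∀ᵐ θ : ℝ, sin θ ≠ 0 := by
  have hc : {θ : ℝ | sin θ = 0}.Countable := by
    refine (Set.countable_range fun n : ℤ => (n : ℝ) * π).mono fun θ hθ => ?_
    exact Real.sin_eq_zero_iff.1 hθ
  exact measure_eq_zero_iff_ae_notMem.1 (hc.measure_zero volume)

lemma integrable_cauchyLogKernel {s t : ℝ} (hst : s ≤ t) (hπ : t - s ≤ π) :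
    Integrable (Function.uncurry cauchyLogKernel)
      ((volume.restrict (Set.Ioc s t)).prod (volume.restrict (Set.Ioc (-1 : ℝ) 0))) := by
  have hS : Integrable (fun θ => 1 / √|sin θ|) (volume.restrict (Set.Ioc s t)) :=
    (intervalIntegrable_iff_integrableOn_Ioc_of_le hst).1
      (intervalIntegrable_one_div_sqrt_abs_sin hst hπ).1
  have hV : Integrable (fun u => 1 / √|u - (-1)|) (volume.restrict (Set.Ioc (-1 : ℝ) 0)) :=
    (intervalIntegrable_iff_integrableOn_Ioc_of_le (by norm_num)).1
      (intervalIntegrable_one_div_sqrt_abs (-1) (-1) 0)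
  refine (hS.mul_prod hV).mono' (Measurable.aestronglyMeasurable ?_) ?_
  · unfold Function.uncurry cauchyLogKernel
    fun_prop
  · have h1 := Measure.quasiMeasurePreserving_fst
      (μ := volume.restrict (Set.Ioc s t)) (ν := volume.restrict (Set.Ioc (-1 : ℝ) 0)) |>.ae
      (ae_restrict_of_ae ae_sin_ne_zero)
    have h2 := Measure.quasiMeasurePreserving_snd
      (μ := volume.restrict (Set.Ioc s t)) (ν := volume.restrict (Set.Ioc (-1 : ℝ) 0)) |>.ae
      (ae_restrict_mem measurableSet_Ioc)
    filter_upwards [h1, h2] with p hp1 hp2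
    have hl := one_le_one_sub_log hp2
    have hv : 0 ≤ 1 + p.2 := by linarith [hp2.1]
    rw [sub_neg_eq_add, add_comm p.2 1, abs_of_nonneg hv]
    refine (norm_cauchyLogKernel_le hp2 hp1).trans (mul_le_of_le_one_left (by positivity) ?_)
    rw [div_le_one (by linarith)]
    exact hl

lemma norm_sub_average_le {f : ℝ → ℂ} (hf : Continuous f) {s t M : ℝ} (hst : s < t)
    {x : ℝ} (h : ∀ y ∈ Set.Icc s t, ‖f x - f y‖ ≤ M) :
    ‖f x - ((t : ℂ) - s)⁻¹ * ∫ y in s..t, f y‖ ≤ M := by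
  have hne : ((t : ℂ) - s) ≠ 0 := by
    rw [← Complex.ofReal_sub]
    exact_mod_cast (sub_pos.2 hst).ne'
  have heq : f x - ((t : ℂ) - s)⁻¹ * ∫ y in s..t, f y =
      ((t : ℂ) - s)⁻¹ * ∫ y in s..t, (f x - f y) := by
    rw [intervalIntegral.integral_sub (by simp) (hf.intervalIntegrable s t),
      intervalIntegral.integral_const, Complex.real_smul, Complex.ofReal_sub]
    field_simp
  have hb := intervalIntegral.norm_integral_le_of_norm_le_const (f := fun y => f x - f y)
    (a := s) (b := t) (C := M) fun y hy => by
      rw [Set.uIoc_of_le hst.le] at hy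
      exact h y ⟨hy.1.le, hy.2⟩
  rw [abs_of_pos (sub_pos.2 hst)] at hb
  rw [heq, norm_mul, norm_inv, ← Complex.ofReal_sub, Complex.norm_real,
    Real.norm_of_nonneg (sub_pos.2 hst).le, inv_mul_le_iff₀ (sub_pos.2 hst)]
  linarith

lemma integral_norm_sub_average_le {f : ℝ → ℂ} (hf : Continuous f) {s t : ℝ} (hst : s < t) :
    ∫ x in s..t, ‖f x - ((t : ℂ) - s)⁻¹ * ∫ y in s..t, f y‖ ≤ 2 * ∫ x in s..t, ‖f x‖ := by
  set A := ((t : ℂ) - s)⁻¹ * ∫ y in s..t, f y with hA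
  have hpos := sub_pos.2 hst
  have hAn : (t - s) * ‖A‖ ≤ ∫ x in s..t, ‖f x‖ := by
    rw [hA, norm_mul, norm_inv, ← Complex.ofReal_sub, Complex.norm_real,
      Real.norm_of_nonneg hpos.le, mul_inv_cancel_left₀ hpos.ne']
    exact intervalIntegral.norm_integral_le_integral_norm hst.le
  calc ∫ x in s..t, ‖f x - A‖ ≤ ∫ x in s..t, (‖f x‖ + ‖A‖) :=
        intervalIntegral.integral_mono_on hst.le
          (Continuous.intervalIntegrable (by fun_prop) s t)
          (Continuous.intervalIntegrable (by fun_prop) s t) fun x _ => norm_sub_le _ _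
    _ = (∫ x in s..t, ‖f x‖) + (t - s) * ‖A‖ := by
        rw [intervalIntegral.integral_add (hf.norm.intervalIntegrable s t) (by simp),
          intervalIntegral.integral_const, smul_eq_mul]
    _ ≤ _ := by linarith

lemma log_two_pi_le_two : log (2 * π) ≤ 2 := by
  rw [Real.log_le_iff_le_exp (by positivity)]
  have h : exp 2 = exp 1 * exp 1 := by rw [← Real.exp_add]; norm_num
  rw [h]
  nlinarith [Real.exp_one_gt_d9, Real.pi_lt_d2]

lemma log_two_pi_div_le_of_le {v h : ℝ} (hv : 0 < v) (hv1 : v ≤ 1) (hvh : v ≤ h) :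
    log (2 * π / h) ≤ 2 * (1 - log v) := by
  rw [Real.log_div (by positivity) (hv.trans_le hvh).ne']
  linarith [Real.log_le_log hv hvh, log_two_pi_le_two, Real.log_nonpos hv.le hv1]

lemma log_two_pi_div_le_of_ge {v h : ℝ} (hh : 0 < h) (hv1 : v ≤ 1) (hvh : h ≤ v) :
    log (2 * π / h) ≤ 4 * √(v / h) * (1 - log v) := by
  have hv := hh.trans_le hvh
  have hr : 1 ≤ √(v / h) := by
    rw [Real.one_le_sqrt, le_div_iff₀ hh]
    linarith
  have h1 : log (v / h) ≤ 2 * √(v / h) := by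
    have := Real.log_le_sub_one_of_pos (x := √(v / h)) (by linarith)
    rw [Real.log_sqrt (by positivity)] at this
    linarith
  rw [Real.log_div hv.ne' hh.ne'] at h1
  rw [Real.log_div (by positivity) hh.ne']
  have h2 := log_two_pi_le_two
  have h3 := Real.log_nonpos hv.le hv1
  nlinarith

lemma integral_sqrt_div_le {h : ℝ} (hh : 0 < h) :
    IntegrableOn (fun u => √h / (√(1 + u) * (h + (1 + u)))) (Set.Ioc (-1 : ℝ) 0) ∧
      ∫ u in (-1 : ℝ)..0, √h / (√(1 + u) * (h + (1 + u))) ≤ π := by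
  have hc : ContinuousOn (fun u => 2 * arctan √((1 + u) / h)) (Set.Icc (-1 : ℝ) 0) := by
    fun_prop
  have hd : ∀ u ∈ Set.Ioo (-1 : ℝ) 0, HasDerivAt (fun u => 2 * arctan √((1 + u) / h))
      (√h / (√(1 + u) * (h + (1 + u)))) u := by
    intro u hu
    have hv : 0 < 1 + u := by linarith [hu.1]
    have h1 : HasDerivAt (fun u : ℝ => (1 + u) / h) (1 / h) u :=
      ((hasDerivAt_id u).const_add 1).div_const h
    have h2 := ((h1.sqrt (by positivity)).arctan).const_mul 2
    refine h2.congr_deriv ?_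
    have ha := Real.sqrt_pos.2 hv
    have hb := Real.sqrt_pos.2 hh
    rw [Real.sq_sqrt (by positivity), Real.sqrt_div hv.le]
    have hh' : √h ^ 2 = h := Real.sq_sqrt hh.le
    field_simp
  have hi : IntegrableOn (fun u => √h / (√(1 + u) * (h + (1 + u)))) (Set.Ioc (-1 : ℝ) 0) := by
    refine integrableOn_deriv_of_nonneg hc hd fun u hu => ?_
    have hv : 0 < 1 + u := by linarith [hu.1]
    positivity
  refine ⟨hi, ?_⟩
  rw [integral_eq_sub_of_hasDerivAt_of_le (by norm_num) hc hd
    ((intervalIntegrable_iff_integrableOn_Ioc_of_le (by norm_num)).2 hi)]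
  simp only [add_neg_cancel, zero_div, Real.sqrt_zero, Real.arctan_zero, mul_zero, sub_zero]
  linarith [Real.arctan_lt_pi_div_two √((1 + 0) / h)]

lemma meanOscillation_cauchyLogKernel_le {s t u : ℝ} (hst : s < t) (hπ : t - s ≤ π)
    (hu : u ∈ Set.Ioc (-1 : ℝ) 0) :
    ∫ θ in s..t, ‖cauchyLogKernel θ u - ((t : ℂ) - s)⁻¹ * ∫ φ in s..t, cauchyLogKernel φ u‖ ≤
      (t - s) * (128 / log (2 * π / (t - s)) *
        (√(t - s) / (√(1 + u) * ((t - s) + (1 + u))))) := by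
  have hl := one_le_one_sub_log hu
  have hv : 0 < 1 + u := by linarith [hu.1]
  have hv1 : 1 + u ≤ 1 := by linarith [hu.2]
  have hf := continuous_cauchyLogKernel hu
  have hh : 0 < t - s := sub_pos.2 hst
  have hL : 0 < log (2 * π / (t - s)) := by
    apply Real.log_pos
    rw [lt_div_iff₀ hh]
    linarith [pi_pos]
  have hsv := Real.sqrt_pos.2 hv
  have hsh := Real.sqrt_pos.2 hh
  have hsh2 := Real.sq_sqrt hh.le
  have hsv2 := Real.sq_sqrt hv.le
  rcases le_total (1 + u) (t - s) with hc | hc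
  · have hw := log_two_pi_div_le_of_le hv hv1 hc
    refine (integral_norm_sub_average_le hf hst).trans ?_
    obtain ⟨hSi, hSle⟩ := intervalIntegrable_one_div_sqrt_abs_sin hst.le hπ
    have h1 : ∫ θ in s..t, ‖cauchyLogKernel θ u‖ ≤
        1 / (1 - log (1 + u)) * ((16 * √(t - s)) * (1 / √(1 + u))) := by
      have h2 : ∫ θ in s..t, ‖cauchyLogKernel θ u‖ ≤
          ∫ θ in s..t, 1 / (1 - log (1 + u)) * (1 / √|sin θ| * (1 / √(1 + u))) := by
        refine intervalIntegral.integral_mono_ae hst.le (hf.norm.intervalIntegrable s t)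
          ((hSi.mul_const _).const_mul _) ?_
        filter_upwards [ae_sin_ne_zero] with θ hθ
        exact norm_cauchyLogKernel_le hu hθ
      refine h2.trans ?_
      rw [intervalIntegral.integral_const_mul, intervalIntegral.integral_mul_const]
      gcongr
    have h3 : 1 / (1 - log (1 + u)) ≤ 2 / log (2 * π / (t - s)) := by
      rw [div_le_div_iff₀ (by linarith) hL]
      linarith
    calc 2 * ∫ θ in s..t, ‖cauchyLogKernel θ u‖
        ≤ 2 * (2 / log (2 * π / (t - s)) * ((16 * √(t - s)) * (1 / √(1 + u)))) := by
          refine mul_le_mul_of_nonneg_left (h1.trans ?_) (by norm_num)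
          exact mul_le_mul_of_nonneg_right h3 (by positivity)
      _ = 64 / log (2 * π / (t - s)) * (√(t - s) / √(1 + u)) := by ring
      _ ≤ 64 / log (2 * π / (t - s)) * (√(t - s) / √(1 + u)) *
            (2 * (t - s) / ((t - s) + (1 + u))) := by
          refine le_mul_of_one_le_right (by positivity) ?_
          rw [one_le_div (by positivity)]
          linarith
      _ = _ := by field_simp; ring
  · have hw := log_two_pi_div_le_of_ge hh hv1 hc
    have h3 : 1 / (1 - log (1 + u)) ≤ 4 * √((1 + u) / (t - s)) / log (2 * π / (t - s)) := by
      rw [div_le_div_iff₀ (by linarith) hL]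
      linarith
    have hM : ∀ θ ∈ Set.Icc s t,
        ‖cauchyLogKernel θ u - ((t : ℂ) - s)⁻¹ * ∫ φ in s..t, cauchyLogKernel φ u‖ ≤
          1 / (1 - log (1 + u)) * ((t - s) / (1 + u) ^ 2) := by
      intro θ hθ
      refine norm_sub_average_le hf hst fun φ hφ => (norm_cauchyLogKernel_sub_le hu θ φ).trans ?_
      have : |φ - θ| ≤ t - s := abs_le.2 ⟨by linarith [hθ.2, hφ.1], by linarith [hθ.1, hφ.2]⟩
      gcongr
    have h4 := intervalIntegral.integral_mono_on (μ := volume) hst.le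
      (Continuous.intervalIntegrable (by fun_prop) s t) intervalIntegrable_const hM
    refine h4.trans ?_
    rw [intervalIntegral.integral_const, smul_eq_mul]
    refine mul_le_mul_of_nonneg_left ?_ hh.le
    calc 1 / (1 - log (1 + u)) * ((t - s) / (1 + u) ^ 2)
        ≤ 4 * √((1 + u) / (t - s)) / log (2 * π / (t - s)) * ((t - s) / (1 + u) ^ 2) :=
          mul_le_mul_of_nonneg_right h3 (by positivity)
      _ = 4 / log (2 * π / (t - s)) * (√(t - s) / (√(1 + u) * (1 + u))) := by
          rw [Real.sqrt_div hv.le]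
          generalize √(t - s) = a at *
          generalize √(1 + u) = b at *
          rw [← hsh2, ← hsv2]
          field_simp
      _ ≤ 4 / log (2 * π / (t - s)) * (√(t - s) / (√(1 + u) * (1 + u))) *
            (32 * (1 + u) / ((t - s) + (1 + u))) := by
          refine le_mul_of_one_le_right (by positivity) ?_
          rw [one_le_div (by positivity)]
          linarith
      _ = _ := by field_simp; ring

/-- `F(θ) = ∫_{-1}^0 dt/((t+e^{iθ})(1-log(1+t)))` (the boundary value
`Qã(-e^{iθ})`) belongs to `BMO_log`: there is `C > 0` such that for every interval
`I = [s,t]` with `0 < t - s ≤ π`, `MO_I(F) ≤ C / log(2π/(t-s))`. -/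
theorem Q_tilde_a_boundary_mem_BMO_log :
    ∃ C : ℝ, 0 < C ∧ ∀ s t : ℝ, s < t → t - s ≤ π →
      (1 / (t - s)) * ∫ θ in s..t,
          ‖(∫ u in (-1:ℝ)..0,
                1 / (((u : ℂ) + Complex.exp ((θ : ℂ) * Complex.I)) *
                  (1 - (Real.log (1 + u) : ℂ)))) -
            (((t - s) : ℂ))⁻¹ * ∫ φ in s..t, ∫ u in (-1:ℝ)..0,
                1 / (((u : ℂ) + Complex.exp ((φ : ℂ) * Complex.I)) *
                  (1 - (Real.log (1 + u) : ℂ)))‖ ≤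
        C / Real.log (2 * π / (t - s)) := by
  refine ⟨128 * π, by positivity, fun s t hst hπ => ?_⟩
  have hh : 0 < t - s := sub_pos.2 hst
  have hK := integrable_cauchyLogKernel hst.le hπ
  have h1 := integral_norm_sub_mul_integral_le hK ((t : ℂ) - s)⁻¹
  have hL : 0 < log (2 * π / (t - s)) := by
    apply Real.log_pos
    rw [lt_div_iff₀ hh]
    linarith [pi_pos]
  obtain ⟨hBi, hBle⟩ := integral_sqrt_div_le hh
  simp only [← intervalIntegral.integral_of_le hst.le,
    ← intervalIntegral.integral_of_le (show (-1 : ℝ) ≤ 0 by norm_num)] at h1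
  have h2 : ∫ u in (-1 : ℝ)..0, ∫ θ in s..t,
      ‖cauchyLogKernel θ u - ((t : ℂ) - s)⁻¹ * ∫ φ in s..t, cauchyLogKernel φ u‖ ≤
      ∫ u in (-1 : ℝ)..0, (t - s) * (128 / log (2 * π / (t - s)) *
        (√(t - s) / (√(1 + u) * ((t - s) + (1 + u))))) := by
    rw [intervalIntegral.integral_of_le (by norm_num), intervalIntegral.integral_of_le (by norm_num)]
    refine integral_mono_of_nonneg
      (.of_forall fun u => intervalIntegral.integral_nonneg hst.le fun _ _ => norm_nonneg _)
      ((hBi.const_mul _).const_mul _) ?_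
    filter_upwards [ae_restrict_mem measurableSet_Ioc] with u hu
    exact meanOscillation_cauchyLogKernel_le hst hπ hu
  rw [intervalIntegral.integral_const_mul, intervalIntegral.integral_const_mul] at h2
  have h3 := h1.trans h2
  unfold cauchyLogKernel at h3
  rw [one_div, inv_mul_le_iff₀ hh]
  refine h3.trans (mul_le_mul_of_nonneg_left ?_ hh.le)
  calc _ ≤ 128 / log (2 * π / (t - s)) * π := mul_le_mul_of_nonneg_left hBle (by positivity)
    _ = _ := by ring
end
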